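/- arXiv:2504.19304 — 4 statements merged into one kernel-verified Lean document; each statement's English description precedes it below -/
import Mathlib

section
/- Let p be a prime and let F be a family of subsets of {1,...,n} such that the intersection of any p (not necessarily distinct) members of F has cardinality divisible by p. Then |F| ≤ 2^⌊n/p⌋. -/
open Submodule

/-- The (Schur / coordinatewise) product of two subspaces of `Fin n → K`. -/
def schurMul {K : Type*} [CommRing K] {n : ℕ} (C D : Submodule K (Fin n → K)) :
    Submodule K (Fin n → K) :=
  Submodule.span K {x | ∃ c ∈ C, ∃ d ∈ D, x = c * d}

/-- `schurPow C k` is the `(k+1)`-st Schur power `C^⟨k+1⟩`; so `schurPow C 0 = C^⟨1⟩ = C`. -/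
def schurPow {K : Type*} [CommRing K] {n : ℕ} (C : Submodule K (Fin n → K)) :
    ℕ → Submodule K (Fin n → K)
  | 0 => C
  | k + 1 => schurMul (schurPow C k) C

/-- The stabiliser `St(E) = {x : x * E ⊆ E}` of a subspace, itself a subspace. -/
def stab {K : Type*} [CommRing K] {n : ℕ} (E : Submodule K (Fin n → K)) :
    Submodule K (Fin n → K) where
  carrier := {x | ∀ e ∈ E, x * e ∈ E}
  add_mem' := fun {a b} ha hb e he => by simpa [add_mul] using E.add_mem (ha e he) (hb e he)
  zero_mem' := fun e he => by simp
  smul_mem' := fun c {x} hx e he => by simpa [smul_mul_assoc] using E.smul_mem c (hx e he)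

/-- Support of a subspace of `Fin n → K`. -/
def suppS {K : Type*} [CommRing K] {n : ℕ} (C : Submodule K (Fin n → K)) : Set (Fin n) :=
  {i | ∃ v ∈ C, v i ≠ 0}

/-- Characteristic vector of a finite set. -/
def charVec (R : Type*) [Zero R] [One R] {n : ℕ} (A : Finset (Fin n)) : Fin n → R :=
  fun i => if i ∈ A then 1 else 0

/-- `𝓕` is `k`-wise `ℓ`-divisible: every intersection of `k` (not necessarily distinct)
members of `𝓕` has cardinality divisible by `ℓ`. -/
def kWiseDiv (n k ℓ : ℕ) (𝓕 : Finset (Finset (Fin n))) : Prop :=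
  ∀ A : Fin k → Finset (Fin n), (∀ i, A i ∈ 𝓕) → ℓ ∣ (Finset.univ.inf A).card

/-- Support of a set family. -/
def famSupp {n : ℕ} (ℱ : Set (Finset (Fin n))) : Set (Fin n) :=
  ⋃ B ∈ ℱ, (B : Set (Fin n))

/-- `A` is an atom of the family `ℱ`: a nonempty subset of the support such that every
member of `ℱ` contains `A` or is disjoint from it, maximal with this property. -/
def IsAtomOf {n : ℕ} (ℱ : Set (Finset (Fin n))) (A : Finset (Fin n)) : Prop :=
  A.Nonempty ∧ (A : Set (Fin n)) ⊆ famSupp ℱ ∧ (∀ B ∈ ℱ, A ⊆ B ∨ Disjoint A B) ∧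
    ∀ A' : Finset (Fin n), A ⊆ A' → (A' : Set (Fin n)) ⊆ famSupp ℱ →
      (∀ B ∈ ℱ, A' ⊆ B ∨ Disjoint A' B) → A' = A

/-- The family `ℱ^r` of all `r`-fold intersections of members of `ℱ`. -/
def interFam {n : ℕ} (ℱ : Set (Finset (Fin n))) (r : ℕ) : Set (Finset (Fin n)) :=
  {S | ∃ f : Fin r → Finset (Fin n), (∀ i, f i ∈ ℱ) ∧ S = Finset.univ.inf f}

/-- The linear map sending `v` to its restriction (indicator) on a coordinate set `S`. -/
noncomputable def indicatorMapL {K : Type*} [CommRing K] {n : ℕ} (S : Set (Fin n)) :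
    (Fin n → K) →ₗ[K] (Fin n → K) where
  toFun v := S.indicator v
  map_add' a b := by
    funext i; by_cases h : i ∈ S <;> simp [Set.indicator_apply, h]
  map_smul' c a := by
    funext i; by_cases h : i ∈ S <;> simp [Set.indicator_apply, h]

/-- Restriction (projection) of a subspace `V` to the coordinates in `S`. -/
noncomputable def restrTo {K : Type*} [CommRing K] {n : ℕ} (S : Set (Fin n))
    (V : Submodule K (Fin n → K)) : Submodule K (Fin n → K) :=
  V.map (indicatorMapL S)


section Helpers

open Module

variable {K : Type} [Field K] {X : Type} [Fintype X]

/-- Class relation of a subalgebra of `X → K`. -/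
def subRel (S : Subalgebra K (X → K)) (x y : X) : Prop := ∀ s ∈ S, s x = s y

lemma subRel_symm {S : Subalgebra K (X → K)} {x y : X} (h : subRel S x y) : subRel S y x :=
  fun s hs => (h s hs).symm

open Classical in
/-- indicator of the class of `x`. -/
noncomputable def clsInd (S : Subalgebra K (X → K)) (x : X) : X → K :=
  fun z => if subRel S x z then 1 else 0

lemma clsInd_mem (S : Subalgebra K (X → K)) (x : X) : clsInd S x ∈ S := by
  classical
  have h : ∀ y : X, ∃ t ∈ S, t x = 1 ∧ (¬ subRel S x y → t y = 0) := by
    intro y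
    by_cases hy : subRel S x y
    · exact ⟨1, S.one_mem, rfl, fun h => absurd hy h⟩
    · have hy' := hy
      unfold subRel at hy'
      push Not at hy'
      obtain ⟨s, hs, hne⟩ := hy'
      have hne' : s x - s y ≠ 0 := sub_ne_zero.mpr hne
      refine ⟨(s x - s y)⁻¹ • (s - algebraMap K (X → K) (s y)), ?_, ?_, ?_⟩
      · exact S.smul_mem (S.sub_mem hs (S.algebraMap_mem _)) _
      · simp [hne']
      · intro _; simp
  choose t ht ht1 ht0 using h
  have hp : (∏ y, t y) ∈ S := S.prod_mem fun y _ => ht y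
  convert hp using 1
  funext z
  by_cases hz : subRel S x z
  · rw [← hz _ hp]
    simp [clsInd, hz, Finset.prod_apply, ht1]
  · simp only [clsInd, hz, if_false, Finset.prod_apply]
    exact (Finset.prod_eq_zero (f := fun c => t c z) (Finset.mem_univ z) (ht0 z hz)).symm

lemma mem_of_rel (S : Subalgebra K (X → K)) (f : X → K)
    (hf : ∀ x y, subRel S x y → f x = f y) : f ∈ S := by
  classical
  let st : Setoid X := ⟨subRel S, fun _ _ _ => rfl, subRel_symm,
    fun h1 h2 s hs => (h1 s hs).trans (h2 s hs)⟩
  have : f = ∑ q : Quotient st, f q.out • clsInd S q.out := by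
    funext z
    rw [Finset.sum_apply, Finset.sum_eq_single (Quotient.mk st z)]
    · have : subRel S (Quotient.mk st z).out z := Quotient.mk_out z
      simp [clsInd, this, hf _ _ this]
    · intro q _ hq
      have : ¬ subRel S q.out z := by
        intro h
        apply hq
        rw [← q.out_eq]
        exact Quotient.sound h
      simp [clsInd, this]
    · simp
  rw [this]
  exact S.sum_mem fun q _ => S.smul_mem (clsInd_mem S _) _

instance finite_subalg : Finite (Subalgebra K (X → K)) := by
  refine Finite.of_injective (β := X → X → Prop) (fun S => subRel S) ?_
  intro S T h
  simp only at h
  ext f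
  constructor
  · intro hf
    exact mem_of_rel T f fun x y hxy => by rw [← h] at hxy; exact hxy f hf
  · intro hf
    exact mem_of_rel S f fun x y hxy => by rw [h] at hxy; exact hxy f hf

lemma cover [Infinite K] {ι : Type} [Finite ι] (A : Submodule K (X → K)) (hA : 1 ∈ A)
    (Q : ι → Submodule K (X → K))
    (h : ∀ a ∈ A, (∀ x, a x ≠ 0) → ∃ i, a ∈ Q i) : ∃ i, A ≤ Q i := by
  let P : X ⊕ ι → Submodule K A := fun j => match j with
    | .inl x => (LinearMap.ker (LinearMap.proj (R := K) (φ := fun _ : X => K) x)).comap A.subtype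
    | .inr i => (Q i).comap A.subtype
  have hc : ⋃ j, (P j : Set A) = Set.univ := by
    rw [Set.eq_univ_iff_forall]
    intro a
    rw [Set.mem_iUnion]
    by_cases ha : ∀ x, a.1 x ≠ 0
    · obtain ⟨i, hi⟩ := h a.1 a.2 ha
      exact ⟨.inr i, hi⟩
    · push Not at ha
      obtain ⟨x, hx⟩ := ha
      exact ⟨.inl x, by simpa [P] using hx⟩
  obtain ⟨j, hj⟩ := Subspace.exists_eq_top_of_iUnion_eq_univ hc
  rcases j with x | i
  · exfalso
    have : (⟨1, hA⟩ : A) ∈ P (.inl x) := by rw [hj]; trivial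
    simp [P] at this
  · refine ⟨i, fun a ha => ?_⟩
    have : (⟨a, ha⟩ : A) ∈ P (.inr i) := by rw [hj]; trivial
    simpa [P] using this

lemma finrank_mulmap (e f : X → K) (hef : e * f = 1) (A : Submodule K (X → K)) :
    finrank K (A.map (LinearMap.mulRight K e)) = finrank K A := by
  have hinj : Function.Injective (LinearMap.mulRight K e) := by
    intro a b hab
    simp only [LinearMap.mulRight_apply] at hab
    calc a = a * (e * f) := by rw [hef, mul_one]
      _ = b * (e * f) := by rw [← mul_assoc, hab, mul_assoc]
      _ = b := by rw [hef, mul_one]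
  exact (Submodule.equivMapOfInjective _ hinj A).finrank_eq.symm

lemma exists_inv (e : X → K) (he : ∀ x, e x ≠ 0) : ∃ f : X → K, e * f = 1 :=
  ⟨e⁻¹, by funext x; simp [he x]⟩

lemma etrans [Infinite K] (N : ℕ) : ∀ (A B : Submodule K (X → K)), finrank K A ≤ N → 1 ∈ A → 1 ∈ B →
    ∃ (H : Subalgebra K (X → K)) (V : Submodule K (X → K)), B ≤ V ∧ V ≤ A * B ∧
      V * Subalgebra.toSubmodule H ≤ V ∧ finrank K A + finrank K B ≤ finrank K V + finrank K H := by
  induction N with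
  | zero =>
    intro A B hN hA hB
    refine ⟨⊥, B, le_rfl, ?_, ?_, ?_⟩
    · exact fun b hb => by simpa using Submodule.mul_mem_mul hA hb
    · rw [Algebra.toSubmodule_bot, mul_one]
    · omega
  | succ N ih =>
    intro A B hN hA hB
    by_cases hall : ∀ e ∈ B, (∀ x, e x ≠ 0) → A.map (LinearMap.mulRight K e) ≤ B
    · refine ⟨Algebra.adjoin K (A : Set (X → K)), B, le_rfl, ?_, ?_, ?_⟩
      · exact fun b hb => by simpa using Submodule.mul_mem_mul hA hb
      · have h1 : B ≤ B / A := by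
          obtain ⟨_, h⟩ := cover (ι := Unit) B hB (fun _ => B / A) (by
            intro e he hex
            refine ⟨(), ?_⟩
            rw [Submodule.mem_div_iff_forall_mul_mem]
            intro a ha
            have := hall e he hex (Submodule.mem_map_of_mem ha)
            simpa [mul_comm] using this)
          exact h
        rw [Submodule.mul_le]
        intro b hb h hh
        induction hh using Algebra.adjoin_induction generalizing b with
        | mem x hx => exact (Submodule.mem_div_iff_forall_mul_mem.mp (h1 hb)) x hx
        | algebraMap r =>
          rw [mul_comm, ← Algebra.smul_def]; exact B.smul_mem _ hb
        | add x y _ _ hx hy => rw [mul_add]; exact B.add_mem (hx b hb) (hy b hb)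
        | mul x y _ _ hx hy => rw [← mul_assoc]; exact hy _ (hx b hb)
      · have : A ≤ Subalgebra.toSubmodule (Algebra.adjoin K (A : Set (X → K))) :=
          Algebra.subset_adjoin
        have := Submodule.finrank_mono this
        have h2 : finrank K (Subalgebra.toSubmodule (Algebra.adjoin K (A : Set (X → K)))) =
          finrank K (Algebra.adjoin K (A : Set (X → K))) := rfl
        omega
    · push Not at hall
      obtain ⟨e, heB, hex, hnot⟩ := hall
      obtain ⟨f, hef⟩ := exists_inv e hex
      set A' := A ⊓ B.comap (LinearMap.mulRight K e) with hA'
      set Ae := A.map (LinearMap.mulRight K e) with hAe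
      have hlt : A' < A := by
        refine lt_of_le_of_ne inf_le_left fun h => hnot ?_
        rw [hAe, Submodule.map_le_iff_le_comap]
        exact inf_eq_left.mp h
      have hfl := Submodule.finrank_lt_finrank_of_lt hlt
      have hmap : A'.map (LinearMap.mulRight K e) = Ae ⊓ B := by
        ext v
        constructor
        · rintro ⟨a, ha, rfl⟩
          exact ⟨⟨a, ha.1, rfl⟩, ha.2⟩
        · rintro ⟨⟨a, ha, rfl⟩, hv⟩
          exact ⟨a, ⟨ha, hv⟩, rfl⟩
      have hd := Submodule.finrank_sup_add_finrank_inf_eq Ae B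
      have hm1 : finrank K Ae = finrank K A := finrank_mulmap e f hef A
      have hm2 := finrank_mulmap e f hef A'
      rw [hmap] at hm2
      obtain ⟨H, V, h1, h2, h3, h4⟩ := ih A' (Ae ⊔ B) (by omega)
        ⟨hA, by simpa using heB⟩ (Submodule.mem_sup_right hB)
      refine ⟨H, V, le_sup_right.trans h1, h2.trans ?_, h3, by omega⟩
      rw [Submodule.mul_le]
      intro a ha b hb
      obtain ⟨c, hc, d, hd, rfl⟩ := Submodule.mem_sup.mp hb
      obtain ⟨c', hc', rfl⟩ := hc
      rw [mul_add]
      refine (A * B).add_mem ?_ (Submodule.mul_mem_mul ha.1 hd)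
      have : a * (LinearMap.mulRight K e) c' = c' * (a * e) := by
        simp only [LinearMap.mulRight_apply]; ring
      rw [this]
      exact Submodule.mul_mem_mul hc' ha.2

lemma kneser [Infinite K] (A B : Submodule K (X → K)) (hA : 1 ∈ A) (hB : 1 ∈ B) :
    ∃ H : Subalgebra K (X → K), A * B * Subalgebra.toSubmodule H ≤ A * B ∧
      finrank K A + finrank K B ≤ finrank K ↥(A * B) + finrank K H := by
  let M : Subalgebra K (X → K) → Submodule K (X → K) :=
    fun H => (A * B) / Subalgebra.toSubmodule H
  obtain ⟨⟨H, hH⟩, hi⟩ := cover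
    (ι := {H : Subalgebra K (X → K) // finrank K A + finrank K B ≤ finrank K (M H) + finrank K H})
    A hA (fun H => M H.1 / B) (by
      intro a ha hax
      obtain ⟨f, haf⟩ := exists_inv a hax
      have hfa : f * a = 1 := by rw [mul_comm, haf]
      obtain ⟨H, V, h1, h2, h3, h4⟩ := etrans _ (A.map (LinearMap.mulRight K f)) B le_rfl
        ⟨a, ha, haf⟩ hB
      have hVM : V.map (LinearMap.mulRight K a) ≤ M H := by
        rw [Submodule.map_le_iff_le_comap]
        intro v hv
        change v * a ∈ (A * B) / Subalgebra.toSubmodule H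
        rw [Submodule.mem_div_iff_forall_mul_mem]
        intro h hh
        have hvh := h2 (h3 (Submodule.mul_mem_mul hv hh))
        have : (A.map (LinearMap.mulRight K f)) * B ≤ (A * B).comap (LinearMap.mulRight K a) := by
          rw [Submodule.mul_le]
          rintro _ ⟨c, hc, rfl⟩ b hb
          have : c * f * b * a = c * b := by
            calc c * f * b * a = c * b * (f * a) := by ring
              _ = c * b := by rw [hfa, mul_one]
          simp only [Submodule.mem_comap, LinearMap.mulRight_apply, this]
          exact Submodule.mul_mem_mul hc hb
        have := this hvh
        simp only [Submodule.mem_comap, LinearMap.mulRight_apply] at this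
        convert this using 1
        ring
      have hm1 := finrank_mulmap f a hfa A
      have hm2 := finrank_mulmap a f haf V
      have hm3 := Submodule.finrank_mono hVM
      refine ⟨⟨H, by omega⟩, ?_⟩
      rw [Submodule.mem_div_iff_forall_mul_mem]
      intro b hb
      have := hVM (Submodule.mem_map_of_mem (h1 hb))
      simpa [mul_comm] using this)
  have h5 : A * B * Subalgebra.toSubmodule H ≤ A * B := by
    rw [← Submodule.le_div_iff_mul_le, ← Submodule.le_div_iff_mul_le]
    exact hi
  refine ⟨H, h5, hH.trans ?_⟩
  have : M H ≤ A * B := by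
    intro m hm
    have := (Submodule.mem_div_iff_forall_mul_mem.mp hm) 1 H.one_mem
    simpa using this
  have := Submodule.finrank_mono this
  omega

lemma pow_bound [Infinite K] (U : Submodule K (X → K)) (hU : 1 ∈ U) (k : ℕ)
    (hst : ∀ H : Subalgebra K (X → K), U ^ k * Subalgebra.toSubmodule H ≤ U ^ k → finrank K H ≤ 1)
    (j : ℕ) (hj : j + 1 ≤ k) :
    (j + 1) * finrank K U ≤ finrank K ↥(U ^ (j + 1)) + j := by
  induction j with
  | zero => rw [zero_add, pow_one]; omega
  | succ j ih =>
    have ih := ih (by omega)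
    have h1 : (1 : X → K) ∈ U ^ (j + 1) := by
      have := Submodule.pow_mem_pow U hU (j + 1)
      simpa using this
    obtain ⟨H, h2, h3⟩ := kneser (U ^ (j + 1)) U h1 hU
    rw [← pow_succ] at h2 h3
    have h4 := hst H (by
      obtain ⟨m, rfl⟩ := Nat.exists_eq_add_of_le hj
      calc U ^ (j + 1 + 1 + m) * Subalgebra.toSubmodule H
          = U ^ m * (U ^ (j + 1 + 1) * Subalgebra.toSubmodule H) := by rw [pow_add]; ring
        _ ≤ U ^ m * U ^ (j + 1 + 1) := mul_le_mul_right h2 _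
        _ = _ := by rw [← pow_add, add_comm])
    have : (j + 1 + 1) * finrank K U = (j + 1) * finrank K U + finrank K U := by ring
    omega

/-- restriction of functions -/
def restrA (s : Set X) : (X → K) →ₐ[K] (s → K) :=
  AlgHom.pi (fun i => Pi.evalAlgHom K _ i.1)

end Helpers

lemma main_bound {K : Type} [Field K] [Infinite K] (p : ℕ) (hp : p.Prime) [CharP K p] (N : ℕ) :
    ∀ (X : Type) [Fintype X] (V : Submodule K (X → K)), Fintype.card X ≤ N → 1 ∈ V →
      (∀ w ∈ V ^ p, ∑ x, w x = 0) → p * Module.finrank K V ≤ Fintype.card X := by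
  classical
  induction N with
  | zero =>
    intro X _ V hN hV hw
    have h1 := Submodule.finrank_le V
    rw [Module.finrank_pi] at h1
    have : Module.finrank K V = 0 := by omega
    simp [this]
  | succ N ih =>
    intro X _ V hN hV hw
    by_cases hst : ∀ H : Subalgebra K (X → K), V ^ p * Subalgebra.toSubmodule H ≤ V ^ p →
        Module.finrank K H ≤ 1
    · have hp1 := hp.one_lt
      have h1 := pow_bound V hV p hst (p - 1) (by omega)
      rw [show p - 1 + 1 = p by omega] at h1
      have hone : (1 : X → K) ∈ V ^ p := by
        simpa using Submodule.pow_mem_pow V hV p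
      have hdvd : p ∣ Fintype.card X := by
        have := hw 1 hone
        simp only [Pi.one_apply, Finset.sum_const, Finset.card_univ, nsmul_eq_mul, mul_one] at this
        exact (CharP.cast_eq_zero_iff K p _).mp this
      rcases isEmpty_or_nonempty X with hX | ⟨⟨x0⟩⟩
      · have h1 := Submodule.finrank_le V
        rw [Module.finrank_pi, Fintype.card_eq_zero] at h1
        have : Module.finrank K V = 0 := by omega
        simp [this]
      have hlt : V ^ p < ⊤ := by
        rw [lt_top_iff_ne_top]
        intro h
        have := hw (Pi.single x0 1) (by rw [h]; trivial)
        simp at this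
      have h2 := Submodule.finrank_lt hlt.ne
      rw [Module.finrank_pi] at h2
      obtain ⟨c, hc⟩ := hdvd
      rw [hc] at h2 ⊢
      apply Nat.mul_le_mul_left
      by_contra hcon
      push Not at hcon
      have : p * (c + 1) ≤ p * Module.finrank K V := Nat.mul_le_mul_left _ hcon
      rw [mul_add] at this
      omega
    · push Not at hst
      obtain ⟨H, hH, hH1⟩ := hst
      have hne : ∃ x y, ¬ subRel H x y := by
        by_contra hcon
        push Not at hcon
        have : H ≤ ⊥ := by
          intro f hf
          rcases isEmpty_or_nonempty X with hX | ⟨⟨x0⟩⟩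
          · rw [Subsingleton.elim f 0]; exact Subalgebra.zero_mem _
          · rw [Algebra.mem_bot]
            exact ⟨f x0, by funext z; exact hcon x0 z f hf⟩
        have h3 := Submodule.finrank_mono (R := K) (M := X → K)
          (s := Subalgebra.toSubmodule H) (t := Subalgebra.toSubmodule ⊥) this
        have h4 : Module.finrank K (Subalgebra.toSubmodule (⊥ : Subalgebra K (X → K))) ≤ 1 := by
          rw [Algebra.toSubmodule_bot, Submodule.one_eq_span]
          exact (finrank_span_le_card _).trans (by simp)
        have h5 : Module.finrank K (Subalgebra.toSubmodule H) = Module.finrank K H := rfl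
        omega
      obtain ⟨x, y, hxy⟩ := hne
      set e := clsInd H x with he
      have heH : e ∈ H := clsInd_mem H x
      have key : ∀ s : Set X, (s.indicator (1 : X → K)) ∈ H → s.ncard ≤ N →
          p * Module.finrank K (V.map (restrA (K := K) s).toLinearMap) ≤ s.ncard := by
        intro s hs hsN
        rw [← Nat.card_coe_set_eq, Nat.card_eq_fintype_card] at hsN ⊢
        apply ih s _ hsN
        · exact ⟨1, hV, by simp⟩
        · rw [← Submodule.map_pow]
          rintro _ ⟨w, hwp, rfl⟩
          have := hw _ (hH (Submodule.mul_mem_mul hwp hs))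
          rw [← this]
          change ∑ i : s, w i.1 = _
          rw [← Finset.sum_subtype (Finset.univ.filter (· ∈ s)) (by simp) w, Finset.sum_filter]
          refine Finset.sum_congr rfl fun z _ => ?_
          by_cases hz : z ∈ s <;> simp [hz]
      set s : Set X := {z | subRel H x z} with hs
      have e1 : s.indicator (1 : X → K) = clsInd H x := by
        funext z
        by_cases hz : subRel H x z <;> simp [Set.indicator, clsInd, hs, hz]
      have e2 : sᶜ.indicator (1 : X → K) = 1 - clsInd H x := by
        rw [← e1, Set.indicator_compl]
      have hc : s.ncard + sᶜ.ncard = Fintype.card X := by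
        rw [Set.ncard_add_ncard_compl, Nat.card_eq_fintype_card]
      have hp1 : 0 < s.ncard := (Set.ncard_pos).mpr ⟨x, fun _ _ => rfl⟩
      have hp2 : 0 < sᶜ.ncard := (Set.ncard_pos).mpr ⟨y, hxy⟩
      have k1 := key s (by rw [e1]; exact heH) (by omega)
      have k2 := key sᶜ (by rw [e2]; exact H.sub_mem H.one_mem heH) (by omega)
      have hfin : Module.finrank K V ≤ Module.finrank K (V.map (restrA (K := K) s).toLinearMap) +
          Module.finrank K (V.map (restrA (K := K) sᶜ).toLinearMap) := by
        rw [← Module.finrank_prod]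
        let φ : V →ₗ[K] _ := LinearMap.prod ((restrA (K := K) s).toLinearMap.submoduleMap V)
          ((restrA (K := K) sᶜ).toLinearMap.submoduleMap V)
        refine LinearMap.finrank_le_finrank_of_injective (f := φ) ?_
        intro u v huv
        have h1 := congrArg (fun t => t.1.1) huv
        have h2 := congrArg (fun t => t.2.1) huv
        ext z
        by_cases hz : z ∈ s
        · exact congrFun h1 ⟨z, hz⟩
        · exact congrFun h2 ⟨z, hz⟩
      calc p * Module.finrank K V ≤ _ := Nat.mul_le_mul_left _ hfin
        _ ≤ Fintype.card X := by rw [mul_add]; omega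

lemma odlyzko {K : Type} [Field K] {X : Type} [Fintype X] (V : Submodule K (X → K))
    (S : Finset (X → K)) (hS : ∀ v ∈ S, v ∈ V) (h01 : ∀ v ∈ S, ∀ x, v x = 0 ∨ v x = 1) :
    S.card ≤ 2 ^ Module.finrank K V := by
  classical
  let ev : X → Module.Dual K V := fun x => (LinearMap.proj x).comp V.subtype
  obtain ⟨b, hb, hspan, hli⟩ := exists_linearIndependent K (Set.range ev)
  have hbf : b.Finite := (Set.finite_range ev).subset hb
  have : Fintype b := hbf.fintype
  have hcard : Fintype.card b ≤ Module.finrank K V := by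
    have := hli.fintype_card_le_finrank
    rwa [Subspace.dual_finrank_eq] at this
  let g : S → (b → Prop) := fun v i => i.1 ⟨v.1, hS v.1 v.2⟩ = 1
  have hg : Function.Injective g := by
    intro u v huv
    have hbv : ∀ i ∈ b, i ⟨u.1, hS _ u.2⟩ = i ⟨v.1, hS _ v.2⟩ := by
      intro i hi
      obtain ⟨x, rfl⟩ := hb hi
      have h1 : (ev x ⟨u.1, hS _ u.2⟩ = 1) = (ev x ⟨v.1, hS _ v.2⟩ = 1) :=
        congrFun huv ⟨ev x, hi⟩
      change (u.1 x = 1) = (v.1 x = 1) at h1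
      change u.1 x = v.1 x
      rcases h01 _ u.2 x with h | h <;> rcases h01 _ v.2 x with h' | h' <;> simp_all
    have hsp : ∀ i ∈ Submodule.span K b, i ⟨u.1, hS _ u.2⟩ = i ⟨v.1, hS _ v.2⟩ := by
      intro i hi
      induction hi using Submodule.span_induction with
      | mem x hx => exact hbv x hx
      | zero => simp
      | add x y _ _ hx hy => simp [hx, hy]
      | smul c x _ hx => simp [hx]
    ext x
    exact hsp (ev x) (by rw [hspan]; exact Submodule.subset_span ⟨x, rfl⟩)
  have := Fintype.card_le_of_injective g hg
  simp only [Fintype.card_coe, Fintype.card_fun, Fintype.card_prop] at this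
  exact this.trans (Nat.pow_le_pow_right (by norm_num) hcard)

theorem statement0 (n p : ℕ) (hp : p.Prime) (𝓕 : Finset (Finset (Fin n)))
    (hdiv : kWiseDiv n p p 𝓕) : 𝓕.card ≤ 2 ^ (n / p) := by
  classical
  have : Fact p.Prime := ⟨hp⟩
  let K := AlgebraicClosure (ZMod p)
  have : CharP K p := inferInstance
  have hppos := hp.pos
  -- pad the ground set
  obtain ⟨r, c, hr, hc⟩ : ∃ r c, r < p ∧ n + r = p * c := by
    refine ⟨(p - n % p) % p, (n + (p - n % p) % p) / p, Nat.mod_lt _ hppos, ?_⟩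
    rw [Nat.mul_div_cancel']
    have h1 := Nat.mod_lt n hppos
    apply Nat.dvd_of_mod_eq_zero
    rw [Nat.add_mod_mod, Nat.add_mod]
    have h2 := Nat.div_add_mod n p
    rw [← Nat.add_mod, show n + (p - n % p) = p * (n / p) + p by omega]
    simp
  let X := Fin n ⊕ Fin r
  let ι : Finset (Fin n) → X → K := fun A => Sum.elim (fun i => if i ∈ A then 1 else 0) (fun _ => 0)
  have hι : Function.Injective ι := by
    intro A B h
    ext i
    have := congrFun h (Sum.inl i)
    by_cases h1 : i ∈ A <;> by_cases h2 : i ∈ B <;> simp_all [ι]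
  let S0 : Set (X → K) := ι '' 𝓕
  let V0 := Submodule.span K S0
  let V := Submodule.span K (insert 1 S0)
  have h1V : (1 : X → K) ∈ V := Submodule.subset_span (Set.mem_insert _ _)
  have hV0V : V0 ≤ V := Submodule.span_mono (Set.subset_insert _ _)
  have hint : ∀ A : Fin p → Finset (Fin n), (∀ i, A i ∈ 𝓕) → ∑ x, (∏ i, ι (A i)) x = 0 := by
    intro A hA
    have h := hdiv A hA
    rw [← CharP.cast_eq_zero_iff K p] at h
    rw [← h, Fintype.sum_sum_type, Finset.card_eq_sum_ones]
    have : Nonempty (Fin p) := ⟨⟨0, hppos⟩⟩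
    have hz : ∑ x : Fin r, (∏ i, ι (A i)) (Sum.inr x) = 0 := by
      apply Finset.sum_eq_zero
      intro x _
      rw [Finset.prod_apply]
      exact Finset.prod_eq_zero (Finset.mem_univ (⟨0, hppos⟩ : Fin p)) rfl
    rw [hz, add_zero]
    have : ∀ x : Fin n, (∏ i, ι (A i)) (Sum.inl x) = if x ∈ Finset.univ.inf A then 1 else 0 := by
      intro x
      rw [Finset.prod_apply]
      change (∏ i, if x ∈ A i then (1 : K) else 0) = _
      rw [Finset.prod_ite_zero]
      simp [Finset.mem_inf]
    simp_rw [this]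
    simp
  have hsum : ∀ w ∈ V ^ p, ∑ x, w x = 0 := by
    intro w hw
    rw [Submodule.span_pow] at hw
    induction hw using Submodule.span_induction with
    | zero => simp
    | add x y _ _ hx hy => simp [Finset.sum_add_distrib, hx, hy]
    | smul c x _ hx => simp [← Finset.mul_sum, hx]
    | mem w hw =>
      obtain ⟨f, rfl⟩ := Set.mem_pow.mp hw
      rw [List.prod_ofFn]
      by_cases hall : ∀ i, (f i).1 = 1
      · simp only [hall]
        have : ((n + r : ℕ) : K) = 0 := by
          rw [hc, CharP.cast_eq_zero_iff K p]; exact dvd_mul_right _ _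
        simpa [X] using this
      · push Not at hall
        obtain ⟨i0, hi0⟩ := hall
        have hmem : ∀ i, (f i).1 ≠ 1 → ∃ A ∈ 𝓕, ι A = (f i).1 := by
          intro i hi
          rcases (f i).2 with h | h
          · exact absurd h hi
          · exact h
        obtain ⟨A0, hA0, hA0'⟩ := hmem i0 hi0
        have hex : ∀ i, ∃ A ∈ 𝓕, ι A = ι A0 * (f i).1 ∨ ι A = (f i).1 := by
          intro i
          by_cases hi : (f i).1 = 1
          · exact ⟨A0, hA0, Or.inl (by rw [hi, mul_one])⟩
          · obtain ⟨A, hA, hA'⟩ := hmem i hi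
            exact ⟨A, hA, Or.inr hA'⟩
        choose A hA hA' using hex
        have hAA : ι A0 * ι A0 = ι A0 := by
          funext x
          rcases x with x | x <;> simp [ι]
        have hmul : ∀ i, ι A0 * ι (A i) = ι A0 * (f i).1 := by
          intro i
          rcases hA' i with h | h
          · rw [h, ← mul_assoc, hAA]
          · rw [h]
        have hpow : ∀ m, m ≠ 0 → ι A0 ^ m = ι A0 := by
          intro m hm
          induction m with
          | zero => exact absurd rfl hm
          | succ m ih =>
            by_cases h0 : m = 0
            · simp [h0]
            · rw [pow_succ, ih h0, hAA]
        -- choose A i0 := A0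
        let A2 : Fin p → Finset (Fin n) := fun i => if i = i0 then A0 else A i
        have hA2m : ∀ i, A2 i ∈ 𝓕 := by
          intro i
          by_cases h : i = i0 <;> simp [A2, h, hA0, hA]
        have hmul2 : ∀ i, ι A0 * ι (A2 i) = ι A0 * (f i).1 := by
          intro i
          by_cases h : i = i0
          · subst h; simp [A2, hA0']
          · simp only [A2, h, if_false]; exact hmul i
        have habs : ∀ g : Fin p → X → K, g i0 = ι A0 → ∏ i, g i = ∏ i, (ι A0 * g i) := by
          intro g hg
          rw [Finset.prod_mul_distrib, Finset.prod_const, Finset.card_univ, Fintype.card_fin,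
            hpow p hppos.ne', ← Finset.mul_prod_erase _ _ (Finset.mem_univ i0), hg, ← mul_assoc,
            hAA]
        rw [habs (fun i => (f i).1) hA0'.symm]
        simp_rw [← hmul2]
        rw [← habs (fun i => ι (A2 i)) (by simp [A2])]
        exact hint A2 hA2m
  have hmain := main_bound p hp _ X V le_rfl h1V hsum
  have hcardX : Fintype.card X = n + r := by simp [X]
  rw [hcardX, hc] at hmain
  have hVc : Module.finrank K V ≤ c := Nat.le_of_mul_le_mul_left hmain hppos
  have hV0c : Module.finrank K V0 ≤ n / p := by
    rw [Nat.le_div_iff_mul_le hppos]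
    rcases Nat.eq_zero_or_pos r with h0 | h0
    · have := Submodule.finrank_mono hV0V
      have : p * Module.finrank K V0 ≤ p * c := Nat.mul_le_mul_left _ (this.trans hVc)
      rw [mul_comm]; omega
    · have hlt : V0 < V := by
        refine lt_of_le_of_ne hV0V fun h => ?_
        rw [← h] at h1V
        have hle : V0 ≤ LinearMap.ker (LinearMap.proj (R := K) (φ := fun _ : X => K)
            (Sum.inr ⟨0, h0⟩)) := by
          rw [Submodule.span_le]
          rintro _ ⟨A, _, rfl⟩
          simp [ι]
        have := hle h1V
        simp at this
      have := Submodule.finrank_lt_finrank_of_lt hlt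
      have : p * (Module.finrank K V0 + 1) ≤ p * c := Nat.mul_le_mul_left _ (by omega)
      rw [mul_comm]
      rw [mul_add] at this
      omega
  have hod := odlyzko V0 (𝓕.image ι) (by
      intro v hv
      obtain ⟨A, hA, rfl⟩ := Finset.mem_image.mp hv
      exact Submodule.subset_span ⟨A, hA, rfl⟩) (by
      intro v hv x
      obtain ⟨A, hA, rfl⟩ := Finset.mem_image.mp hv
      rcases x with x | x
      · by_cases h : x ∈ A <;> simp [ι, h]
      · simp [ι])
  rw [Finset.card_image_of_injective _ hι] at hod
  exact hod.trans (Nat.pow_le_pow_right (by norm_num) hV0c)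
end

section
/- Let p be a prime and let F ⊆ 2^[n] be a (p+1)-wise p-divisible set family with |F| > 2^(⌊n/p⌋ - 1). Then F is contained in an atomic family with atoms of size p; i.e., there is a collection of pairwise disjoint p-element subsets of [n] such that every member of F is a union of some of these subsets. -/
open Submodule

set_option linter.unusedSectionVars false

section kneser
variable {L ι : Type*} [Field L] [Fintype ι]

/-- indicator vector -/
noncomputable def indV (L : Type*) [Field L] {ι : Type*} (S : Set ι) : ι → L := by
  classical exact fun i => if i ∈ S then 1 else 0

theorem stab_prod (x : ι → L) (B : Submodule L (ι → L)) (hx : ∀ b ∈ B, x * b ∈ B)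
    (s : Finset L) : ∀ b ∈ B, (fun j => ∏ a ∈ s, (x j - a)) * b ∈ B := by
  classical
  induction s using Finset.induction_on with
  | empty =>
    intro b hb
    convert hb using 1
    funext j; simp
  | insert a s ha ih =>
    intro b hb
    have h1 := ih b hb
    have h2 := B.sub_mem (hx _ h1) (B.smul_mem a h1)
    convert h2 using 1
    funext j
    simp [Finset.prod_insert ha]
    ring

theorem stab_ind (x : ι → L) (B : Submodule L (ι → L)) (hx : ∀ b ∈ B, x * b ∈ B) (i : ι) :
    ∀ b ∈ B, indV L {j | x j = x i} * b ∈ B := by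
  classical
  intro b hb
  have h := B.smul_mem (∏ a ∈ (Finset.univ.image x).erase (x i), (x i - a))⁻¹
    (stab_prod x B hx ((Finset.univ.image x).erase (x i)) b hb)
  convert h using 1
  funext j
  by_cases hj : x j = x i
  · have : ∏ a ∈ (Finset.univ.image x).erase (x i), (x i - a) ≠ 0 := by
      rw [Finset.prod_ne_zero_iff]
      intro a ha
      rw [sub_ne_zero]
      exact (Finset.ne_of_mem_erase ha).symm
    simp only [indV, Pi.mul_apply, Set.mem_ofPred_eq, Pi.smul_apply, smul_eq_mul]
    rw [if_pos hj, hj, ← mul_assoc, inv_mul_cancel₀ this]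
  · have : ∏ a ∈ (Finset.univ.image x).erase (x i), (x j - a) = 0 := by
      apply Finset.prod_eq_zero (i := x j)
      · simp [hj]
      · simp
    simp [indV, hj, this]

theorem avoid [Infinite L] {M κ : Type*} [AddCommGroup M] [Module L M] [Finite κ]
    (W : κ → Submodule L M) (B : Submodule L M) (h : ∀ k, ¬ B ≤ W k) :
    ∃ b ∈ B, ∀ k, b ∉ W k := by
  by_contra hc
  push Not at hc
  have := Subspace.exists_eq_top_of_iUnion_eq_univ (k := L) (E := B)
    (p := fun k => (W k).comap B.subtype) (by
      ext ⟨b, hb⟩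
      obtain ⟨k, hk⟩ := hc b hb
      simp only [Set.mem_iUnion, Set.mem_univ, iff_true]
      exact ⟨k, hk⟩)
  obtain ⟨k, hk⟩ := this
  apply h k
  intro b hb
  have : (⟨b, hb⟩ : B) ∈ (W k).comap B.subtype := by rw [hk]; trivial
  exact this

/-- full support -/
def FullSupp (B : Submodule L (ι → L)) : Prop := ∀ i, ∃ v ∈ B, v i ≠ 0

theorem finrank_map_mul (b : ι → L) (hb : ∀ i, b i ≠ 0) (A : Submodule L (ι → L)) :
    Module.finrank L (A.map (LinearMap.mulLeft L b)) = Module.finrank L A := by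
  have hinj : Function.Injective (LinearMap.mulLeft L b) := by
    intro x y hxy
    funext i
    have := congrFun hxy i
    simpa [hb i] using this
  exact (LinearEquiv.finrank_eq (Submodule.equivMapOfInjective _ hinj A)).symm

theorem kneser_local [Infinite L] (d : ℕ) : ∀ (A B : Submodule L (ι → L)),
    Module.finrank L A = d → (1 : ι → L) ∈ A → FullSupp B →
    ∃ V : Submodule L (ι → L), B ≤ V ∧ V ≤ A * B ∧
      (Module.finrank L A + Module.finrank L B ≤ Module.finrank L V + 1 ∨
        ∃ S : Set ι, S ≠ ∅ ∧ S ≠ Set.univ ∧ ∀ v ∈ V, indV L S * v ∈ V) := by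
  classical
  induction d using Nat.strong_induction_on with
  | _ d ih =>
  intro A B hd h1 hB
  have hBAB : B ≤ A * B := by
    intro b hb
    have := Submodule.mul_mem_mul h1 hb
    simpa using this
  by_cases hAB : ∀ a ∈ A, ∀ b ∈ B, a * b ∈ B
  · refine ⟨B, le_rfl, hBAB, ?_⟩
    by_cases hx : ∃ x ∈ A, ∃ i j, x i ≠ x j
    · right
      obtain ⟨x, hxA, i, j, hij⟩ := hx
      refine ⟨{k | x k = x i}, ?_, ?_, stab_ind x B (hAB x hxA) i⟩
      · intro h
        have : i ∈ ({k | x k = x i} : Set ι) := rfl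
        rw [h] at this; exact this
      · intro h
        have : j ∈ ({k | x k = x i} : Set ι) := by rw [h]; trivial
        exact hij this.symm
    · left
      push Not at hx
      have hle : A ≤ Submodule.span L {(1 : ι → L)} := by
        intro x hxA
        rw [Submodule.mem_span_singleton]
        by_cases hι : Nonempty ι
        · obtain ⟨i⟩ := hι
          refine ⟨x i, ?_⟩
          funext j
          simp [hx x hxA i j]
        · refine ⟨0, ?_⟩
          funext j
          exact absurd ⟨j⟩ hι
      have := (Submodule.finrank_mono hle).trans (finrank_span_le_card _)
      simp at this
      omega
  · push Not at hAB
    obtain ⟨a0, ha0, b0, hb0, hab0⟩ := hAB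
    obtain ⟨b, hb, hbW⟩ := avoid (L := L) (κ := Option ι)
      (fun k => match k with
        | none => B / A
        | some i => LinearMap.ker (LinearMap.proj i : (ι → L) →ₗ[L] L)) B (by
        intro k
        match k with
        | none =>
          intro h
          have := h hb0
          rw [Submodule.mem_div_iff_forall_mul_mem] at this
          apply hab0
          rw [mul_comm]; exact this a0 ha0
        | some i =>
          intro h
          obtain ⟨v, hv, hvi⟩ := hB i
          have := h hv
          simp at this
          exact hvi this)
    have hbne : ∀ i, b i ≠ 0 := by
      intro i
      have := hbW (some i)
      simpa using this
    have hbA : ∃ a ∈ A, b * a ∉ B := by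
      have := hbW none
      simp only at this
      rw [Submodule.mem_div_iff_forall_mul_mem] at this
      push Not at this
      exact this
    obtain ⟨a, ha, hab⟩ := hbA
    set A' := A ⊓ B.comap (LinearMap.mulLeft L b) with hA'
    set B' := B ⊔ A.map (LinearMap.mulLeft L b) with hB'
    have hlt : A' < A := by
      refine lt_of_le_of_ne inf_le_left ?_
      intro h
      have : a ∈ A' := by rw [h]; exact ha
      exact hab this.2
    have hfl := Submodule.finrank_lt_finrank_of_lt hlt
    have hdim : Module.finrank L A' + Module.finrank L B'
        = Module.finrank L A + Module.finrank L B := by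
      have e1 := Submodule.finrank_sup_add_finrank_inf_eq B (A.map (LinearMap.mulLeft L b))
      rw [finrank_map_mul b hbne] at e1
      have e2 : B ⊓ A.map (LinearMap.mulLeft L b) = A'.map (LinearMap.mulLeft L b) := by
        ext x
        constructor
        · rintro ⟨hx, y, hy, rfl⟩
          exact ⟨y, ⟨hy, hx⟩, rfl⟩
        · rintro ⟨y, ⟨hy, hx⟩, rfl⟩
          exact ⟨hx, y, hy, rfl⟩
      rw [e2, finrank_map_mul b hbne, ← hB'] at e1
      omega
    obtain ⟨V, hV1, hV2, hV3⟩ := ih _ (hd ▸ hfl) A' B' rfl ⟨h1, by simpa using hb⟩ (by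
      intro i
      obtain ⟨v, hv, hvi⟩ := hB i
      exact ⟨v, (le_sup_left : B ≤ B') hv, hvi⟩)
    refine ⟨V, le_sup_left.trans hV1, hV2.trans ?_, ?_⟩
    · rw [Submodule.mul_le]
      intro x hx y hy
      obtain ⟨y1, hy1, z, ⟨w, hw, rfl⟩, rfl⟩ := Submodule.mem_sup.1 hy
      rw [mul_add]
      refine Submodule.add_mem _ (Submodule.mul_mem_mul hx.1 hy1) ?_
      have h2 : b * x ∈ B := hx.2
      have := Submodule.mul_mem_mul hw h2
      convert this using 1
      simp only [LinearMap.mulLeft_apply]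
      ring
    · rcases hV3 with h | h
      · left; omega
      · right; exact h

theorem kneser_trivial [Infinite L] (A B : Submodule L (ι → L)) (hA : FullSupp A)
    (hB : FullSupp B)
    (hst : ∀ S : Set ι, (∀ v ∈ A * B, indV L S * v ∈ A * B) → S = ∅ ∨ S = Set.univ) :
    Module.finrank L A + Module.finrank L B ≤ Module.finrank L ↥(A * B) + 1 := by
  classical
  by_contra hcon
  obtain ⟨a, ha, haW⟩ := avoid (L := L) (κ := ι ⊕ {S : Set ι // S ≠ ∅ ∧ S ≠ Set.univ})
    (fun k => match k with
      | .inl i => LinearMap.ker (LinearMap.proj i : (ι → L) →ₗ[L] L)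
      | .inr S => ((A * B) / B).comap (LinearMap.mulLeft L (indV L S.1))) A (by
      intro k
      match k with
      | .inl i =>
        intro h
        obtain ⟨v, hv, hvi⟩ := hA i
        have := h hv
        simp at this
        exact hvi this
      | .inr ⟨S, hS1, hS2⟩ =>
        intro h
        have : ∀ v ∈ A * B, indV L S * v ∈ A * B := by
          intro v hv
          induction hv using Submodule.mul_induction_on' with
          | mem_mul_mem m hm n hn =>
            have := h hm
            rw [Submodule.mem_comap, Submodule.mem_div_iff_forall_mul_mem] at this
            have := this n hn
            simpa [mul_assoc] using this
          | add x _ y _ hx hy => rw [mul_add]; exact Submodule.add_mem _ hx hy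
        rcases hst S this with h | h
        · exact hS1 h
        · exact hS2 h)
  have hane : ∀ i, a i ≠ 0 := by
    intro i
    have := haW (.inl i)
    simpa using this
  have hinv : ∀ i, a⁻¹ i ≠ 0 := fun i => by simpa using hane i
  have haa : a * a⁻¹ = 1 := by funext i; simp [hane i]
  have key : ∀ v ∈ A.map (LinearMap.mulLeft L a⁻¹) * B, a * v ∈ A * B := by
    intro v hv
    induction hv using Submodule.mul_induction_on' with
    | mem_mul_mem m hm n hn =>
      obtain ⟨y, hy, rfl⟩ := hm
      have := Submodule.mul_mem_mul hy hn
      convert this using 1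
      simp only [LinearMap.mulLeft_apply]
      rw [← mul_assoc, ← mul_assoc, haa, one_mul]
    | add x _ y _ hx hy => rw [mul_add]; exact Submodule.add_mem _ hx hy
  obtain ⟨V, hV1, hV2, hV3⟩ := kneser_local (L := L) _ (A.map (LinearMap.mulLeft L a⁻¹)) B rfl
    ⟨a, ha, by simp [mul_comm, haa]⟩ hB
  rcases hV3 with h | ⟨S, hS1, hS2, hS⟩
  · rw [finrank_map_mul _ hinv] at h
    have : V.map (LinearMap.mulLeft L a) ≤ A * B := by
      rintro _ ⟨v, hv, rfl⟩
      exact key v (hV2 hv)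
    have := Submodule.finrank_mono this
    rw [finrank_map_mul _ hane] at this
    omega
  · apply haW (.inr ⟨S, hS1, hS2⟩)
    simp only [Submodule.mem_comap]
    rw [Submodule.mem_div_iff_forall_mul_mem]
    intro b hb
    have := key _ (hV2 (hS b (hV1 hb)))
    convert this using 1
    simp only [LinearMap.mulLeft_apply]
    ring

theorem fullSupp_mul (A B : Submodule L (ι → L)) (hA : FullSupp A) (hB : FullSupp B) :
    FullSupp (A * B) := by
  intro i
  obtain ⟨a, ha, hai⟩ := hA i
  obtain ⟨b, hb, hbi⟩ := hB i
  exact ⟨a * b, Submodule.mul_mem_mul ha hb, by simp [hai, hbi]⟩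

theorem kneser_pow [Infinite L] (C : Submodule L (ι → L)) (hC : FullSupp C) (k : ℕ)
    (hst : ∀ S : Set ι, (∀ v ∈ C ^ (k + 1), indV L S * v ∈ C ^ (k + 1)) → S = ∅ ∨ S = Set.univ) :
    FullSupp (C ^ (k + 1)) ∧
      (k + 1) * Module.finrank L C ≤ Module.finrank L ↥(C ^ (k + 1)) + k := by
  induction k with
  | zero => rw [zero_add, pow_one]; exact ⟨hC, by omega⟩
  | succ k ih =>
    have h := ih (by
      intro S hS
      apply hst S
      intro v hv
      rw [_root_.pow_succ] at hv ⊢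
      induction hv using Submodule.mul_induction_on' with
      | mem_mul_mem m hm n hn =>
        rw [← mul_assoc]
        exact Submodule.mul_mem_mul (hS m hm) hn
      | add x _ y _ hx hy => rw [mul_add]; exact Submodule.add_mem _ hx hy)
    rw [_root_.pow_succ C (k + 1)] at hst ⊢
    refine ⟨fullSupp_mul _ _ h.1 hC, ?_⟩
    have := kneser_trivial _ _ h.1 hC hst
    have h2 := h.2
    have : (k + 1 + 1) * Module.finrank L C = (k + 1) * Module.finrank L C + Module.finrank L C := by
      ring
    omega

theorem finrank_orth (A B : Submodule L (ι → L))
    (h : ∀ a ∈ A, ∀ b ∈ B, ∑ i, a i * b i = 0) :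
    Module.finrank L A + Module.finrank L B ≤ Fintype.card ι := by
  classical
  have h1 := Subspace.finrank_add_finrank_dualAnnihilator_eq B
  have h2 : Module.finrank L A ≤ Module.finrank L B.dualAnnihilator := by
    have hinj : Function.Injective (dotProductEquiv L ι).toLinearMap :=
      (dotProductEquiv L ι).injective
    rw [LinearEquiv.finrank_eq (Submodule.equivMapOfInjective _ hinj A)]
    apply Submodule.finrank_mono
    rintro _ ⟨a, ha, rfl⟩
    rw [Submodule.mem_dualAnnihilator]
    intro b hb
    exact h a ha b hb
  rw [Module.finrank_fintype_fun_eq_card] at h1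
  omega

end kneser

section comb

theorem cube_bound {α L : Type*} [DecidableEq α] [Field L] (m : Finset α → L) (q : ℕ) :
    ∀ G : Finset (Finset α), (∀ s ∈ G, m s ≠ 0) → G.Nonempty →
      (∀ S : Finset α, S.card ≤ q → ∑ s ∈ G with S ⊆ s, m s = 0) → 2 ^ (q + 1) ≤ G.card := by
  have base : ∀ G : Finset (Finset α), (∀ s ∈ G, m s ≠ 0) → G.Nonempty →
      (∑ s ∈ G with ∅ ⊆ s, m s = 0) → 1 < G.card := by
    intro G hm hG h
    by_contra hc
    have : G.card = 1 := by have := hG.card_pos; omega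
    obtain ⟨s, rfl⟩ := Finset.card_eq_one.1 this
    simp at h
    exact hm s (by simp) h
  induction q with
  | zero =>
    intro G hm hG h
    have := base G hm hG (h ∅ (by simp))
    omega
  | succ q ih =>
    intro G hm hG h
    obtain ⟨s, hs, s', hs', hne⟩ := Finset.one_lt_card.1 (base G hm hG (h ∅ (by simp)))
    have : ∃ a, ∃ s ∈ G, ∃ s' ∈ G, a ∈ s ∧ a ∉ s' := by
      by_contra hc
      push Not at hc
      apply hne
      ext a
      exact ⟨hc a s hs s' hs', hc a s' hs' s hs⟩
    obtain ⟨a, s, hs, s', hs', h1, h2⟩ := this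
    have e1 : ∀ S : Finset α, S.card ≤ q → ∑ s ∈ G.filter (a ∈ ·) with S ⊆ s, m s = 0 := by
      intro S hS
      rw [← h (insert a S) ((Finset.card_insert_le _ _).trans (by omega))]
      apply Finset.sum_congr _ (fun _ _ => rfl)
      ext x
      simp [Finset.insert_subset_iff, and_assoc]
    have e2 : ∀ S : Finset α, S.card ≤ q → ∑ s ∈ G.filter (¬ a ∈ ·) with S ⊆ s, m s = 0 := by
      intro S hS
      have h3 := h S (by omega)
      rw [← Finset.sum_filter_add_sum_filter_not _ (a ∈ ·), Finset.filter_comm, e1 S hS,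
        zero_add, Finset.filter_comm] at h3
      exact h3
    have g1 := ih (G.filter (a ∈ ·)) (fun s hs => hm s (Finset.mem_filter.1 hs).1)
      ⟨s, by simp [hs, h1]⟩ e1
    have g2 := ih (G.filter (¬ a ∈ ·)) (fun s hs => hm s (Finset.mem_filter.1 hs).1)
      ⟨s', by simp [hs', h2]⟩ e2
    have := Finset.card_filter_add_card_filter_not (s := G) (a ∈ ·)
    rw [_root_.pow_succ]
    omega

theorem count_zero_one {L ι : Type*} [Field L] [Fintype ι] (C : Submodule L (ι → L))
    (X : Finset (ι → L)) (hX : ∀ x ∈ X, x ∈ C) (h01 : ∀ x ∈ X, ∀ i, x i = 0 ∨ x i = 1) :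
    X.card ≤ 2 ^ Module.finrank L C := by
  classical
  let f : ι → Module.Dual L C := fun i => (LinearMap.proj i).domRestrict C
  obtain ⟨b, hb, hspan, hli⟩ := exists_linearIndependent L (Set.range f)
  have hfin : b.Finite := (Set.finite_range f).subset hb
  haveI := hfin.fintype
  have hcard : Fintype.card b ≤ Module.finrank L C := by
    have := hli.fintype_card_le_finrank
    rwa [Subspace.dual_finrank_eq] at this
  let g : X → (b → Bool) := fun x φ => decide (φ.1 ⟨x.1, hX x.1 x.2⟩ = 1)
  have hinj : Function.Injective g := by
    rintro ⟨x, hx⟩ ⟨y, hy⟩ hxy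
    have hv : ∀ φ ∈ b, ∀ z (hz : z ∈ X), φ ⟨z, hX z hz⟩ = 0 ∨ φ ⟨z, hX z hz⟩ = 1 := by
      intro φ hφ z hz
      obtain ⟨i, rfl⟩ := hb hφ
      exact h01 z hz i
    have hag : ∀ φ ∈ b, φ ⟨x, hX x hx⟩ = φ ⟨y, hX y hy⟩ := by
      intro φ hφ
      have h1 := congrFun hxy ⟨φ, hφ⟩
      simp only [g, decide_eq_decide] at h1
      rcases hv φ hφ x hx with h2 | h2 <;> rcases hv φ hφ y hy with h3 | h3 <;>
        simp [h2, h3] at h1 ⊢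
    have hall : ∀ φ ∈ Submodule.span L b, φ ⟨x, hX x hx⟩ = φ ⟨y, hX y hy⟩ := by
      intro φ hφ
      induction hφ using Submodule.span_induction with
      | mem φ h => exact hag φ h
      | zero => simp
      | add u v _ _ hu hv => simp [hu, hv]
      | smul c u _ hu => simp [hu]
    apply Subtype.ext
    funext i
    exact hall (f i) (by rw [hspan]; exact Submodule.subset_span ⟨i, rfl⟩)
  have := Fintype.card_le_of_injective g hinj
  rw [Fintype.card_fun, Fintype.card_bool, Fintype.card_coe] at this
  exact this.trans (Nat.pow_le_pow_right (by norm_num) hcard)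

variable {n : ℕ}

/-- 0/1 vector of `A` on the coordinate set `T`. -/
def chi (L : Type*) [Field L] (T A : Finset (Fin n)) : T → L :=
  fun t => if t.1 ∈ A then 1 else 0

/-- code on `T`. -/
def codeT (L : Type*) [Field L] (F : Finset (Finset (Fin n))) (T : Finset (Fin n)) :
    Submodule L (T → L) := Submodule.span L (chi L T '' F)

/-- divisibility in list form. -/
def Hdiv (L : Type*) [Field L] (F : Finset (Finset (Fin n))) (k : ℕ) (T : Finset (Fin n)) : Prop :=
  ∀ l : List (Finset (Fin n)), (∀ A ∈ l, A ∈ F) → l.length = k →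
    ∑ t ∈ T, (l.map (fun A => if t ∈ A then (1 : L) else 0)).prod = 0

/-- signature. -/
def sig (F : Finset (Finset (Fin n))) (t : Fin n) : Finset (Finset (Fin n)) :=
  F.filter (t ∈ ·)

/-- atomic on `T`. -/
def Good (F : Finset (Finset (Fin n))) (p : ℕ) (T : Finset (Fin n)) : Prop :=
  ∃ 𝒜 : Finset (Finset (Fin n)), (∀ A ∈ 𝒜, A.card = p ∧ A ⊆ T) ∧
    (∀ A ∈ 𝒜, ∀ B ∈ 𝒜, A ≠ B → Disjoint A B) ∧ (∀ B ∈ F, ∃ 𝒮 ⊆ 𝒜, B ∩ T = 𝒮.sup id)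

theorem prod_ind {L : Type*} [Field L] (l : List (Finset (Fin n))) (t : Fin n) :
    (l.map (fun A => if t ∈ A then (1 : L) else 0)).prod = if ∀ A ∈ l, t ∈ A then 1 else 0 := by
  induction l with
  | nil => simp
  | cons A l ih =>
    rw [List.map_cons, List.prod_cons, ih]
    by_cases h : t ∈ A <;> simp [h]

theorem Hdiv_sub {L : Type*} [Field L] {F : Finset (Finset (Fin n))} {k : ℕ}
    {T : Finset (Fin n)} (h : Hdiv L F k T) (S : Finset (Finset (Fin n))) (hS : S.Nonempty)
    (hk : S.card ≤ k) : (((T.filter (fun t => S ⊆ sig F t)).card : ℕ) : L) = 0 := by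
  by_cases hSF : S ⊆ F
  · obtain ⟨A0, hA0⟩ := hS
    have := h (S.toList ++ List.replicate (k - S.card) A0) (by
      intro A hA
      rw [List.mem_append] at hA
      rcases hA with hA | hA
      · exact hSF (Finset.mem_toList.1 hA)
      · rw [(List.mem_replicate.1 hA).2]; exact hSF hA0) (by simp; omega)
    simp only [prod_ind] at this
    rw [Finset.sum_boole] at this
    convert this using 3
    ext t
    simp only [Finset.mem_filter, List.mem_append, Finset.mem_toList, List.mem_replicate]
    constructor
    · rintro ⟨h1, h2⟩
      refine ⟨h1, ?_⟩
      intro A hA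
      have : A ∈ S := by
        rcases hA with hA | hA
        · exact hA
        · rw [hA.2]; exact hA0
      exact (Finset.mem_filter.1 (h2 this)).2
    · rintro ⟨h1, h2⟩
      refine ⟨h1, ?_⟩
      intro A hA
      exact Finset.mem_filter.2 ⟨hSF hA, h2 A (Or.inl hA)⟩
  · have : T.filter (fun t => S ⊆ sig F t) = ∅ := by
      rw [Finset.filter_eq_empty_iff]
      intro t _ hc
      exact hSF (hc.trans (Finset.filter_subset _ _))
    rw [this]; simp

theorem big_of_not_dvd {L : Type*} [Field L] {F : Finset (Finset (Fin n))} {k : ℕ}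
    {T : Finset (Fin n)} (h : Hdiv L F k T) (hT : T ⊆ F.sup id) (s0 : Finset (Finset (Fin n)))
    (hs0 : (((T.filter (fun t => sig F t = s0)).card : ℕ) : L) ≠ 0) :
    2 ^ (k + 1) ≤ T.card + 1 := by
  classical
  let m : Finset (Finset (Fin n)) → L := fun s =>
    if s = ∅ then - (T.card : L) else (((T.filter (fun t => sig F t = s)).card : ℕ) : L)
  have hempty : ∅ ∉ T.image (sig F) := by
    intro hc
    obtain ⟨t, ht, hts⟩ := Finset.mem_image.1 hc
    obtain ⟨A, hA, htA⟩ := Finset.mem_sup.1 (hT ht)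
    have : A ∈ sig F t := Finset.mem_filter.2 ⟨hA, htA⟩
    rw [hts] at this
    simp at this
  have hfib : ∀ S : Finset (Finset (Fin n)), ∑ s ∈ T.image (sig F) with S ⊆ s, m s
      = (((T.filter (fun t => S ⊆ sig F t)).card : ℕ) : L) := by
    intro S
    rw [Finset.card_eq_sum_card_fiberwise (f := sig F) (t := (T.image (sig F)).filter (S ⊆ ·))]
    · rw [Nat.cast_sum]
      apply Finset.sum_congr rfl
      intro s hs
      rw [Finset.mem_filter] at hs
      have : s ≠ ∅ := by rintro rfl; exact hempty hs.1
      simp only [m, if_neg this]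
      congr 2
      ext t
      simp only [Finset.mem_filter]
      constructor
      · rintro ⟨h1, rfl⟩; exact ⟨⟨h1, hs.2⟩, rfl⟩
      · rintro ⟨⟨h1, _⟩, h2⟩; exact ⟨h1, h2⟩
    · intro t ht
      simp only [Finset.coe_filter, Set.mem_ofPred_eq] at ht ⊢
      exact ⟨Finset.mem_image_of_mem _ ht.1, ht.2⟩
  have hs0T : s0 ∈ T.image (sig F) := by
    have : (T.filter (fun t => sig F t = s0)).Nonempty := by
      rw [Finset.nonempty_iff_ne_empty]
      intro hc
      rw [hc] at hs0
      simp at hs0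
    obtain ⟨t, ht⟩ := this
    rw [Finset.mem_filter] at ht
    exact Finset.mem_image.2 ⟨t, ht.1, ht.2⟩
  have := cube_bound m k ((insert ∅ (T.image (sig F))).filter (fun s => m s ≠ 0))
    (fun s hs => (Finset.mem_filter.1 hs).2) ⟨s0, by
      rw [Finset.mem_filter]
      refine ⟨Finset.mem_insert_of_mem hs0T, ?_⟩
      have : s0 ≠ ∅ := by rintro rfl; exact hempty hs0T
      simp only [m, if_neg this]
      exact hs0⟩ (by
      intro S hS
      rw [Finset.filter_comm, Finset.sum_filter_ne_zero]
      rcases S.eq_empty_or_nonempty with rfl | hne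
      · rw [Finset.filter_insert, if_pos (by simp), Finset.sum_insert (by simp [hempty]), hfib]
        simp [m]
      · rw [Finset.filter_insert, if_neg (by rw [Finset.subset_empty]; exact hne.ne_empty), hfib]
        exact Hdiv_sub h S hne hS)
  refine this.trans ((Finset.card_filter_le _ _).trans ((Finset.card_insert_le _ _).trans ?_))
  have := Finset.card_image_le (s := T) (f := sig F)
  omega

theorem code_le_sigs {L : Type*} [Field L] (F : Finset (Finset (Fin n))) (T : Finset (Fin n)) :
    Module.finrank L (codeT L F T) ≤ (T.image (sig F)).card := by
  classical
  let g : T → (T.image (sig F) : Finset _) := fun t => ⟨sig F t.1, Finset.mem_image_of_mem _ t.2⟩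
  have hle : codeT L F T ≤ LinearMap.range (LinearMap.funLeft L L g) := by
    rw [codeT, Submodule.span_le]
    rintro _ ⟨A, hA, rfl⟩
    refine ⟨fun s => if A ∈ s.1 then 1 else 0, ?_⟩
    funext t
    have hA' : A ∈ F := hA
    simp [LinearMap.funLeft_apply, g, chi, sig, hA']
  have h1 := Submodule.finrank_mono hle
  have h2 := LinearMap.finrank_range_le (LinearMap.funLeft L L g)
  rw [Module.finrank_fintype_fun_eq_card] at h2
  simp only [Fintype.card_coe] at h2
  exact h1.trans h2

theorem good_of_dvd {L : Type*} [Field L] (F : Finset (Finset (Fin n))) (T : Finset (Fin n))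
    (p : ℕ) (hdvd : ∀ s, p ∣ (T.filter (fun t => sig F t = s)).card) :
    p * (Module.finrank L (codeT L F T) + 1) ≤ T.card ∨
      (p * Module.finrank L (codeT L F T) ≤ T.card ∧ Good F p T) := by
  classical
  set c := Module.finrank L (codeT L F T)
  have hc : c ≤ (T.image (sig F)).card := code_le_sigs F T
  have hsum := Finset.card_eq_sum_card_image (sig F) T
  have hge : ∀ s ∈ T.image (sig F), p ≤ (T.filter (fun t => sig F t = s)).card := by
    intro s hs
    apply Nat.le_of_dvd _ (hdvd s)
    rw [Finset.card_pos]
    obtain ⟨t, ht, hts⟩ := Finset.mem_image.1 hs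
    exact ⟨t, Finset.mem_filter.2 ⟨ht, hts⟩⟩
  by_cases hall : ∀ s ∈ T.image (sig F), (T.filter (fun t => sig F t = s)).card = p
  · right
    constructor
    · rw [hsum, Finset.sum_congr rfl hall, Finset.sum_const, smul_eq_mul, mul_comm]
      exact Nat.mul_le_mul_right _ hc
    · refine ⟨(T.image (sig F)).image (fun s => T.filter (fun t => sig F t = s)), ?_, ?_, ?_⟩
      · intro A hA
        obtain ⟨s, hs, rfl⟩ := Finset.mem_image.1 hA
        exact ⟨hall s hs, Finset.filter_subset _ _⟩
      · intro A hA B hB hne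
        obtain ⟨s, hs, rfl⟩ := Finset.mem_image.1 hA
        obtain ⟨s', hs', rfl⟩ := Finset.mem_image.1 hB
        rw [Finset.disjoint_left]
        intro t ht ht'
        apply hne
        rw [← (Finset.mem_filter.1 ht).2, ← (Finset.mem_filter.1 ht').2]
      · intro B hB
        refine ⟨((T.image (sig F)).filter (B ∈ ·)).image (fun s => T.filter (fun t => sig F t = s)),
          Finset.image_subset_image (Finset.filter_subset _ _), ?_⟩
        ext t
        simp only [Finset.mem_sup, Finset.mem_inter, Finset.mem_image, Finset.mem_filter, id]
        constructor
        · rintro ⟨h1, h2⟩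
          exact ⟨_, ⟨sig F t, ⟨⟨t, h2, rfl⟩, Finset.mem_filter.2 ⟨hB, h1⟩⟩, rfl⟩, by simp [h2]⟩
        · rintro ⟨_, ⟨s, ⟨_, h1⟩, rfl⟩, h2⟩
          rw [Finset.mem_filter] at h2
          refine ⟨?_, h2.1⟩
          rw [← h2.2] at h1
          exact (Finset.mem_filter.1 h1).2
  · left
    push Not at hall
    obtain ⟨s, hs, hsp⟩ := hall
    have h2 : 2 * p ≤ (T.filter (fun t => sig F t = s)).card := by
      have h3 := hge s hs
      obtain ⟨k, hk⟩ := hdvd s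
      have : 2 ≤ k := by
        by_contra hk2
        have : k = 0 ∨ k = 1 := by omega
        rcases this with rfl | rfl
        · rw [mul_zero] at hk; omega
        · rw [mul_one] at hk; exact hsp hk
      rw [hk]; nlinarith
    rw [hsum, ← Finset.add_sum_erase _ _ hs]
    have h4 : ((T.image (sig F)).erase s).card * p ≤
        ∑ x ∈ (T.image (sig F)).erase s, (T.filter (fun t => sig F t = x)).card := by
      rw [← smul_eq_mul]
      exact Finset.card_nsmul_le_sum _ _ _ (fun x hx => hge x (Finset.mem_of_mem_erase hx))
    rw [Finset.card_erase_of_mem hs] at h4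
    obtain ⟨k, hk⟩ : ∃ k, (T.image (sig F)).card = k + 1 :=
      ⟨_, (Nat.succ_pred_eq_of_pos (Finset.card_pos.2 ⟨s, hs⟩)).symm⟩
    rw [hk] at h4 hc
    simp only [Nat.add_sub_cancel] at h4
    nlinarith

theorem orth_aux {L : Type*} [Field L] {F : Finset (Finset (Fin n))} {K : ℕ}
    {T : Finset (Fin n)} (h : Hdiv L F K T) (k : ℕ) : ∀ x ∈ (codeT L F T) ^ k,
    ∀ l : List (Finset (Fin n)), (∀ A ∈ l, A ∈ F) → l.length + k = K →
    ∑ t : T, x t * (l.map (fun A => chi L T A t)).prod = 0 := by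
  induction k with
  | zero =>
    intro x hx l hl hk
    rw [pow_zero, Submodule.mem_one] at hx
    obtain ⟨c, rfl⟩ := hx
    simp only [Pi.algebraMap_apply, Algebra.algebraMap_self, RingHom.id_apply]
    rw [← Finset.mul_sum]
    have := h l hl (by omega)
    rw [← Finset.sum_coe_sort] at this
    simp only [chi]
    rw [this, mul_zero]
  | succ k ih =>
    intro x hx l hl hk
    rw [_root_.pow_succ] at hx
    induction hx using Submodule.mul_induction_on' with
    | mem_mul_mem y hy z hz =>
      rw [codeT] at hz
      induction hz using Submodule.span_induction with
      | mem z hz =>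
        obtain ⟨A, hA, rfl⟩ := hz
        have := ih y hy (A :: l) (by
          intro B hB
          rcases List.mem_cons.1 hB with rfl | hB
          · exact hA
          · exact hl B hB) (by simp; omega)
        simpa [mul_assoc] using this
      | zero => simp
      | add u v _ _ hu hv =>
        simp only [Pi.mul_apply, Pi.add_apply, mul_add, add_mul, Finset.sum_add_distrib] at hu hv ⊢
        rw [hu, hv, add_zero]
      | smul c u _ hu =>
        simp only [Pi.mul_apply, Pi.smul_apply, smul_eq_mul] at hu ⊢
        rw [← mul_zero c, ← hu, Finset.mul_sum]
        apply Finset.sum_congr rfl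
        intro t _; ring
    | add u _ v _ hu hv =>
      simp only [Pi.add_apply, add_mul, Finset.sum_add_distrib]
      rw [hu, hv, add_zero]

theorem orth_code {L : Type*} [Field L] {F : Finset (Finset (Fin n))} {p : ℕ}
    {T : Finset (Fin n)} (h : Hdiv L F (p + 1) T) : ∀ x ∈ (codeT L F T) ^ p,
    ∀ y ∈ codeT L F T, ∑ t : T, x t * y t = 0 := by
  intro x hx y hy
  have := orth_aux h (p + 1) (x * y) (by rw [_root_.pow_succ]; exact Submodule.mul_mem_mul hx hy)
    [] (by simp) (by simp)
  simpa using this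

theorem chiProd_mem {L : Type*} [Field L] {F : Finset (Finset (Fin n))}
    (T : Finset (Fin n)) (l : List (Finset (Fin n))) (hl : ∀ A ∈ l, A ∈ F) :
    (fun t : T => (l.map (fun A => chi L T A t)).prod) ∈ (codeT L F T) ^ l.length := by
  induction l with
  | nil =>
    simp only [List.map_nil, List.prod_nil, List.length_nil, pow_zero]
    exact Submodule.one_le.1 le_rfl
  | cons A l ih =>
    rw [List.length_cons, pow_succ']
    have h1 : chi L T A ∈ codeT L F T := Submodule.subset_span ⟨A, hl A (by simp), rfl⟩
    have := Submodule.mul_mem_mul h1 (ih (fun B hB => hl B (by simp [hB])))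
    convert this using 1
    funext t; simp

theorem split_div {L : Type*} [Field L] {F : Finset (Finset (Fin n))} {p : ℕ}
    {T : Finset (Fin n)} (h : Hdiv L F (p + 1) T) (S : Finset (Fin n)) (hST : S ⊆ T)
    (hs : ∀ v ∈ (codeT L F T) ^ p, indV L {t : T | t.1 ∈ S} * v ∈ (codeT L F T) ^ p) :
    Hdiv L F (p + 1) S ∧ Hdiv L F (p + 1) (T \ S) := by
  have h1 : Hdiv L F (p + 1) S := by
    intro l hl hlen
    match l, hl, hlen with
    | [], _, hlen => simp at hlen
    | A :: l, hl, hlen =>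
      have hm := chiProd_mem (L := L) (F := F) T l (fun B hB => hl B (by simp [hB]))
      simp only [List.length_cons, Nat.add_right_cancel_iff] at hlen
      rw [hlen] at hm
      have := orth_code h _ (hs _ hm) (chi L T A)
        (Submodule.subset_span ⟨A, hl A (by simp), rfl⟩)
      refine Eq.trans ?_ this
      rw [← Finset.inter_eq_right.2 hST, ← Finset.filter_mem_eq_inter, Finset.sum_filter,
        ← Finset.sum_coe_sort]
      apply Finset.sum_congr rfl
      intro t _
      by_cases ht : t.1 ∈ S <;> simp [indV, ht, chi, mul_comm]
  refine ⟨h1, ?_⟩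
  intro l hl hlen
  have := Finset.sum_sdiff (f := fun t => (l.map (fun A => if t ∈ A then (1 : L) else 0)).prod) hST
  rw [h l hl hlen, h1 l hl hlen, add_zero] at this
  exact this

theorem finrank_split {L : Type*} [Field L] (F : Finset (Finset (Fin n)))
    (T S : Finset (Fin n)) (hST : S ⊆ T) :
    Module.finrank L (codeT L F T) ≤
      Module.finrank L (codeT L F S) + Module.finrank L (codeT L F (T \ S)) := by
  classical
  let f1 : (T → L) →ₗ[L] (S → L) := LinearMap.funLeft L L (fun s => ⟨s.1, hST s.2⟩)
  let f2 : (T → L) →ₗ[L] ((T \ S : Finset _) → L) :=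
    LinearMap.funLeft L L (fun s => ⟨s.1, Finset.sdiff_subset s.2⟩)
  have hinj : Function.Injective (f1.prod f2) := by
    intro x y hxy
    funext ⟨t, ht⟩
    have e1 : f1 x = f1 y := congrArg Prod.fst hxy
    have e2 : f2 x = f2 y := congrArg Prod.snd hxy
    by_cases hts : t ∈ S
    · exact congrFun e1 ⟨t, hts⟩
    · exact congrFun e2 ⟨t, Finset.mem_sdiff.2 ⟨ht, hts⟩⟩
  have h1 : ∀ x ∈ codeT L F T, f1 x ∈ codeT L F S := by
    have : codeT L F T ≤ (codeT L F S).comap f1 := by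
      rw [codeT, Submodule.span_le]
      rintro _ ⟨A, hA, rfl⟩
      exact Submodule.subset_span ⟨A, hA, rfl⟩
    exact this
  have h2 : ∀ x ∈ codeT L F T, f2 x ∈ codeT L F (T \ S) := by
    have : codeT L F T ≤ (codeT L F (T \ S)).comap f2 := by
      rw [codeT, Submodule.span_le]
      rintro _ ⟨A, hA, rfl⟩
      exact Submodule.subset_span ⟨A, hA, rfl⟩
    exact this
  rw [← Module.finrank_prod]
  apply LinearMap.finrank_le_finrank_of_injective (f := (f1.restrict h1).prod (f2.restrict h2))
  intro x y hxy
  apply Subtype.ext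
  apply hinj
  exact Prod.ext (congrArg (fun z => z.1.1) hxy) (congrArg (fun z => z.2.1) hxy)

theorem good_union {F : Finset (Finset (Fin n))} {p : ℕ} {T S : Finset (Fin n)} (hST : S ⊆ T)
    (h1 : Good F p S) (h2 : Good F p (T \ S)) : Good F p T := by
  classical
  obtain ⟨a, ha1, ha2, ha3⟩ := h1
  obtain ⟨b, hb1, hb2, hb3⟩ := h2
  have hd : ∀ A ∈ a, ∀ B ∈ b, Disjoint A B := by
    intro A hA B hB
    exact Disjoint.mono (ha1 A hA).2 (hb1 B hB).2 Finset.disjoint_sdiff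
  refine ⟨a ∪ b, ?_, ?_, ?_⟩
  · intro A hA
    rcases Finset.mem_union.1 hA with hA | hA
    · exact ⟨(ha1 A hA).1, (ha1 A hA).2.trans hST⟩
    · exact ⟨(hb1 A hA).1, (hb1 A hA).2.trans Finset.sdiff_subset⟩
  · intro A hA B hB hne
    rcases Finset.mem_union.1 hA with hA | hA <;> rcases Finset.mem_union.1 hB with hB | hB
    · exact ha2 A hA B hB hne
    · exact hd A hA B hB
    · exact (hd B hB A hA).symm
    · exact hb2 A hA B hB hne
  · intro B hB
    obtain ⟨s, hs, hs'⟩ := ha3 B hB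
    obtain ⟨u, hu, hu'⟩ := hb3 B hB
    refine ⟨s ∪ u, Finset.union_subset_union hs hu, ?_⟩
    rw [Finset.sup_union, ← hs', ← hu', Finset.sup_eq_union, ← Finset.inter_union_distrib_left,
      Finset.union_sdiff_of_subset hST]

theorem num_bound (p : ℕ) : 2 * (p * p) ≤ 2 ^ (p + 2) := by
  have h : ∀ k : ℕ, 2 * ((k + 3) * (k + 3)) ≤ 2 ^ (k + 3 + 2) := by
    intro k
    induction k with
    | zero => norm_num
    | succ k ih =>
      have : 2 ^ (k + 1 + 3 + 2) = 2 * 2 ^ (k + 3 + 2) := by ring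
      rw [this]
      nlinarith
  rcases Nat.lt_or_ge p 3 with h3 | h3
  · interval_cases p <;> norm_num
  · obtain ⟨k, rfl⟩ := Nat.exists_eq_add_of_le' h3
    exact h k

theorem main_ind {L : Type*} [Field L] [Infinite L] (p : ℕ) (hp : p.Prime) [CharP L p]
    (F : Finset (Finset (Fin n))) (N : ℕ) : ∀ T : Finset (Fin n), T.card = N → T ⊆ F.sup id →
    Hdiv L F (p + 1) T →
    p * (Module.finrank L (codeT L F T) + 1) ≤ T.card ∨
      (p * Module.finrank L (codeT L F T) ≤ T.card ∧ Good F p T) := by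
  classical
  induction N using Nat.strong_induction_on with
  | _ N ih =>
  intro T hN hT hdiv
  by_cases hdvd : ∀ s, p ∣ (T.filter (fun t => sig F t = s)).card
  · exact good_of_dvd F T p hdvd
  push Not at hdvd
  obtain ⟨s0, hs0⟩ := hdvd
  have hbig := big_of_not_dvd (L := L) hdiv hT s0 (by
    rw [Ne, CharP.cast_eq_zero_iff L p]; exact hs0)
  have hp2 := hp.two_le
  set c := Module.finrank L (codeT L F T) with hc
  by_cases hcs : c + 2 ≤ 2 * p
  · left
    have := num_bound p
    have e : p + 1 + 1 = p + 2 := rfl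
    rw [e] at hbig
    nlinarith
  by_cases hst : ∀ S : Set T, (∀ v ∈ (codeT L F T) ^ p, indV L S * v ∈ (codeT L F T) ^ p) →
      S = ∅ ∨ S = Set.univ
  · left
    obtain ⟨k, rfl⟩ : ∃ k, p = k + 1 := ⟨p - 1, by omega⟩
    have hfs : FullSupp (codeT L F T) := by
      intro t
      obtain ⟨A, hA, htA⟩ := Finset.mem_sup.1 (hT t.2)
      refine ⟨chi L T A, Submodule.subset_span ⟨A, hA, rfl⟩, ?_⟩
      have : t.1 ∈ A := htA
      simp [chi, this]
    have h1 := (kneser_pow (codeT L F T) hfs k hst).2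
    have h2 := finrank_orth _ _ (orth_code hdiv)
    rw [Fintype.card_coe] at h2
    rw [← hc] at h1 h2
    nlinarith
  · push Not at hst
    obtain ⟨S', hS', hne, hnu⟩ := hst
    let S : Finset (Fin n) := T.filter (fun t => ∃ h : t ∈ T, (⟨t, h⟩ : T) ∈ S')
    have hST : S ⊆ T := Finset.filter_subset _ _
    have hSS : {t : T | t.1 ∈ S} = S' := by
      ext ⟨t, ht⟩
      simp [S, ht]
    have hsd := split_div hdiv S hST (by rw [hSS]; exact hS')
    have hcardS := Finset.card_sdiff_add_card_eq_card hST
    obtain ⟨⟨t, ht⟩, htS⟩ := hne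
    have hpos1 : 0 < S.card := Finset.card_pos.2 ⟨t, by simp [S, ht, htS]⟩
    obtain ⟨⟨u, hu⟩, huS⟩ := (Set.ne_univ_iff_exists_notMem _).1 hnu
    have hpos2 : 0 < (T \ S).card := Finset.card_pos.2 ⟨u, by simp [S, hu, huS]⟩
    have g1 := ih S.card (by omega) S rfl (hST.trans hT) hsd.1
    have g2 := ih (T \ S).card (by omega) (T \ S) rfl (Finset.sdiff_subset.trans hT) hsd.2
    have hfr := finrank_split (L := L) F T S hST
    rw [← hc] at hfr
    have hmul := Nat.mul_le_mul_left p hfr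
    rw [mul_add] at hmul
    simp only [mul_add, mul_one] at g1 g2 ⊢
    rcases g1 with g1 | ⟨g1, g1'⟩
    · left; rcases g2 with g2 | ⟨g2, g2'⟩ <;> omega
    · rcases g2 with g2 | ⟨g2, g2'⟩
      · left; omega
      · right; exact ⟨by omega, good_union hST g1' g2'⟩

end comb

/-- large (p+1)-wise p-divisible families are contained in an atomic
family with atoms of size p. -/
theorem statement1 (n p : ℕ) (hp : p.Prime) (𝓕 : Finset (Finset (Fin n)))
    (hdiv : kWiseDiv n (p + 1) p 𝓕)
    (hcard : (2 : ℝ) ^ (((n / p : ℕ) : ℤ) - 1) < (𝓕.card : ℝ)) :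
    ∃ 𝒜 : Finset (Finset (Fin n)),
      (∀ A ∈ 𝒜, A.card = p) ∧
      (∀ A ∈ 𝒜, ∀ B ∈ 𝒜, A ≠ B → Disjoint A B) ∧
      (∀ B ∈ 𝓕, ∃ 𝒮 ⊆ 𝒜, B = 𝒮.sup id) := by
  classical
  haveI : Fact p.Prime := ⟨hp⟩
  let L := AlgebraicClosure (ZMod p)
  haveI : Infinite L := IsAlgClosed.instInfinite
  let T : Finset (Fin n) := 𝓕.sup id
  have hH : Hdiv L 𝓕 (p + 1) T := by
    intro l hl hlen
    simp only [prod_ind]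
    rw [Finset.sum_boole, CharP.cast_eq_zero_iff L p]
    have := hdiv (fun i => l.get (i.cast hlen.symm)) (fun i => hl _ (List.get_mem _ _))
    convert this using 2
    ext t
    simp only [Finset.mem_filter, Finset.mem_inf, Finset.mem_univ, true_imp_iff]
    constructor
    · rintro ⟨_, h⟩ i
      exact h _ (List.get_mem _ _)
    · intro h
      have h' : ∀ A ∈ l, t ∈ A := by
        intro A hA
        obtain ⟨i, rfl⟩ := List.get_of_mem hA
        exact h (i.cast hlen)
      refine ⟨?_, h'⟩
      exact Finset.mem_sup.2 ⟨_, hl _ (List.get_mem l ((0 : Fin (p + 1)).cast hlen.symm)), h 0⟩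
  have hsub : ∀ B ∈ 𝓕, B ⊆ T := fun B hB => Finset.le_sup (f := id) hB
  have hcount : 𝓕.card ≤ 2 ^ Module.finrank L (codeT L 𝓕 T) := by
    have hinj : Set.InjOn (chi L T) (𝓕 : Set (Finset (Fin n))) := by
      have key : ∀ A ∈ 𝓕, ∀ B ∈ 𝓕, chi L T A = chi L T B → A ⊆ B := by
        intro A hA B hB hAB t ht
        have := congrFun hAB ⟨t, hsub A hA ht⟩
        by_contra hc
        simp [chi, ht, hc] at this
      intro A hA B hB hAB
      exact (key A hA B hB hAB).antisymm (key B hB A hA hAB.symm)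
    rw [← Finset.card_image_of_injOn hinj]
    apply count_zero_one
    · intro x hx
      obtain ⟨A, hA, rfl⟩ := Finset.mem_image.1 hx
      exact Submodule.subset_span ⟨A, hA, rfl⟩
    · intro x hx i
      obtain ⟨A, hA, rfl⟩ := Finset.mem_image.1 hx
      by_cases h : i.1 ∈ A <;> simp [chi, h]
  have hc : n / p ≤ Module.finrank L (codeT L 𝓕 T) := by
    have h1 : (2 : ℝ) ^ (((n / p : ℕ) : ℤ) - 1) <
        (2 : ℝ) ^ ((Module.finrank L (codeT L 𝓕 T) : ℕ) : ℤ) := by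
      refine lt_of_lt_of_le hcard ?_
      rw [zpow_natCast]
      exact_mod_cast hcount
    have h2 := (zpow_lt_zpow_iff_right₀ (by norm_num : (1 : ℝ) < 2)).1 h1
    omega
  have hTn : T.card ≤ n := by simpa using Finset.card_le_univ T
  have hlt : n < p * (n / p + 1) := Nat.lt_mul_div_succ n hp.pos
  have hmul := Nat.mul_le_mul_left p (Nat.add_le_add_right hc 1)
  rcases main_ind (L := L) p hp 𝓕 _ T rfl le_rfl hH with h | ⟨_, 𝒜, h1, h2, h3⟩
  · omega
  · refine ⟨𝒜, fun A hA => (h1 A hA).1, h2, ?_⟩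
    intro B hB
    obtain ⟨𝒮, hS, hS'⟩ := h3 B hB
    exact ⟨𝒮, hS, by rw [← hS', Finset.inter_eq_left.2 (hsub B hB)]⟩
end

section
/- Let ℓ be a positive integer and let F ⊆ 2^[n] be a 4ℓ²-wise ℓ-divisible set family. Then |F| ≤ 2^⌊n/ℓ⌋. -/
open Submodule

/-- Abstract matroid covering theorem (Edmonds). -/
theorem cover_aux {α : Type*} [DecidableEq α] (ρ : Finset α → ℕ)
    (hmono : ∀ A B, A ⊆ B → ρ A ≤ ρ B)
    (hsub : ∀ A B, ρ (A ∪ B) + ρ (A ∩ B) ≤ ρ A + ρ B)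
    (hcard : ∀ A, ρ A ≤ A.card) (Z : Finset α) (k : ℕ) :
    ∀ (N : ℕ) (C : α → Finset (Fin k)), ∑ z ∈ Z, (C z).card = N →
      (∀ A ⊆ Z, A.card ≤ ∑ j, ρ (A.filter (fun z => j ∈ C z))) →
      ∃ I : Fin k → Finset α, (∀ j, I j ⊆ Z ∧ ρ (I j) = (I j).card) ∧
        ∀ z ∈ Z, ∃ j, z ∈ I j := by
  intro N
  induction N using Nat.strong_induction_on with
  | _ N ih =>
  intro C hN hP
  by_cases hall : ∀ z ∈ Z, (C z).card ≤ 1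
  · refine ⟨fun j => Z.filter (fun z => j ∈ C z), ?_, ?_⟩
    · have h1 : ∑ j, (Z.filter (fun z => j ∈ C z)).card ≤ ∑ j, ρ (Z.filter (fun z => j ∈ C z)) := by
        refine le_trans ?_ (hP Z subset_rfl)
        have : ∑ j, (Z.filter (fun z => j ∈ C z)).card = ∑ z ∈ Z, (C z).card := by
          simp only [Finset.card_filter]
          rw [Finset.sum_comm]
          refine Finset.sum_congr rfl fun z _ => ?_
          simp
        rw [this]
        calc _ ≤ ∑ z ∈ Z, 1 := Finset.sum_le_sum hall
          _ = _ := by simp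
      intro j
      refine ⟨Finset.filter_subset _ _, ?_⟩
      have h2 := (Finset.sum_eq_sum_iff_of_le (s := Finset.univ)
        (f := fun j => ρ (Z.filter (fun z => j ∈ C z)))
        (g := fun j => (Z.filter (fun z => j ∈ C z)).card) (fun j _ => hcard _)).1
        (le_antisymm (Finset.sum_le_sum fun j _ => hcard _) h1)
      exact h2 j (Finset.mem_univ _)
    · intro z hz
      by_contra hcon
      push Not at hcon
      have h := hP {z} (by simpa using hz)
      have h0 : ∀ j, ({z} : Finset α).filter (fun z => j ∈ C z) = ∅ := by
        intro j
        have hj := hcon j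
        simp only [Finset.mem_filter, hz, true_and] at hj
        rw [Finset.filter_singleton, if_neg hj]
      have h00 : ρ ∅ = 0 := by simpa using hcard ∅
      simp [h0, h00] at h
  · push Not at hall
    obtain ⟨z0, hz0, hc⟩ := hall
    obtain ⟨x, hx, y, hy, hxy⟩ := Finset.one_lt_card.1 hc
    have key : ∀ x ∈ C z0, (∀ A ⊆ Z, A.card ≤ ∑ j, ρ (A.filter
        (fun z => j ∈ Function.update C z0 ((C z0).erase x) z))) →
        ∃ I : Fin k → Finset α, (∀ j, I j ⊆ Z ∧ ρ (I j) = (I j).card) ∧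
        ∀ z ∈ Z, ∃ j, z ∈ I j := by
      intro x hx hA
      refine ih _ ?_ (Function.update C z0 ((C z0).erase x)) rfl hA
      rw [← hN]
      refine Finset.sum_lt_sum ?_ ⟨z0, hz0, ?_⟩
      · intro z _
        by_cases hz : z = z0
        · subst hz; simpa using Finset.card_le_card (Finset.erase_subset x (C z))
        · simp [Function.update_of_ne hz]
      · simpa using Finset.card_erase_lt_of_mem hx
    by_contra hno
    have n1 := fun h => hno (key x hx h)
    have n2 := fun h => hno (key y hy h)
    rw [imp_false] at n1 n2
    push Not at n1 n2
    obtain ⟨A1, hA1, h1⟩ := n1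
    obtain ⟨A2, hA2, h2⟩ := n2
    have e1 := hP (A1 ∪ A2) (Finset.union_subset hA1 hA2)
    have e2 := hP ((A1 ∩ A2).erase z0)
      ((Finset.erase_subset _ _).trans (Finset.inter_subset_left.trans hA1))
    have e3 := Finset.card_union_add_card_inter A1 A2
    have e4 := Finset.pred_card_le_card_erase (s := A1 ∩ A2) (a := z0)
    have e5 : ∑ j, ρ ((A1 ∪ A2).filter (fun z => j ∈ C z)) +
        ∑ j, ρ (((A1 ∩ A2).erase z0).filter (fun z => j ∈ C z)) ≤
        ∑ j, ρ (A1.filter (fun z => j ∈ Function.update C z0 ((C z0).erase x) z)) +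
        ∑ j, ρ (A2.filter (fun z => j ∈ Function.update C z0 ((C z0).erase y) z)) := by
      rw [← Finset.sum_add_distrib, ← Finset.sum_add_distrib]
      refine Finset.sum_le_sum fun j _ => ?_
      by_cases hz1 : z0 ∈ A1 <;> by_cases hz2 : z0 ∈ A2
      on_goal 1 =>
        refine le_trans (add_le_add (hmono _ _ ?_) (hmono _ _ ?_)) (hsub _ _)
        · intro z hz
          simp only [Finset.mem_filter, Finset.mem_union] at hz ⊢
          by_cases h : z = z0
          · subst h
            simp only [Function.update_self, Finset.mem_erase]
            by_cases hjx : j = x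
            · right; exact ⟨hz2, by rw [hjx]; exact hxy, hz.2⟩
            · left; exact ⟨hz1, hjx, hz.2⟩
          · simp only [Function.update_of_ne h]; tauto
        · intro z hz
          simp only [Finset.mem_filter, Finset.mem_inter, Finset.mem_erase] at hz ⊢
          simp only [Function.update_of_ne hz.1.1]; tauto
      all_goals exfalso
      · have : ∀ j, A2.filter (fun z => j ∈ Function.update C z0 ((C z0).erase y) z)
            = A2.filter (fun z => j ∈ C z) := fun j => Finset.filter_congr fun z hz => by
          rw [Function.update_of_ne (ne_of_mem_of_not_mem hz hz2)]
        simp only [this] at h2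
        exact absurd (hP A2 hA2) (not_le.2 h2)
      all_goals
        have : ∀ j, A1.filter (fun z => j ∈ Function.update C z0 ((C z0).erase x) z)
            = A1.filter (fun z => j ∈ C z) := fun j => Finset.filter_congr fun z hz => by
          rw [Function.update_of_ne (ne_of_mem_of_not_mem hz hz1)]
        simp only [this] at h1
        exact absurd (hP A1 hA1) (not_le.2 h1)
    omega

theorem cover_s2 {α : Type*} [DecidableEq α] (ρ : Finset α → ℕ)
    (hmono : ∀ A B, A ⊆ B → ρ A ≤ ρ B)
    (hsub : ∀ A B, ρ (A ∪ B) + ρ (A ∩ B) ≤ ρ A + ρ B)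
    (hcard : ∀ A, ρ A ≤ A.card) (Z : Finset α) (k : ℕ)
    (h : ∀ A ⊆ Z, A.card ≤ k * ρ A) :
    ∃ I : Fin k → Finset α, (∀ j, I j ⊆ Z ∧ ρ (I j) = (I j).card) ∧
        ∀ z ∈ Z, ∃ j, z ∈ I j := by
  refine cover_aux ρ hmono hsub hcard Z k _ (fun _ => Finset.univ) rfl ?_
  intro A hA
  simpa using h A hA

/-- elements of `V` vanishing on `A` -/
def vanOn {K ι : Type*} [Field K] (V : Submodule K (ι → K)) (A : Finset ι) :
    Submodule K (ι → K) where
  carrier := {v | v ∈ V ∧ ∀ a ∈ A, v a = 0}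
  add_mem' := fun {u v} hu hv => ⟨V.add_mem hu.1 hv.1, fun a ha => by
    simp [hu.2 a ha, hv.2 a ha]⟩
  zero_mem' := ⟨V.zero_mem, fun _ _ => rfl⟩
  smul_mem' := fun c {u} hu => ⟨V.smul_mem c hu.1, fun a ha => by simp [hu.2 a ha]⟩

section van
set_option linter.unusedSectionVars false
variable {K ι : Type*} [Field K] [Fintype ι] [DecidableEq ι] (V : Submodule K (ι → K))

theorem mem_vanOn {A : Finset ι} {v : ι → K} :
    v ∈ vanOn V A ↔ v ∈ V ∧ ∀ a ∈ A, v a = 0 := Iff.rfl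

theorem vanOn_anti {A B : Finset ι} (h : A ⊆ B) : vanOn V B ≤ vanOn V A :=
  fun _ hv => ⟨hv.1, fun a ha => hv.2 a (h ha)⟩

/-- dimension of the space of elements vanishing on `A` -/
noncomputable def vdim (A : Finset ι) : ℕ := Module.finrank K (vanOn V A)

theorem vdim_anti {A B : Finset ι} (h : A ⊆ B) : vdim V B ≤ vdim V A :=
  Submodule.finrank_mono (vanOn_anti V h)

theorem vdim_super (A B : Finset ι) :
    vdim V A + vdim V B ≤ vdim V (A ∪ B) + vdim V (A ∩ B) := by
  have h := Submodule.finrank_sup_add_finrank_inf_eq (vanOn V A) (vanOn V B)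
  have h1 : vanOn V A ⊓ vanOn V B = vanOn V (A ∪ B) := by
    ext v
    simp only [Submodule.mem_inf, mem_vanOn, Finset.mem_union]
    constructor
    · rintro ⟨⟨h1, h2⟩, _, h3⟩
      exact ⟨h1, fun a ha => ha.elim (h2 a) (h3 a)⟩
    · rintro ⟨h1, h2⟩
      exact ⟨⟨h1, fun a ha => h2 a (Or.inl ha)⟩, h1, fun a ha => h2 a (Or.inr ha)⟩
  have h2 : vanOn V A ⊔ vanOn V B ≤ vanOn V (A ∩ B) :=
    sup_le (vanOn_anti V Finset.inter_subset_left) (vanOn_anti V Finset.inter_subset_right)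
  have h3 := Submodule.finrank_mono h2
  rw [h1] at h
  unfold vdim
  omega

theorem vdim_insert (A : Finset ι) (z : ι) : vdim V A ≤ vdim V (insert z A) + 1 := by
  let φ : vanOn V A →ₗ[K] K := (LinearMap.proj z).comp (vanOn V A).subtype
  have h := LinearMap.finrank_range_add_finrank_ker φ
  have h1 : Module.finrank K (LinearMap.range φ) ≤ 1 := by
    simpa using Submodule.finrank_le (LinearMap.range φ)
  have h2 : Module.finrank K (LinearMap.ker φ) ≤ vdim V (insert z A) := by
    rw [← Submodule.finrank_map_subtype_eq]
    refine Submodule.finrank_mono ?_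
    rintro _ ⟨v, hv, rfl⟩
    refine ⟨v.2.1, fun a ha => ?_⟩
    rcases Finset.mem_insert.1 ha with rfl | ha
    · exact hv
    · exact v.2.2 a ha
  unfold vdim at *
  omega

theorem vdim_union (A B : Finset ι) : vdim V B ≤ vdim V (A ∪ B) + A.card := by
  induction A using Finset.induction_on with
  | empty => simp
  | insert a s ha ih =>
    rw [Finset.insert_union, Finset.card_insert_of_notMem ha]
    have := vdim_insert V (s ∪ B) a
    omega

theorem exists_of_vdim_lt {A : Finset ι} {z : ι} (h : vdim V (insert z A) < vdim V A) :
    ∃ v ∈ V, (∀ a ∈ A, v a = 0) ∧ v z ≠ 0 := by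
  by_contra hcon
  push Not at hcon
  have : vanOn V A ≤ vanOn V (insert z A) := fun v hv => ⟨hv.1, fun a ha => by
    rcases Finset.mem_insert.1 ha with rfl | ha
    · exact hcon v hv.1 hv.2
    · exact hv.2 a ha⟩
  exact absurd (Submodule.finrank_mono this) (not_le.2 h)

theorem exists_basis_set (Y : Finset ι) :
    ∃ I ⊆ Y, vanOn V I = vanOn V Y ∧ I.card + vdim V Y ≤ vdim V ∅ := by
  induction Y using Finset.induction_on with
  | empty => exact ⟨∅, subset_rfl, rfl, by simp⟩
  | insert z Y hz ih =>
    obtain ⟨I, hI, hv, hc⟩ := ih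
    by_cases h : vanOn V (insert z Y) = vanOn V Y
    · exact ⟨I, hI.trans (Finset.subset_insert _ _), by rw [hv, h], by unfold vdim at *; rwa [h]⟩
    · refine ⟨insert z I, Finset.insert_subset_insert _ hI, ?_, ?_⟩
      · ext v
        have := SetLike.ext_iff.1 hv v
        simp only [mem_vanOn, Finset.mem_insert, forall_eq_or_imp] at this ⊢
        tauto
      · have h1 : vdim V (insert z Y) < vdim V Y :=
          Submodule.finrank_lt_finrank_of_lt
            (lt_of_le_of_ne (vanOn_anti V (Finset.subset_insert _ _)) h)
        have := Finset.card_insert_le z I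
        omega

theorem key_lemma (Y : Finset ι) (c : ℕ) (hY : Y.card + c * vdim V Y < c * vdim V ∅)
    (hne : ∀ y ∈ Y, ∃ v ∈ V, v y ≠ 0)
    (hsep : ∀ y ∈ Y, ∀ x ∈ Y, x ≠ y → ∃ v ∈ V, v x = 0 ∧ v y ≠ 0) :
    ∃ y ∈ Y, ∃ f ∈ V ^ (3 * c), f y ≠ 0 ∧ ∀ x ∈ Y, x ≠ y → f x = 0 := by
  have hc : 0 < c := by
    rcases Nat.eq_zero_or_pos c with rfl | h
    · simp at hY
    · exact h
  obtain ⟨A, hA, hmax⟩ := Finset.exists_max_image Y.powerset (fun A => A.card + c * vdim V A)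
    ⟨∅, by simp⟩
  simp only [Finset.mem_powerset] at hA hmax
  have hne' : A ≠ Y := by
    rintro rfl
    have := hmax ∅ (by simp)
    simp only [Finset.card_empty, zero_add] at this
    omega
  obtain ⟨y, hy, hyA⟩ := Finset.exists_of_ssubset (lt_of_le_of_ne hA hne')
  refine ⟨y, hy, ?_⟩
  have hsubY : ∀ B, B ⊆ Y → B ∪ insert y A ⊆ Y := fun B hB =>
    Finset.union_subset hB (Finset.insert_subset hy hA)
  have hy1 : vdim V (insert y A) + 1 = vdim V A := by
    have h1 := vdim_insert V A y
    have h2 := hmax (insert y A) (Finset.insert_subset hy hA)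
    rw [Finset.card_insert_of_notMem hyA] at h2
    have h3 := vdim_anti V (Finset.subset_insert y A)
    rcases Nat.lt_or_ge (vdim V (insert y A)) (vdim V A) with h | h
    · omega
    · have : vdim V (insert y A) = vdim V A := le_antisymm h3 h
      rw [this] at h2; omega
  classical
  set P := (Y \ A).filter (fun z => ∀ v ∈ vanOn V (insert y A), v z = 0) with hP
  have hPc : P.card ≤ c := by
    have h1 : vanOn V (insert y A) ≤ vanOn V (A ∪ P) := by
      intro v hv
      refine ⟨hv.1, fun a ha => ?_⟩
      rcases Finset.mem_union.1 ha with ha | ha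
      · exact hv.2 a (Finset.mem_insert_of_mem ha)
      · exact (Finset.mem_filter.1 ha).2 v hv
    have h2 : vdim V (insert y A) ≤ vdim V (A ∪ P) := Submodule.finrank_mono h1
    have h3 := hmax (A ∪ P) (Finset.union_subset hA
      ((Finset.filter_subset _ _).trans Finset.sdiff_subset))
    rw [Finset.card_union_of_disjoint] at h3
    · rw [← hy1] at h3
      have := Nat.mul_le_mul_left c h2
      rw [mul_add] at h3
      omega
    · exact (Finset.disjoint_sdiff).mono_right (Finset.filter_subset _ _)
  have hyP : y ∈ P := by
    simp only [hP, Finset.mem_filter, Finset.mem_sdiff]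
    exact ⟨⟨hy, hyA⟩, fun v hv => hv.2 y (Finset.mem_insert_self _ _)⟩
  set Z := (Y \ A) \ P with hZ
  have hZY : Z ⊆ Y := Finset.sdiff_subset.trans Finset.sdiff_subset
  set D := insert y A with hD
  obtain ⟨I, hI, hcov⟩ := cover_s2 (fun B => vdim V D - vdim V (B ∪ D))
    (fun B B' h => Nat.sub_le_sub_left (vdim_anti V (Finset.union_subset_union_left h)) _)
    (fun B B' => by
      have h1 := vdim_super V (B ∪ D) (B' ∪ D)
      have e1 : (B ∪ D) ∪ (B' ∪ D) = (B ∪ B') ∪ D := by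
        ext; simp only [Finset.mem_union]; tauto
      have e2 : (B ∪ D) ∩ (B' ∪ D) = (B ∩ B') ∪ D := by
        ext; simp only [Finset.mem_union, Finset.mem_inter]; tauto
      rw [e1, e2] at h1
      have h2 := vdim_anti V (Finset.subset_union_right (s₁ := B) (s₂ := D))
      have h3 := vdim_anti V (Finset.subset_union_right (s₁ := B') (s₂ := D))
      have h4 := vdim_anti V (Finset.subset_union_right (s₁ := B ∪ B') (s₂ := D))
      have h5 := vdim_anti V (Finset.subset_union_right (s₁ := B ∩ B') (s₂ := D))
      omega)
    (fun B => by have := vdim_union V B D; omega) Z (2 * c) (by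
      intro B hB
      rcases B.eq_empty_or_nonempty with rfl | ⟨z, hz⟩
      · simp
      have h1 := hmax (B ∪ D) (hsubY B (hB.trans hZY))
      have hdis : Disjoint B D := by
        rw [Finset.disjoint_left]
        intro b hb hbD
        have hbZ := hB hb
        simp only [hZ, Finset.mem_sdiff] at hbZ
        rcases Finset.mem_insert.1 hbD with rfl | h
        · exact hbZ.2 hyP
        · exact hbZ.1.2 h
      rw [Finset.card_union_of_disjoint hdis, hD, Finset.card_insert_of_notMem hyA, ← hD,
        ← hy1] at h1
      have h2 := vdim_anti V (Finset.subset_union_right (s₁ := B) (s₂ := D))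
      have h3 : vdim V (B ∪ D) < vdim V D := by
        have hzZ := hB hz
        simp only [hZ, hP, Finset.mem_sdiff, Finset.mem_filter, not_and, not_forall] at hzZ
        obtain ⟨v, hv, hvz⟩ := hzZ.2 hzZ.1
        refine Submodule.finrank_lt_finrank_of_lt (lt_of_le_of_ne
          (vanOn_anti V Finset.subset_union_right) ?_)
        intro h
        rw [← h] at hv
        exact hvz (hv.2 z (Finset.mem_union_left _ hz))
      obtain ⟨t, ht⟩ := Nat.exists_eq_add_of_lt h3
      have : vdim V D - vdim V (B ∪ D) = t + 1 := by omega
      rw [this]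
      rw [ht] at h1
      nlinarith)
  have hv : ∀ j, ∃ v ∈ V, (∀ a ∈ I j ∪ A, v a = 0) ∧ v y ≠ 0 := by
    intro j
    apply exists_of_vdim_lt
    have h1 := (hI j).2
    have e : I j ∪ D = insert y (I j ∪ A) := by rw [hD, Finset.union_insert]
    rw [e] at h1
    have h2 := vdim_union V (I j) A
    have h3 := vdim_anti V (show D ⊆ insert y (I j ∪ A) by rw [← e]; exact Finset.subset_union_right)
    have h1' : vdim V D - vdim V (insert y (I j ∪ A)) = (I j).card := h1
    omega
  choose v hvV hv0 hvy using hv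
  have hw : ∀ x : ι, ∃ w ∈ V, w y ≠ 0 ∧ (x ∈ P.erase y → w x = 0) := by
    intro x
    by_cases hx : x ∈ P.erase y
    · obtain ⟨w, hw, h1, h2⟩ := hsep y hy x (Finset.sdiff_subset (Finset.filter_subset _ _
        (Finset.mem_of_mem_erase hx))) (Finset.ne_of_mem_erase hx)
      exact ⟨w, hw, h2, fun _ => h1⟩
    · obtain ⟨w, hw, h⟩ := hne y hy
      exact ⟨w, hw, h, fun h => absurd h hx⟩
  choose w hwV hwy hw0 using hw
  obtain ⟨u, huV, huy⟩ := hne y hy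
  have hpow : ∀ (s : Finset ι), ∏ x ∈ s, w x ∈ V ^ s.card := by
    intro s
    induction s using Finset.induction_on with
    | empty => simp [Submodule.one_le.1 le_rfl]
    | insert a s ha ih =>
      rw [Finset.prod_insert ha, Finset.card_insert_of_notMem ha, pow_succ']
      exact Submodule.mul_mem_mul (hwV a) ih
  have hpow2 : ∀ (s : Finset (Fin (2 * c))), ∏ x ∈ s, v x ∈ V ^ s.card := by
    intro s
    induction s using Finset.induction_on with
    | empty => simp [Submodule.one_le.1 le_rfl]
    | insert a s ha ih =>
      rw [Finset.prod_insert ha, Finset.card_insert_of_notMem ha, pow_succ']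
      exact Submodule.mul_mem_mul (hvV a) ih
  refine ⟨(∏ j, v j) * ((∏ x ∈ P.erase y, w x) * u ^ (c - (P.erase y).card)), ?_, ?_, ?_⟩
  · have hle : (P.erase y).card ≤ c := (Finset.card_le_card (Finset.erase_subset _ _)).trans hPc
    have : 3 * c = (Finset.univ : Finset (Fin (2 * c))).card +
      ((P.erase y).card + (c - (P.erase y).card)) := by
      rw [Finset.card_univ, Fintype.card_fin]; omega
    rw [this, pow_add, pow_add]
    exact Submodule.mul_mem_mul (hpow2 _) (Submodule.mul_mem_mul (hpow _)
      (Submodule.pow_mem_pow _ huV _))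
  · simp only [Pi.mul_apply, Finset.prod_apply, Pi.pow_apply]
    refine mul_ne_zero (Finset.prod_ne_zero_iff.2 fun j _ => hvy j) (mul_ne_zero
      (Finset.prod_ne_zero_iff.2 fun j _ => hwy j) (pow_ne_zero _ huy))
  · intro x hx hxy
    simp only [Pi.mul_apply, Finset.prod_apply, Pi.pow_apply]
    by_cases hxA : x ∈ A
    · rw [Finset.prod_eq_zero (Finset.mem_univ (⟨0, by omega⟩ : Fin (2 * c)))
        (hv0 _ x (Finset.mem_union_right _ hxA)), zero_mul]
    by_cases hxP : x ∈ P
    · have hx' : x ∈ P.erase y := Finset.mem_erase.2 ⟨hxy, hxP⟩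
      rw [Finset.prod_eq_zero (f := fun c => w c x) hx' (hw0 x hx'), zero_mul, mul_zero]
    · obtain ⟨j, hj⟩ := hcov x (by simp [hZ, hx, hxA, hxP])
      rw [Finset.prod_eq_zero (Finset.mem_univ j) (hv0 _ x (Finset.mem_union_left _ hj)), zero_mul]

end van

/-- span of the characteristic vectors of the family -/
def famSpan (R : Type*) [CommRing R] {n : ℕ} (F : Finset (Finset (Fin n))) :
    Submodule R (Fin n → R) := Submodule.span R (charVec R '' (F : Set (Finset (Fin n))))

theorem famSpan_le_succ (R : Type*) [CommRing R] {n : ℕ} (F : Finset (Finset (Fin n))) :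
    famSpan R F ≤ famSpan R F * famSpan R F := by
  unfold famSpan
  rw [Submodule.span_le]
  rintro _ ⟨A, hA, rfl⟩
  have : charVec R A = charVec R A * charVec R A := by
    funext x; by_cases h : x ∈ A <;> simp [charVec, h]
  rw [this]
  exact Submodule.mul_mem_mul (Submodule.subset_span ⟨A, hA, rfl⟩)
    (Submodule.subset_span ⟨A, hA, rfl⟩)

theorem famSpan_pow_mono (R : Type*) [CommRing R] {n : ℕ} (F : Finset (Finset (Fin n)))
    {k k' : ℕ} (hk : 1 ≤ k) (h : k ≤ k') : famSpan R F ^ k ≤ famSpan R F ^ k' := by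
  induction k', h using Nat.le_induction with
  | base => exact le_rfl
  | succ m hm ih =>
    refine ih.trans ?_
    obtain ⟨t, rfl⟩ : ∃ t, m = t + 1 := ⟨m - 1, by omega⟩
    rw [pow_succ _ (t + 1), pow_succ _ t, mul_assoc]
    exact mul_le_mul' le_rfl (famSpan_le_succ R F)

theorem famSpan_dvd {n k ℓ : ℕ} (F : Finset (Finset (Fin n))) (hdiv : kWiseDiv n k ℓ F)
    (g : Fin n → ℤ) (hg : g ∈ famSpan ℤ F ^ k) : (ℓ : ℤ) ∣ ∑ x, g x := by
  unfold famSpan at hg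
  rw [Submodule.span_pow] at hg
  induction hg using Submodule.span_induction with
  | mem x h =>
    rw [Set.mem_pow] at h
    obtain ⟨f, rfl⟩ := h
    choose A hA hAf using fun i => (f i).2
    have h1 : ∀ x, (List.ofFn fun i => (f i : Fin n → ℤ)).prod x =
        if x ∈ Finset.univ.inf A then 1 else 0 := by
      intro x
      rw [List.prod_ofFn, Finset.prod_apply]
      simp only [← hAf, charVec, Finset.mem_inf, Finset.mem_univ, true_implies]
      rw [Finset.prod_ite_zero]
      simp
    simp only [h1, Finset.sum_boole, Finset.filter_mem_eq_inter, Finset.univ_inter]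
    exact_mod_cast hdiv A hA
  | zero => simp
  | add x y _ _ hx hy => simpa [Finset.sum_add_distrib] using dvd_add hx hy
  | smul a x _ hx =>
    simp only [Pi.smul_apply, smul_eq_mul, ← Finset.mul_sum]
    exact Dvd.dvd.mul_left hx a

theorem famSpan_lift {n : ℕ} (p : ℕ) [NeZero p] (F : Finset (Finset (Fin n))) (k : ℕ) :
    ∀ w ∈ famSpan (ZMod p) F ^ k, ∃ g ∈ famSpan ℤ F ^ k, ∀ x, ((g x : ℤ) : ZMod p) = w x := by
  induction k with
  | zero =>
    intro w hw
    rw [pow_zero, Submodule.mem_one] at hw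
    obtain ⟨y, rfl⟩ := hw
    obtain ⟨z, rfl⟩ := ZMod.intCast_surjective y
    refine ⟨algebraMap ℤ _ z, ?_, ?_⟩
    · rw [pow_zero, Submodule.mem_one]; exact ⟨z, rfl⟩
    · intro x; simp
  | succ k ih =>
    intro w hw
    rw [pow_succ] at hw ⊢
    induction hw using Submodule.mul_induction_on' with
    | mem_mul_mem a ha b hb =>
      obtain ⟨g, hg, hga⟩ := ih a ha
      have : ∃ h ∈ famSpan ℤ F, ∀ x, ((h x : ℤ) : ZMod p) = b x := by
        unfold famSpan at hb
        induction hb using Submodule.span_induction with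
        | mem x h =>
          obtain ⟨A, hA, rfl⟩ := h
          refine ⟨charVec ℤ A, Submodule.subset_span ⟨A, hA, rfl⟩, ?_⟩
          intro x; simp [charVec]
        | zero => exact ⟨0, Submodule.zero_mem _, by simp⟩
        | add x y _ _ hx hy =>
          obtain ⟨g1, h1, h2⟩ := hx
          obtain ⟨g2, h3, h4⟩ := hy
          exact ⟨g1 + g2, Submodule.add_mem _ h1 h3, fun x => by simp [h2, h4]⟩
        | smul a x _ hx =>
          obtain ⟨g1, h1, h2⟩ := hx
          obtain ⟨z, rfl⟩ := ZMod.intCast_surjective a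
          exact ⟨z • g1, Submodule.smul_mem _ _ h1, fun x => by simp [h2]⟩
      obtain ⟨h, hh, hhb⟩ := this
      exact ⟨g * h, Submodule.mul_mem_mul hg hh, fun x => by simp [hga, hhb]⟩
    | add x hx y hy k1 k2 =>
      obtain ⟨g1, h1, h2⟩ := k1
      obtain ⟨g2, h3, h4⟩ := k2
      exact ⟨g1 + g2, Submodule.add_mem _ h1 h3, fun x => by simp [h2, h4]⟩

theorem good_dvd {n k ℓ : ℕ} (F : Finset (Finset (Fin n))) (hdiv : kWiseDiv n k ℓ F)
    (p a r : ℕ) [NeZero p] (hpa : p ^ (a + 1) ∣ ℓ) (hr : 1 ≤ r) (hk : r * p ^ a ≤ k)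
    (C : Finset (Fin n)) (hC : charVec (ZMod p) C ∈ famSpan (ZMod p) F ^ r) :
    p ^ (a + 1) ∣ C.card := by
  obtain ⟨g, hg, hgC⟩ := famSpan_lift p F r _ hC
  have hpos : 0 < p ^ a := Nat.pos_of_ne_zero (pow_ne_zero _ (NeZero.ne p))
  have h1 : g ^ (p ^ a) ∈ famSpan ℤ F ^ k := by
    refine famSpan_pow_mono ℤ F (Nat.mul_pos hr hpos) hk ?_
    rw [pow_mul]
    exact Submodule.pow_mem_pow _ hg _
  have h2 := famSpan_dvd F hdiv _ h1
  have h3 : ((p : ℤ) ^ (a + 1)) ∣ ∑ x, (g ^ (p ^ a)) x :=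
    dvd_trans (by exact_mod_cast hpa) h2
  have h4 : ((p : ℤ) ^ (a + 1)) ∣ ∑ x, ((g ^ (p ^ a)) x - charVec ℤ C x) := by
    refine Finset.dvd_sum fun x _ => ?_
    have h5 : (p : ℤ) ∣ g x - charVec ℤ C x := by
      rw [← ZMod.intCast_zmod_eq_zero_iff_dvd]
      push_cast
      rw [hgC]
      simp [charVec]
    have h6 := dvd_sub_pow_of_dvd_sub h5 a
    have h7 : charVec ℤ C x ^ p ^ a = charVec ℤ C x := by
      unfold charVec
      split_ifs
      · simp
      · exact zero_pow hpos.ne'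
    rw [h7] at h6
    exact h6
  rw [Finset.sum_sub_distrib] at h4
  have h8 := (dvd_sub_right h3).1 h4
  have h9 : ∑ x, charVec ℤ C x = (C.card : ℤ) := by simp [charVec]
  rw [h9] at h8
  exact_mod_cast h8

theorem famSpan_const {R : Type*} [CommRing R] {n : ℕ} (F : Finset (Finset (Fin n)))
    {x y : Fin n} (hxy : ∀ A ∈ F, x ∈ A ↔ y ∈ A) (k : ℕ) :
    ∀ f ∈ famSpan R F ^ k, f x = f y := by
  induction k with
  | zero =>
    intro w hw
    rw [pow_zero, Submodule.mem_one] at hw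
    obtain ⟨y, rfl⟩ := hw
    simp
  | succ k ih =>
    intro w hw
    rw [pow_succ] at hw
    induction hw using Submodule.mul_induction_on' with
    | mem_mul_mem a ha b hb =>
      have : b x = b y := by
        unfold famSpan at hb
        induction hb using Submodule.span_induction with
        | mem _ h => obtain ⟨A, hA, rfl⟩ := h; simp [charVec, hxy A hA]
        | zero => rfl
        | add _ _ _ _ hx hy => simp [hx, hy]
        | smul a _ _ hx => simp [hx]
      simp [ih a ha, this]
    | add _ _ _ _ h1 h2 => simp [h1, h2]

theorem famSpan_zero {R : Type*} [CommRing R] {n : ℕ} (F : Finset (Finset (Fin n)))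
    {x : Fin n} (hx : ∀ A ∈ F, x ∉ A) {k : ℕ} (hk : 1 ≤ k) :
    ∀ f ∈ famSpan R F ^ k, f x = 0 := by
  obtain ⟨k, rfl⟩ : ∃ t, k = t + 1 := ⟨k - 1, by omega⟩
  intro w hw
  rw [pow_succ] at hw
  induction hw using Submodule.mul_induction_on' with
  | mem_mul_mem a ha b hb =>
    have : b x = 0 := by
      unfold famSpan at hb
      induction hb using Submodule.span_induction with
      | mem _ h => obtain ⟨A, hA, rfl⟩ := h; simp [charVec, hx A hA]
      | zero => rfl
      | add _ _ _ _ hx hy => simp [hx, hy]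
      | smul a _ _ hx => simp [hx]
    simp [this]
  | add _ _ _ _ h1 h2 => simp [h1, h2]

/-- the class of `x`: points contained in the same members of `F` -/
def famCls {n : ℕ} (F : Finset (Finset (Fin n))) (x : Fin n) : Finset (Fin n) :=
  Finset.univ.filter (fun y => ∀ A ∈ F, x ∈ A ↔ y ∈ A)

theorem mem_famCls {n : ℕ} {F : Finset (Finset (Fin n))} {x y : Fin n} :
    y ∈ famCls F x ↔ ∀ A ∈ F, x ∈ A ↔ y ∈ A := by simp [famCls]

/-- the bad representatives carry small rank -/
theorem bad_bound {n : ℕ} (F : Finset (Finset (Fin n))) (p : ℕ) [Fact p.Prime] (c : ℕ)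
    (hc : 1 ≤ c) (Z Y : Finset (Fin n)) (hYZ : Y ⊆ Z)
    (hsupp : ∀ z ∈ Z, ∃ A ∈ F, z ∈ A)
    (hinj : ∀ z ∈ Z, ∀ z' ∈ Z, z' ∈ famCls F z → z' = z)
    (hrep : ∀ x, (∃ A ∈ F, x ∈ A) → ∃ z ∈ Z, x ∈ famCls F z)
    (hbad : ∀ y ∈ Y, charVec (ZMod p) (famCls F y) ∉ famSpan (ZMod p) F ^ (3 * c))
    (hgood : ∀ z ∈ Z, z ∉ Y → charVec (ZMod p) (famCls F z) ∈ famSpan (ZMod p) F ^ (3 * c)) :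
    ∃ I : Finset (Fin n), c * I.card ≤ Y.card ∧
      ∀ A ∈ F, ∀ B ∈ F, (∀ x ∈ I, x ∈ A ↔ x ∈ B) → ∀ x ∈ Y, x ∈ A ↔ x ∈ B := by
  have hmem : ∀ A ∈ F, charVec (ZMod p) A ∈ famSpan (ZMod p) F := fun A hA =>
    Submodule.subset_span ⟨A, hA, rfl⟩
  obtain ⟨I, hIY, hIv, hIc⟩ := exists_basis_set (famSpan (ZMod p) F) Y
  refine ⟨I, ?_, ?_⟩
  · by_contra hcon
    have hlt : Y.card + c * vdim (famSpan (ZMod p) F) Y < c * vdim (famSpan (ZMod p) F) ∅ := by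
      have := Nat.mul_le_mul_left c hIc
      rw [mul_add] at this
      omega
    obtain ⟨y, hy, f, hf, hfy, hf0⟩ := key_lemma (famSpan (ZMod p) F) Y c hlt
      (fun y hy => by
        obtain ⟨A, hA, hyA⟩ := hsupp y (hYZ hy)
        exact ⟨_, hmem A hA, by simp [charVec, hyA]⟩)
      (fun y hy x hx hxy => by
        by_cases h : ∃ A ∈ F, y ∈ A ∧ x ∉ A
        · obtain ⟨A, hA, h1, h2⟩ := h
          exact ⟨_, hmem A hA, by simp [charVec, h2], by simp [charVec, h1]⟩
        · push Not at h
          obtain ⟨A, hA, hyA⟩ := hsupp y (hYZ hy)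
          have hB : ∃ B ∈ F, x ∈ B ∧ y ∉ B := by
            by_contra hno
            push Not at hno
            exact hxy (hinj y (hYZ hy) x (hYZ hx)
              (mem_famCls.2 fun B hB => ⟨h B hB, hno B hB⟩))
          obtain ⟨B, hB, hxB, hyB⟩ := hB
          exact ⟨_, Submodule.sub_mem _ (hmem A hA) (hmem B hB),
            by simp [charVec, h A hA hyA, hxB], by simp [charVec, hyA, hyB]⟩)
    apply hbad y hy
    have heq : charVec (ZMod p) (famCls F y) =
        (f y)⁻¹ • (f - ∑ z ∈ Z \ Y, f z • charVec (ZMod p) (famCls F z)) := by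
      funext x
      simp only [Pi.smul_apply, Pi.sub_apply, Finset.sum_apply, smul_eq_mul]
      by_cases hx : ∃ A ∈ F, x ∈ A
      · obtain ⟨z, hz, hzx⟩ := hrep x hx
        have hfx : f z = f x := famSpan_const F (mem_famCls.1 hzx) _ f hf
        have huniq : ∀ z' ∈ Z, x ∈ famCls F z' → z' = z := by
          intro z' hz' h
          refine hinj z hz z' hz' (mem_famCls.2 fun A hA => ?_)
          rw [mem_famCls.1 hzx A hA, mem_famCls.1 h A hA]
        by_cases hzY : z ∈ Y
        · have hs : ∑ z ∈ Z \ Y, f z * charVec (ZMod p) (famCls F z) x = 0 := by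
            refine Finset.sum_eq_zero fun z' hz' => ?_
            rw [Finset.mem_sdiff] at hz'
            have : x ∉ famCls F z' := fun h => hz'.2 (huniq z' hz'.1 h ▸ hzY)
            simp [charVec, this]
          rw [hs, sub_zero, ← hfx]
          by_cases hzy : z = y
          · subst hzy
            simp [charVec, hzx, hfy]
          · have : x ∉ famCls F y := fun h => hzy (huniq y (hYZ hy) h).symm
            simp [charVec, this, hf0 z hzY hzy]
        · have hs : ∑ z ∈ Z \ Y, f z * charVec (ZMod p) (famCls F z) x = f z := by
            rw [Finset.sum_eq_single z]
            · simp [charVec, hzx]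
            · intro z' hz' hne
              rw [Finset.mem_sdiff] at hz'
              have : x ∉ famCls F z' := fun h => hne (huniq z' hz'.1 h)
              simp [charVec, this]
            · intro h; exact absurd (Finset.mem_sdiff.2 ⟨hz, hzY⟩) h
          have : x ∉ famCls F y := fun h => hzY (huniq y (hYZ hy) h ▸ hy)
          rw [hs, hfx]
          simp [charVec, this]
      · push Not at hx
        have hn : ∀ z ∈ Z, x ∉ famCls F z := by
          intro z hz h
          obtain ⟨A, hA, hzA⟩ := hsupp z hz
          exact hx A hA ((mem_famCls.1 h A hA).1 hzA)
        rw [Finset.sum_eq_zero, famSpan_zero F hx (by omega) f hf]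
        · simp [charVec, hn y (hYZ hy)]
        · intro z hz
          simp [charVec, hn z (Finset.mem_sdiff.1 hz).1]
    rw [heq]
    refine Submodule.smul_mem _ _ (Submodule.sub_mem _ hf (Submodule.sum_mem _ fun z hz => ?_))
    rw [Finset.mem_sdiff] at hz
    exact Submodule.smul_mem _ _ (hgood z hz.1 hz.2)
  · intro A hA B hB hAB x hx
    have h1 : charVec (ZMod p) A - charVec (ZMod p) B ∈ vanOn (famSpan (ZMod p) F) I := by
      refine ⟨Submodule.sub_mem _ (hmem A hA) (hmem B hB), fun a ha => ?_⟩
      simp [charVec, hAB a ha]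
    rw [hIv] at h1
    have h2 := h1.2 x hx
    by_cases hxA : x ∈ A <;> by_cases hxB : x ∈ B <;> simp_all [charVec]

theorem omega_bound {ℓ p a : ℕ} (hℓ : 0 < ℓ) (hp : p.Prime) (h : p ^ (a + 1) ∣ ℓ) :
    ℓ.primeFactors.card * p ^ a ≤ ℓ := by
  obtain ⟨t, rfl⟩ := h
  have ht : 0 < p * t := by
    rcases Nat.eq_zero_or_pos t with rfl | h
    · simp at hℓ
    · exact Nat.mul_pos hp.pos h
  have h1 : (p ^ (a + 1) * t).primeFactors ⊆ Finset.Icc 1 (p * t) := by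
    intro q hq
    have hqp := Nat.prime_of_mem_primeFactors hq
    have hqd := Nat.dvd_of_mem_primeFactors hq
    have : q ∣ p * t := by
      rcases (hqp.dvd_mul).1 hqd with h | h
      · exact Dvd.dvd.mul_right (hqp.dvd_of_dvd_pow h) t
      · exact Dvd.dvd.mul_left h p
    exact Finset.mem_Icc.2 ⟨hqp.one_le, Nat.le_of_dvd ht this⟩
  have h2 := Finset.card_le_card h1
  rw [Nat.card_Icc] at h2
  calc _ ≤ (p * t) * p ^ a := Nat.mul_le_mul_right _ (by omega)
    _ = _ := by ring

/-- 4ℓ²-wise ℓ-divisible families have size at most `2 ^ ⌊n/ℓ⌋`. -/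
theorem statement2 (n ℓ : ℕ) (hℓ : 0 < ℓ) (𝓕 : Finset (Finset (Fin n)))
    (hdiv : kWiseDiv n (4 * ℓ ^ 2) ℓ 𝓕) : 𝓕.card ≤ 2 ^ (n / ℓ) := by
  classical
  set m := ℓ.primeFactors.card with hm
  by_cases hm0 : m = 0
  · have hℓ1 : ℓ = 1 := by
      rw [hm, Finset.card_eq_zero, Nat.primeFactors_eq_empty] at hm0
      omega
    subst hℓ1
    simpa using Finset.card_le_univ 𝓕
  -- representatives
  obtain ⟨Z, hsupp, hinj, hrep⟩ : ∃ Z : Finset (Fin n), (∀ z ∈ Z, ∃ A ∈ 𝓕, z ∈ A) ∧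
      (∀ z ∈ Z, ∀ z' ∈ Z, z' ∈ famCls 𝓕 z → z' = z) ∧
      (∀ x, (∃ A ∈ 𝓕, x ∈ A) → ∃ z ∈ Z, x ∈ famCls 𝓕 z) := by
    refine ⟨Finset.univ.filter (fun z => (∃ A ∈ 𝓕, z ∈ A) ∧ ∀ z' ∈ famCls 𝓕 z, z ≤ z'),
      ?_, ?_, ?_⟩
    · intro z hz; exact (Finset.mem_filter.1 hz).2.1
    · intro z hz z' hz' h
      refine le_antisymm ((Finset.mem_filter.1 hz').2.2 z ?_) ((Finset.mem_filter.1 hz).2.2 z' h)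
      exact mem_famCls.2 fun A hA => (mem_famCls.1 h A hA).symm
    · rintro x ⟨A, hA, hxA⟩
      have hne : (famCls 𝓕 x).Nonempty := ⟨x, mem_famCls.2 fun _ _ => Iff.rfl⟩
      have hmin := mem_famCls.1 (Finset.min'_mem _ hne)
      refine ⟨(famCls 𝓕 x).min' hne, Finset.mem_filter.2 ⟨Finset.mem_univ _, ⟨A, hA, ?_⟩, ?_⟩, ?_⟩
      · exact (hmin A hA).1 hxA
      · intro z' hz'
        refine Finset.min'_le _ _ (mem_famCls.2 fun B hB => ?_)
        rw [hmin B hB, mem_famCls.1 hz' B hB]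
      · exact mem_famCls.2 fun B hB => (hmin B hB).symm
  set c := m * ℓ with hc
  have hc1 : 1 ≤ c := Nat.mul_pos (Nat.pos_of_ne_zero hm0) hℓ
  let Y : ℕ → Finset (Fin n) := fun p =>
    Z.filter (fun z => charVec (ZMod p) (famCls 𝓕 z) ∉ famSpan (ZMod p) 𝓕 ^ (3 * c))
  have hex : ∀ p, ∃ I : Finset (Fin n), p ∈ ℓ.primeFactors → (c * I.card ≤ (Y p).card ∧
      ∀ A ∈ 𝓕, ∀ B ∈ 𝓕, (∀ x ∈ I, x ∈ A ↔ x ∈ B) → ∀ x ∈ Y p, x ∈ A ↔ x ∈ B) := by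
    intro p
    by_cases hp : p ∈ ℓ.primeFactors
    · have : Fact p.Prime := ⟨Nat.prime_of_mem_primeFactors hp⟩
      obtain ⟨I, hI⟩ := bad_bound 𝓕 p c hc1 Z (Y p) (Finset.filter_subset _ _) hsupp hinj hrep
        (fun y hy => (Finset.mem_filter.1 hy).2)
        (fun z hz hzY => by
          by_contra h
          exact hzY (Finset.mem_filter.2 ⟨hz, h⟩))
      exact ⟨I, fun _ => hI⟩
    · exact ⟨∅, fun h => absurd h hp⟩
  choose I hI using hex
  set T := ℓ.primeFactors.biUnion Y with hT
  have hTZ : T ⊆ Z := Finset.biUnion_subset.2 fun p _ => Finset.filter_subset _ _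
  set G := Z \ T with hG
  have hGcard : ∀ z ∈ G, ℓ ≤ (famCls 𝓕 z).card := by
    intro z hz
    rw [hG, Finset.mem_sdiff] at hz
    have hpos : 0 < (famCls 𝓕 z).card := Finset.card_pos.2 ⟨z, mem_famCls.2 fun _ _ => Iff.rfl⟩
    refine Nat.le_of_dvd hpos ?_
    rw [Nat.dvd_iff_prime_pow_dvd_dvd]
    intro p k hp hpk
    cases k with
    | zero => simp
    | succ a =>
      have : Fact p.Prime := ⟨hp⟩
      have hpm : p ∈ ℓ.primeFactors := Nat.mem_primeFactors.2
        ⟨hp, dvd_trans (dvd_pow_self p (Nat.succ_ne_zero a)) hpk, hℓ.ne'⟩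
      refine good_dvd 𝓕 hdiv p a (3 * c) hpk (by omega) ?_ _ ?_
      · have := omega_bound hℓ hp hpk
        rw [← hm] at this
        calc 3 * c * p ^ a = 3 * ℓ * (m * p ^ a) := by rw [hc]; ring
          _ ≤ 3 * ℓ * ℓ := Nat.mul_le_mul_left _ this
          _ ≤ 4 * ℓ ^ 2 := by nlinarith
      · by_contra h
        exact hz.2 (Finset.mem_biUnion.2 ⟨p, hpm, Finset.mem_filter.2 ⟨hz.1, h⟩⟩)
  set D := G ∪ ℓ.primeFactors.biUnion I with hD
  have hdet : ∀ A ∈ 𝓕, ∀ B ∈ 𝓕, (∀ x ∈ D, x ∈ A ↔ x ∈ B) → A = B := by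
    intro A hA B hB h
    have hZ : ∀ z ∈ Z, z ∈ A ↔ z ∈ B := by
      intro z hz
      by_cases hzT : z ∈ T
      · obtain ⟨p, hp, hzp⟩ := Finset.mem_biUnion.1 hzT
        exact (hI p hp).2 A hA B hB (fun x hx => h x (Finset.mem_union_right _
          (Finset.mem_biUnion.2 ⟨p, hp, hx⟩))) z hzp
      · exact h z (Finset.mem_union_left _ (Finset.mem_sdiff.2 ⟨hz, hzT⟩))
    ext x
    by_cases hx : ∃ A ∈ 𝓕, x ∈ A
    · obtain ⟨z, hz, hzx⟩ := hrep x hx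
      rw [← mem_famCls.1 hzx A hA, ← mem_famCls.1 hzx B hB, hZ z hz]
    · push Not at hx
      simp [hx A hA, hx B hB]
  have hcard : 𝓕.card ≤ 2 ^ D.card := by
    rw [← Finset.card_powerset]
    refine Finset.card_le_card_of_injOn (fun A => A ∩ D)
      (fun A _ => Finset.mem_powerset.2 Finset.inter_subset_right) ?_
    intro A hA B hB hAB
    refine hdet A hA B hB fun x hx => ?_
    have := Finset.ext_iff.1 hAB x
    simpa [hx] using this
  refine hcard.trans (Nat.pow_le_pow_right (by norm_num) ?_)
  rw [Nat.le_div_iff_mul_le hℓ]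
  -- counting
  have h1 : D.card ≤ G.card + ∑ p ∈ ℓ.primeFactors, (I p).card :=
    (Finset.card_union_le _ _).trans (Nat.add_le_add_left Finset.card_biUnion_le _)
  have h2 : c * ∑ p ∈ ℓ.primeFactors, (I p).card ≤ m * T.card := by
    rw [Finset.mul_sum, hm, ← smul_eq_mul, ← Finset.sum_const]
    exact Finset.sum_le_sum fun p hp => (hI p hp).1.trans
      (Finset.card_le_card (Finset.subset_biUnion_of_mem Y hp))
  have h3 : ℓ * ∑ p ∈ ℓ.primeFactors, (I p).card ≤ T.card := by
    rw [hc, mul_assoc] at h2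
    exact Nat.le_of_mul_le_mul_left h2 (Nat.pos_of_ne_zero hm0)
  have h4 : (G.biUnion (famCls 𝓕)).card = ∑ z ∈ G, (famCls 𝓕 z).card := by
    refine Finset.card_biUnion fun z hz z' hz' hne => ?_
    refine Finset.disjoint_left.2 fun x hx hx' => ?_
    refine hne (hinj z' (Finset.mem_sdiff.1 hz').1 z (Finset.mem_sdiff.1 hz).1
      (mem_famCls.2 fun A hA => ?_))
    rw [mem_famCls.1 hx' A hA, mem_famCls.1 hx A hA]
  have h5 : G.card * ℓ ≤ ∑ z ∈ G, (famCls 𝓕 z).card := by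
    rw [← smul_eq_mul]
    exact Finset.card_nsmul_le_sum _ _ _ hGcard
  have h6 : (G.biUnion (famCls 𝓕)).card + T.card ≤ n := by
    rw [← Finset.card_union_of_disjoint]
    · simpa using Finset.card_le_univ (G.biUnion (famCls 𝓕) ∪ T)
    · rw [Finset.disjoint_left]
      intro x hx hxT
      obtain ⟨z, hz, hzx⟩ := Finset.mem_biUnion.1 hx
      rw [hG, Finset.mem_sdiff] at hz
      have := hinj z hz.1 x (hTZ hxT) hzx
      exact hz.2 (this ▸ hxT)
  have h7 := Nat.mul_le_mul_right ℓ h1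
  rw [add_mul, mul_comm (∑ p ∈ ℓ.primeFactors, (I p).card) ℓ] at h7
  omega
end

section
/- Let ℓ be a positive integer and let F ⊆ 2^[n] be a 4ℓ²-wise ℓ-divisible set family with |F| > 2^(⌊n/ℓ⌋ - 1). Then F is contained in an atomic family with atoms of size ℓ. -/
open Submodule

section KneserPart

/-- covering lemma -/
theorem kn_cov {K ι κ : Type*} [Field K] [Infinite K] [Finite ι] [Finite κ]
    (V : Submodule K (ι → K)) (hV : ∀ i, ∃ v ∈ V, v i ≠ 0) (W : κ → Submodule K (ι → K))
    (hW : ∀ v ∈ V, (∀ i, v i ≠ 0) → ∃ h, v ∈ W h) : ∃ h, V ≤ W h := by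
  classical
  let p : ι ⊕ κ → Submodule K V := fun x => match x with
    | Sum.inl i => LinearMap.ker ((LinearMap.proj i).comp V.subtype)
    | Sum.inr h => (W h).comap V.subtype
  obtain ⟨x, hx⟩ := Subspace.exists_eq_top_of_iUnion_eq_univ (p := p) (by
    rw [Set.eq_univ_iff_forall]
    intro v
    rw [Set.mem_iUnion]
    by_cases h : ∀ i, (v : ι → K) i ≠ 0
    · obtain ⟨k, hk⟩ := hW v v.2 h
      exact ⟨Sum.inr k, hk⟩
    · push Not at h
      obtain ⟨i, hi⟩ := h
      refine ⟨Sum.inl i, ?_⟩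
      simpa [p] using hi)
  rcases x with i | k
  · exfalso
    obtain ⟨v, hv, hvi⟩ := hV i
    have : (⟨v, hv⟩ : V) ∈ p (Sum.inl i) := by rw [hx]; trivial
    apply hvi
    simpa [p] using this
  · refine ⟨k, fun v hv => ?_⟩
    have : (⟨v, hv⟩ : V) ∈ p (Sum.inr k) := by rw [hx]; trivial
    simpa [p] using this

theorem kn_finrank_mul {K ι : Type*} [Field K] [Finite ι] (e : ι → K) (he : ∀ i, e i ≠ 0)
    (C : Submodule K (ι → K)) :
    Module.finrank K (C.map (LinearMap.mulLeft K e)) = Module.finrank K C := by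
  have hinj : Function.Injective (LinearMap.mulLeft K e) := by
    intro x y hxy
    funext i
    have := congrFun hxy i
    simpa [he i] using this
  exact (LinearEquiv.finrank_eq (Submodule.equivMapOfInjective _ hinj C)).symm

/-- the e-transform lemma -/
theorem kn_etransform {K ι : Type*} [Field K] [Infinite K] [Finite ι] (m : ℕ) :
    ∀ (C D : Submodule K (ι → K)), Module.finrank K C ≤ m → (1 : ι → K) ∈ C →
      (∀ i, ∃ v ∈ D, v i ≠ 0) →
      ∃ (V : Submodule K (ι → K)) (H : Subalgebra K (ι → K)), D ≤ V ∧ V ≤ C * D ∧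
        (∀ h ∈ H, ∀ v ∈ V, h * v ∈ V) ∧
        Module.finrank K C + Module.finrank K D ≤ Module.finrank K V + Module.finrank K H := by
  induction m with
  | zero =>
    intro C D hC h1 hD
    have hC0 : C = ⊥ := by
      rw [← Submodule.finrank_eq_zero]; omega
    have hle : D ≤ C * D := fun d hd => by
      have := Submodule.mul_mem_mul h1 hd
      simpa using this
    refine ⟨D, ⊥, le_rfl, hle, ?_, ?_⟩
    · intro h hh v hv
      obtain ⟨k, rfl⟩ := Algebra.mem_bot.1 hh
      rw [← Algebra.smul_def]
      exact D.smul_mem _ hv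
    · omega
  | succ m ih =>
    intro C D hC h1 hD
    have hle : D ≤ C * D := fun d hd => by
      have := Submodule.mul_mem_mul h1 hd
      simpa using this
    by_cases hall : ∀ e ∈ D, (∀ i, e i ≠ 0) → ∀ c ∈ C, c * e ∈ D
    · have hCD : ∀ c ∈ C, ∀ d ∈ D, c * d ∈ D := by
        intro c hc d hd
        obtain ⟨-, h⟩ := kn_cov (κ := Unit) D hD (fun _ => D.comap (LinearMap.mulLeft K c))
          (fun v hv hvi => ⟨(), by simpa using hall v hv hvi c hc⟩)
        simpa using h hd
      refine ⟨D, Algebra.adjoin K (C : Set (ι → K)), le_rfl, hle, ?_, ?_⟩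
      · intro h hh
        induction hh using Algebra.adjoin_induction with
        | mem x hx => exact hCD x hx
        | algebraMap r =>
          intro v hv
          rw [← Algebra.smul_def]
          exact D.smul_mem _ hv
        | add x y _ _ hx hy =>
          intro v hv
          rw [add_mul]
          exact D.add_mem (hx v hv) (hy v hv)
        | mul x y _ _ hx hy =>
          intro v hv
          rw [mul_assoc]
          exact hx _ (hy v hv)
      · have : Module.finrank K C ≤
            Module.finrank K (Subalgebra.toSubmodule (Algebra.adjoin K (C : Set (ι → K)))) :=
          Submodule.finrank_mono (fun c hc => Algebra.subset_adjoin hc)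
        have h2 : Module.finrank K (Subalgebra.toSubmodule (Algebra.adjoin K (C : Set (ι → K))))
          = Module.finrank K (Algebra.adjoin K (C : Set (ι → K))) := rfl
        omega
    · push Not at hall
      obtain ⟨e, heD, hei, c, hc, hce⟩ := hall
      let μ := LinearMap.mulLeft K e
      let C' := C ⊓ D.comap μ
      let D' := D ⊔ C.map μ
      have hlt : C' < C := by
        refine lt_of_le_of_ne inf_le_left (fun h => hce ?_)
        have : c ∈ C' := h ▸ hc
        have := this.2
        rw [mul_comm]
        simpa [μ] using this
      have hf := Submodule.finrank_lt_finrank_of_lt hlt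
      have hmap : C'.map μ = D ⊓ C.map μ := by
        ext x
        constructor
        · rintro ⟨y, hy, rfl⟩
          exact ⟨hy.2, ⟨y, hy.1, rfl⟩⟩
        · rintro ⟨hx, ⟨y, hy, rfl⟩⟩
          exact ⟨y, ⟨hy, hx⟩, rfl⟩
      have hd := Submodule.finrank_sup_add_finrank_inf_eq D (C.map μ)
      rw [← hmap, kn_finrank_mul e hei, kn_finrank_mul e hei] at hd
      obtain ⟨V, H, h1V, h2V, h3V, h4V⟩ := ih C' D' (by omega)
        ⟨h1, by simpa [μ] using heD⟩ (fun i => by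
          obtain ⟨v, hv, hvi⟩ := hD i
          exact ⟨v, Submodule.mem_sup_left hv, hvi⟩)
      refine ⟨V, H, le_sup_left.trans h1V, h2V.trans ?_, h3V, ?_⟩
      · rw [Submodule.mul_le]
        intro x hx y hy
        obtain ⟨d, hd, z, ⟨w, hw, rfl⟩, rfl⟩ := Submodule.mem_sup.1 hy
        rw [mul_add]
        refine Submodule.add_mem _ (Submodule.mul_mem_mul hx.1 hd) ?_
        have hx2 : e * x ∈ D := by simpa [μ] using hx.2
        have : x * (μ w) = w * (e * x) := by
          simp only [μ, LinearMap.mulLeft_apply]; ring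
        rw [this]
        exact Submodule.mul_mem_mul hw hx2
      · have : Module.finrank K D' + Module.finrank K C' =
          Module.finrank K D + Module.finrank K C := hd
        omega

theorem kn_etransform' {K ι : Type*} [Field K] [Infinite K] [Finite ι]
    (C D : Submodule K (ι → K)) (hD : ∀ i, ∃ v ∈ D, v i ≠ 0) (a : ι → K) (haC : a ∈ C)
    (ha : ∀ i, a i ≠ 0) :
      ∃ (V : Submodule K (ι → K)) (H : Subalgebra K (ι → K)), (∀ d ∈ D, a * d ∈ V) ∧ V ≤ C * D ∧
        (∀ h ∈ H, ∀ v ∈ V, h * v ∈ V) ∧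
        Module.finrank K C + Module.finrank K D ≤ Module.finrank K V + Module.finrank K H := by
  have hb : ∀ i, (a⁻¹) i ≠ 0 := fun i => by simpa using ha i
  have hab : a * a⁻¹ = 1 := by funext i; simp [ha i]
  obtain ⟨V, H, h1, h2, h3, h4⟩ := kn_etransform _ (C.map (LinearMap.mulLeft K a⁻¹)) D le_rfl
    ⟨a, haC, by simpa [mul_comm] using hab⟩ hD
  refine ⟨V.map (LinearMap.mulLeft K a), H, ?_, ?_, ?_, ?_⟩
  · intro d hd
    exact ⟨d, h1 hd, rfl⟩
  · have hle : C.map (LinearMap.mulLeft K a⁻¹) * D ≤ (C * D).comap (LinearMap.mulLeft K a) := by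
      rw [Submodule.mul_le]
      rintro _ ⟨c, hc, rfl⟩ y hy
      have : LinearMap.mulLeft K a ((LinearMap.mulLeft K a⁻¹ c) * y) = c * y := by
        simp only [LinearMap.mulLeft_apply]
        rw [← mul_assoc, ← mul_assoc, hab, one_mul]
      rw [Submodule.mem_comap, this]
      exact Submodule.mul_mem_mul hc hy
    rintro _ ⟨v, hv, rfl⟩
    exact hle (h2 hv)
  · rintro h hh _ ⟨v, hv, rfl⟩
    exact ⟨h * v, h3 h hh v hv, by simp only [LinearMap.mulLeft_apply]; ring⟩
  · rw [kn_finrank_mul _ ha]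
    rw [kn_finrank_mul _ hb] at h4
    exact h4

open Classical in
theorem kn_indicator_mem {K ι : Type*} [Field K] [Fintype ι] (H : Subalgebra K (ι → K)) (i : ι) :
    (fun j => if (∀ h ∈ H, h i = h j) then (1 : K) else 0) ∈ H := by
  have hex : ∀ j, ∃ g ∈ H, g i = 1 ∧ (¬ (∀ h ∈ H, h i = h j) → g j = 0) := by
    intro j
    by_cases hj : ∀ h ∈ H, h i = h j
    · exact ⟨1, H.one_mem, rfl, fun h => absurd hj h⟩
    · have hj' := hj
      push Not at hj'
      obtain ⟨h, hh, hne⟩ := hj'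
      refine ⟨(h i - h j)⁻¹ • (h - algebraMap K (ι → K) (h j)), ?_, ?_, ?_⟩
      · exact H.smul_mem (H.sub_mem hh (H.algebraMap_mem _)) _
      · have : h i - h j ≠ 0 := sub_ne_zero.2 hne
        simp [this]
      · intro _
        simp
  choose g hg hgi hgj using hex
  have : (fun j => if (∀ h ∈ H, h i = h j) then (1 : K) else 0) = ∏ j, g j := by
    funext k
    rw [Finset.prod_apply]
    split_ifs with hk
    · symm
      apply Finset.prod_eq_one
      intro j _
      rw [← hk _ (hg j), hgi]
    · symm
      exact Finset.prod_eq_zero (Finset.mem_univ k) (hgj k hk)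
  rw [this]
  exact H.prod_mem (fun j _ => hg j)

theorem kn_kneser {K ι : Type*} [Field K] [Infinite K] [Fintype ι] [Nonempty ι]
    (C D : Submodule K (ι → K)) (hC : ∀ i, ∃ v ∈ C, v i ≠ 0) (hD : ∀ i, ∃ v ∈ D, v i ≠ 0)
    (htriv : ∀ x : ι → K, (∀ e ∈ C * D, x * e ∈ C * D) → ∀ i j, x i = x j) :
    Module.finrank K C + Module.finrank K D ≤ Module.finrank K ↥(C * D) + 1 := by
  classical
  let U := {a : ι → K // a ∈ C ∧ ∀ i, a i ≠ 0}
  have hex : ∀ a : U, _ := fun a => kn_etransform' C D hD a.1 a.2.1 a.2.2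
  choose V H h1 h2 h3 h4 using hex
  let R : U → Set (ι × ι) := fun a => {x | ∀ h ∈ H a, h x.1 = h x.2}
  obtain ⟨S, hS⟩ := kn_cov C hC
    (fun S : Set (ι × ι) => Submodule.span K {x | ∃ a : U, R a = S ∧ x = a.1})
    (fun v hv hvi => ⟨R ⟨v, hv, hvi⟩, Submodule.subset_span ⟨⟨v, hv, hvi⟩, rfl, rfl⟩⟩)
  have hne : ∃ a : U, R a = S := by
    by_contra hno
    push Not at hno
    have he : {x | ∃ a : U, R a = S ∧ x = a.1} = (∅ : Set (ι → K)) := by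
      ext x; simp only [Set.mem_ofPred_eq, Set.mem_empty_iff_false, iff_false]
      rintro ⟨a, ha, -⟩
      exact hno a ha
    rw [he, Submodule.span_empty] at hS
    obtain ⟨v, hv, hvi⟩ := hC (Classical.arbitrary ι)
    have := hS hv
    rw [Submodule.mem_bot] at this
    exact hvi (by rw [this]; rfl)
  have hind : ∀ i, ∀ e ∈ C * D,
      (fun j => if (i, j) ∈ S then (1 : K) else 0) * e ∈ C * D := by
    intro i e he
    induction he using Submodule.mul_induction_on' with
    | mem_mul_mem c hc d hd =>
      have := hS hc
      clear hc
      induction this using Submodule.span_induction with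
      | mem x hx =>
        obtain ⟨a, ha, rfl⟩ := hx
        have hm := kn_indicator_mem (H a) i
        have heq : (fun j => if (∀ h ∈ H a, h i = h j) then (1 : K) else 0) =
            (fun j => if (i, j) ∈ S then (1 : K) else 0) := by
          rw [← ha]
          rfl
        rw [heq] at hm
        exact h2 a (h3 a _ hm _ (h1 a d hd))
      | zero => simp
      | add x y _ _ hx hy =>
        rw [add_mul, mul_add]
        exact Submodule.add_mem _ hx hy
      | smul k x _ hx =>
        rw [smul_mul_assoc, mul_smul_comm]
        exact Submodule.smul_mem _ _ hx
    | add x _ y _ hx hy => rw [mul_add]; exact Submodule.add_mem _ hx hy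
  have hall : ∀ i j, (i, j) ∈ S := by
    intro i j
    have := htriv _ (hind i) i j
    obtain ⟨a, ha⟩ := hne
    have hii : (i, i) ∈ S := by rw [← ha]; intro h _; rfl
    by_contra hij
    simp [hii, hij] at this
  obtain ⟨a, ha⟩ := hne
  have hH : Module.finrank K (H a) ≤ 1 := by
    have hle : Subalgebra.toSubmodule (H a) ≤ Submodule.span K {1} := by
      intro h hh
      rw [Submodule.mem_span_singleton]
      refine ⟨h (Classical.arbitrary ι), ?_⟩
      funext j
      have : (Classical.arbitrary ι, j) ∈ R a := by rw [ha]; exact hall _ _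
      simpa using this h hh
    calc Module.finrank K (H a) = Module.finrank K (Subalgebra.toSubmodule (H a)) := rfl
      _ ≤ _ := Submodule.finrank_mono hle
      _ ≤ 1 := (finrank_span_le_card ({1} : Set (ι → K))).trans (by simp)
  have := Submodule.finrank_mono (h2 a)
  have := h4 a
  omega

theorem kn_pow {K ι : Type*} [Field K] [Infinite K] [Fintype ι] [Nonempty ι]
    (C : Submodule K (ι → K)) (hC : ∀ i, ∃ v ∈ C, v i ≠ 0) (r : ℕ) (hr : 1 ≤ r)
    (htriv : ∀ x : ι → K, (∀ e ∈ C ^ r, x * e ∈ C ^ r) → ∀ i j, x i = x j) :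
    r * Module.finrank K C + 1 ≤ Fintype.card ι + r := by
  have key : ∀ s, 1 ≤ s → s ≤ r →
      s * Module.finrank K C + 1 ≤ Module.finrank K ↥(C ^ s) + s := by
    intro s hs
    induction s, hs using Nat.le_induction with
    | base => intro _; rw [pow_one, one_mul]
    | succ s hs ih =>
      intro hsr
      have h := ih (by omega)
      have hk := kn_kneser (C ^ s) C (fun i => by
          obtain ⟨v, hv, hvi⟩ := hC i
          exact ⟨v ^ s, Submodule.pow_mem_pow _ hv s, by simpa using pow_ne_zero s hvi⟩) hC (by
        rw [← pow_succ]
        intro x hx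
        apply htriv
        intro e he
        obtain ⟨t, rfl⟩ := Nat.exists_eq_add_of_le hsr
        rw [pow_add] at he ⊢
        induction he using Submodule.mul_induction_on' with
        | mem_mul_mem c hc d hd =>
          rw [← mul_assoc]
          exact Submodule.mul_mem_mul (hx c hc) hd
        | add x _ y _ hx hy => rw [mul_add]; exact Submodule.add_mem _ hx hy)
      rw [← pow_succ] at hk
      rw [add_mul]
      omega
  have h := key r hr le_rfl
  have := Submodule.finrank_le (C ^ r)
  rw [Module.finrank_fintype_fun_eq_card] at this
  omega

end KneserPart

section BlockPart

/-- restriction of functions to a finset of coordinates -/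
def restrAlg (K : Type*) [Field K] {n : ℕ} (P : Finset (Fin n)) : (Fin n → K) →ₐ[K] (P → K) :=
  AlgHom.pi (fun j => Pi.evalAlgHom K _ j.1)

theorem restrAlg_apply (K : Type*) [Field K] {n : ℕ} (P : Finset (Fin n)) (v : Fin n → K) (j : P) :
    restrAlg K P v j = v j.1 := rfl

/-- the number of traces of a family -/
def traceCard {n : ℕ} (F : Finset (Finset (Fin n))) (S : Finset (Fin n)) : ℕ :=
  (F.image (fun A => A ∩ S)).card

theorem traceCard_union {n : ℕ} (F : Finset (Finset (Fin n))) (S S' : Finset (Fin n)) :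
    traceCard F (S ∪ S') ≤ traceCard F S * traceCard F S' := by
  classical
  unfold traceCard
  rw [← Finset.card_product]
  apply Finset.card_le_card_of_injOn (fun X => (X ∩ S, X ∩ S'))
  · intro X hX
    simp only [Finset.coe_image, Set.mem_image, Finset.mem_coe] at hX
    obtain ⟨A, hA, rfl⟩ := hX
    simp only [Finset.coe_product, Set.mem_prod, Finset.mem_coe, Finset.mem_image]
    refine ⟨⟨A, hA, ?_⟩, ⟨A, hA, ?_⟩⟩ <;> ext x <;> simp
  · intro X hX Y hY hXY
    simp only [Finset.coe_image, Set.mem_image, Finset.mem_coe] at hX hY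
    obtain ⟨A, hA, rfl⟩ := hX
    obtain ⟨A', hA', rfl⟩ := hY
    simp only [Prod.mk.injEq, Finset.ext_iff, Finset.mem_inter, Finset.mem_union] at hXY
    ext x
    have h1 := hXY.1 x
    have h2 := hXY.2 x
    simp only [Finset.mem_inter, Finset.mem_union]
    tauto

theorem traceCard_empty {n : ℕ} (F : Finset (Finset (Fin n))) : traceCard F ∅ ≤ 1 := by
  unfold traceCard
  rw [Finset.card_le_one]
  intro a ha b hb
  simp only [Finset.mem_image] at ha hb
  obtain ⟨A, hA, rfl⟩ := ha
  obtain ⟨A', hA', rfl⟩ := hb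
  simp

theorem traceCard_biUnion {n : ℕ} {κ : Type*} (F : Finset (Finset (Fin n))) (I : Finset κ)
    (S : κ → Finset (Fin n)) (w : κ → ℕ) (h : ∀ i ∈ I, traceCard F (S i) ≤ 2 ^ w i) :
    traceCard F (I.biUnion S) ≤ 2 ^ (∑ i ∈ I, w i) := by
  classical
  induction I using Finset.induction_on with
  | empty => simpa using traceCard_empty F
  | insert a I ha ih =>
    rw [Finset.biUnion_insert, Finset.sum_insert ha, pow_add]
    refine (traceCard_union _ _ _).trans (Nat.mul_le_mul (h a (by simp)) (ih ?_))
    intro i hi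
    exact h i (by simp [hi])

theorem zero_one_card {K ι : Type*} [Field K] [Fintype ι] [DecidableEq ι]
    (V : Submodule K (ι → K)) (𝒮 : Finset (Finset ι))
    (h : ∀ A ∈ 𝒮, (fun i => if i ∈ A then (1 : K) else 0) ∈ V) :
    𝒮.card ≤ 2 ^ Module.finrank K V := by
  classical
  let f : ι → Module.Dual K V := fun i => (LinearMap.proj i).comp V.subtype
  obtain ⟨κ, a, ha, hsp, hli⟩ := exists_linearIndependent' K f
  have : Finite κ := Finite.of_injective a ha
  have := Fintype.ofFinite κ
  have hcard := hli.fintype_card_le_finrank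
  rw [Subspace.dual_finrank_eq] at hcard
  calc 𝒮.card ≤ (Finset.univ : Finset (κ → Bool)).card := by
        apply Finset.card_le_card_of_injOn (fun A k => decide (a k ∈ A))
        · intro A _; simp
        · intro A hA B hB hAB
          have hz : ∀ g ∈ Submodule.span K (Set.range f),
              g (⟨_, h A hA⟩ - ⟨_, h B hB⟩) = 0 := by
            rw [← hsp]
            intro g hg
            induction hg using Submodule.span_induction with
            | mem x hx =>
              obtain ⟨k, rfl⟩ := hx
              have := congrFun hAB k
              simp only [decide_eq_decide] at this
              simp [f, this]
            | zero => simp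
            | add x y _ _ hx hy => rw [LinearMap.add_apply, hx, hy, add_zero]
            | smul c x _ hx => rw [LinearMap.smul_apply, hx, smul_zero]
          ext i
          have := hz (f i) (Submodule.subset_span ⟨i, rfl⟩)
          simp only [f, map_sub, LinearMap.comp_apply, Submodule.subtype_apply,
            LinearMap.proj_apply] at this
          by_cases h1 : i ∈ A <;> by_cases h2 : i ∈ B <;> simp [h1, h2] at this ⊢
    _ = 2 ^ Fintype.card κ := by simp
    _ ≤ _ := Nat.pow_le_pow_right (by norm_num) hcard

theorem traceCard_le_finrank {n : ℕ} {K : Type*} [Field K] (F : Finset (Finset (Fin n)))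
    (P : Finset (Fin n)) :
    traceCard F P ≤ 2 ^ Module.finrank K
      ((span K (charVec K '' (F : Set (Finset (Fin n))))).map (restrAlg K P).toLinearMap) := by
  classical
  have h1 : traceCard F P ≤ (F.image (fun A => A.subtype (· ∈ P))).card := by
    have : F.image (fun A => A ∩ P) =
        (F.image (fun A => A.subtype (· ∈ P))).image (fun B => B.map (Function.Embedding.subtype _)) := by
      rw [Finset.image_image]
      apply Finset.image_congr
      intro A _
      ext x
      simp [and_comm]
    unfold traceCard
    rw [this]
    exact Finset.card_image_le
  refine h1.trans (zero_one_card _ _ ?_)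
  intro B hB
  simp only [Finset.mem_image] at hB
  obtain ⟨A, hA, rfl⟩ := hB
  refine ⟨charVec K A, Submodule.subset_span ⟨A, hA, rfl⟩, ?_⟩
  funext j
  change charVec K A j.1 = _
  simp [charVec]

theorem kn_block {n : ℕ} {K : Type*} [Field K] [Infinite K] (C : Submodule K (Fin n → K)) (r : ℕ)
    (hr : 1 ≤ r) (P : Finset (Fin n)) (hP : P.Nonempty)
    (hPm : ∀ e ∈ C ^ r, charVec K P * e ∈ C ^ r)
    (hst : ∀ x : Fin n → K, (∀ e ∈ C ^ r, x * e ∈ C ^ r) → ∀ i ∈ P, ∀ j ∈ P, x i = x j)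
    (hC : ∀ i ∈ P, ∃ v ∈ C, v i ≠ 0) :
    r * Module.finrank K (C.map (restrAlg K P).toLinearMap) + 1 ≤ P.card + r := by
  classical
  have : Nonempty P := hP.to_subtype
  have h := kn_pow (C.map (restrAlg K P).toLinearMap) (fun i => by
    obtain ⟨v, hv, hvi⟩ := hC i.1 i.2
    exact ⟨_, ⟨v, hv, rfl⟩, hvi⟩) r hr (by
    rw [← Submodule.map_pow]
    intro x hx i j
    let y : Fin n → K := fun k => if hk : k ∈ P then x ⟨k, hk⟩ else 0
    have hy : ∀ k : P, y k.1 = x k := fun k => by simp [y]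
    rw [← hy, ← hy]
    refine hst y (fun e he => ?_) _ i.2 _ j.2
    obtain ⟨e', he', hee'⟩ := hx _ ⟨e, he, rfl⟩
    have : y * e = charVec K P * e' := by
      funext k
      by_cases hk : k ∈ P
      · have := congrFun hee' ⟨k, hk⟩
        change e' k = x ⟨k, hk⟩ * e k at this
        simp [y, charVec, hk, this]
      · simp [y, charVec, hk]
    rw [this]
    exact hPm _ he')
  simpa using h

/-- coordinates not separated by the family -/
def clsF {n : ℕ} (F : Finset (Finset (Fin n))) (x : Fin n) : Finset (Fin n) :=
  Finset.univ.filter (fun y => ∀ A ∈ F, x ∈ A ↔ y ∈ A)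

theorem mem_clsF {n : ℕ} {F : Finset (Finset (Fin n))} {x y : Fin n} :
    y ∈ clsF F x ↔ ∀ A ∈ F, x ∈ A ↔ y ∈ A := by
  simp [clsF]

/-- stabiliser subalgebra -/
def stabAlg {n : ℕ} {K : Type*} [Field K] (E : Submodule K (Fin n → K)) :
    Subalgebra K (Fin n → K) where
  carrier := {x | ∀ e ∈ E, x * e ∈ E}
  add_mem' := fun {a b} ha hb e he => by simpa [add_mul] using E.add_mem (ha e he) (hb e he)
  mul_mem' := fun {a b} ha hb e he => by simpa [mul_assoc] using ha _ (hb e he)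
  algebraMap_mem' := fun c e he => by
    rw [← Algebra.smul_def]
    exact E.smul_mem _ he

theorem mem_stabAlg {n : ℕ} {K : Type*} [Field K] {E : Submodule K (Fin n → K)} {x : Fin n → K} :
    x ∈ stabAlg E ↔ ∀ e ∈ E, x * e ∈ E := Iff.rfl

theorem dichotomy {n : ℕ} (K : Type*) [Field K] [Infinite K] (F : Finset (Finset (Fin n))) (r : ℕ)
    (hr : 1 ≤ r) :
    ∃ (B : Finset (Fin n)) (D : ℕ), traceCard F B ≤ 2 ^ D ∧ r * D ≤ 2 * B.card ∧
      (B.Nonempty → r ≤ B.card) ∧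
      ∀ x, x ∉ B → (∃ A ∈ F, x ∈ A) → (∀ y ∈ clsF F x, y ∉ B) ∧
        charVec K (clsF F x) ∈ (span K (charVec K '' (F : Set (Finset (Fin n))))) ^ r := by
  classical
  set C := span K (charVec K '' (F : Set (Finset (Fin n)))) with hCdef
  have hmemC : ∀ A ∈ F, charVec K A ∈ C := fun A hA => Submodule.subset_span ⟨A, hA, rfl⟩
  let H := stabAlg (C ^ r)
  let cl : Fin n → Finset (Fin n) := fun i => Finset.univ.filter (fun j => ∀ h ∈ H, h i = h j)
  have mem_cl : ∀ i j, j ∈ cl i ↔ ∀ h ∈ H, h i = h j := fun i j => by simp [cl]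
  have self_cl : ∀ i, i ∈ cl i := fun i => by rw [mem_cl]; intros; rfl
  have cl_eq : ∀ i j, j ∈ cl i → cl j = cl i := by
    intro i j hij
    rw [mem_cl] at hij
    ext k
    rw [mem_cl, mem_cl]
    constructor
    · intro h g hg; rw [hij g hg, h g hg]
    · intro h g hg; rw [← hij g hg, h g hg]
  have cl_mem : ∀ i, charVec K (cl i) ∈ H := by
    intro i
    have := kn_indicator_mem H i
    convert this using 1
    funext j
    simp [charVec, mem_cl]
  let dd : Finset (Fin n) → ℕ := fun P => Module.finrank K (C.map (restrAlg K P).toLinearMap)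
  have hvan : ∀ j, (¬ ∃ A ∈ F, j ∈ A) → ∀ e ∈ C ^ r, e j = 0 := by
    intro j hj
    have hC0 : ∀ c ∈ C, c j = 0 := by
      intro c hc
      induction hc using Submodule.span_induction with
      | mem x hx =>
        obtain ⟨A, hA, rfl⟩ := hx
        have : j ∉ A := fun h => hj ⟨A, hA, h⟩
        simp [charVec, this]
      | zero => rfl
      | add x y _ _ hx hy => simp [hx, hy]
      | smul c x _ hx => simp [hx]
    intro e he
    obtain ⟨s, rfl⟩ := Nat.exists_eq_add_of_le hr
    rw [add_comm, pow_succ] at he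
    induction he using Submodule.mul_induction_on' with
    | mem_mul_mem c hc d hd => simp [hC0 d hd]
    | add x _ y _ hx hy => simp [hx, hy]
  have hconst : ∀ x y, y ∈ clsF F x → ∀ e ∈ C ^ r, e x = e y := by
    intro x y hxy
    rw [mem_clsF] at hxy
    have hC0 : ∀ c ∈ C, c x = c y := by
      intro c hc
      induction hc using Submodule.span_induction with
      | mem z hz =>
        obtain ⟨A, hA, rfl⟩ := hz
        simp [charVec, hxy A hA]
      | zero => rfl
      | add x y _ _ hx hy => simp [hx, hy]
      | smul c x _ hx => simp [hx]
    have : ∀ s, ∀ e ∈ C ^ s, e x = e y := by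
      intro s
      induction s with
      | zero =>
        intro e he
        rw [pow_zero, Submodule.mem_one] at he
        obtain ⟨k, rfl⟩ := he
        rfl
      | succ s ih =>
        intro e he
        rw [pow_succ] at he
        induction he using Submodule.mul_induction_on' with
        | mem_mul_mem c hc d hd => simp [hC0 d hd, ih c hc]
        | add x _ y _ hx hy => simp [hx, hy]
    exact this r
  have hsupp : ∀ i j, (∃ A ∈ F, i ∈ A) → j ∈ cl i → ∃ A ∈ F, j ∈ A := by
    intro i j hi hj
    by_contra hno
    have hne : i ≠ j := by rintro rfl; exact hno hi
    have hs : (Pi.single j 1 : Fin n → K) ∈ H := by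
      intro e he
      have : (Pi.single j 1 : Fin n → K) * e = 0 := by
        funext k
        by_cases hk : k = j
        · subst hk; simp [hvan k hno e he]
        · simp [hk]
      rw [this]
      exact Submodule.zero_mem _
    have := (mem_cl i j).1 hj _ hs
    simp [hne] at this
  have hblock : ∀ i, (∃ A ∈ F, i ∈ A) → r * dd (cl i) + 1 ≤ (cl i).card + r := by
    intro i hi
    refine kn_block C r hr (cl i) ⟨i, self_cl i⟩ (cl_mem i) ?_ ?_
    · intro x hx j hj k hk
      rw [← (mem_cl i j).1 hj x hx, ← (mem_cl i k).1 hk x hx]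
    · intro j hj
      obtain ⟨A, hA, hjA⟩ := hsupp i j hi hj
      exact ⟨_, hmemC A hA, by simp [charVec, hjA]⟩
  let B : Finset (Fin n) := Finset.univ.filter (fun i => (∃ A ∈ F, i ∈ A) ∧ 2 ≤ dd (cl i))
  have memB : ∀ i, i ∈ B ↔ (∃ A ∈ F, i ∈ A) ∧ 2 ≤ dd (cl i) := fun i => by simp [B]
  have hclB : ∀ i ∈ B, cl i ⊆ B := by
    intro i hi j hj
    rw [memB] at hi ⊢
    exact ⟨hsupp i j hi.1 hj, by rw [cl_eq i j hj]; exact hi.2⟩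
  have hBU : B = (B.image cl).biUnion id := by
    ext j
    simp only [Finset.mem_biUnion, Finset.mem_image, id]
    constructor
    · intro hj; exact ⟨cl j, ⟨j, hj, rfl⟩, self_cl j⟩
    · rintro ⟨_, ⟨i, hi, rfl⟩, hj⟩; exact hclB i hi hj
  have hBcard : B.card = ∑ P ∈ B.image cl, P.card := by
    conv_lhs => rw [hBU]
    rw [Finset.card_biUnion]
    · rfl
    · intro P hP Q hQ hPQ
      obtain ⟨i, hi, rfl⟩ := Finset.mem_image.1 (Finset.mem_coe.1 hP)
      obtain ⟨j, hj, rfl⟩ := Finset.mem_image.1 (Finset.mem_coe.1 hQ)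
      rw [Function.onFun, Finset.disjoint_left]
      intro k hk hk'
      exact hPQ (by rw [← cl_eq i k hk, ← cl_eq j k hk'])
  refine ⟨B, ∑ P ∈ B.image cl, dd P, ?_, ?_, ?_, ?_⟩
  · have := traceCard_biUnion F (B.image cl) id dd
      (fun P _ => traceCard_le_finrank (K := K) F P)
    rw [← hBU] at this
    exact this
  · rw [hBcard, Finset.mul_sum, Finset.mul_sum]
    apply Finset.sum_le_sum
    intro P hP
    simp only [Finset.mem_image] at hP
    obtain ⟨i, hi, rfl⟩ := hP
    have h1 := (memB i).1 hi
    have h2 := hblock i h1.1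
    have h3 := Nat.mul_le_mul_left r h1.2
    omega
  · rintro ⟨i, hi⟩
    have h1 := (memB i).1 hi
    have h2 := hblock i h1.1
    have h3 := Nat.mul_le_mul_left r h1.2
    have := Finset.card_le_card (hclB i hi)
    omega
  · intro x hxB hx
    have hd : dd (cl x) ≤ 1 := by
      by_contra hcon
      exact hxB ((memB x).2 ⟨hx, by omega⟩)
    obtain ⟨v, hv⟩ := finrank_le_one_iff.1 hd
    have hsame : ∀ A ∈ F, ∀ i ∈ cl x, ∀ j ∈ cl x, i ∈ A → j ∈ A := by
      intro A hA i hi j hj hiA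
      by_contra hjA
      obtain ⟨A', hA', hjA'⟩ := hsupp x j hx hj
      obtain ⟨c, hc⟩ := hv ⟨_, ⟨charVec K A, hmemC A hA, rfl⟩⟩
      obtain ⟨c', hc'⟩ := hv ⟨_, ⟨charVec K A', hmemC A' hA', rfl⟩⟩
      have hc := congrArg Subtype.val hc
      have hc' := congrArg Subtype.val hc'
      have e1 : c * v.1 ⟨i, hi⟩ = charVec K A i := congrFun hc ⟨i, hi⟩
      have e2 : c * v.1 ⟨j, hj⟩ = charVec K A j := congrFun hc ⟨j, hj⟩
      have e3 : c' * v.1 ⟨j, hj⟩ = charVec K A' j := congrFun hc' ⟨j, hj⟩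
      simp only [charVec, hiA, hjA, hjA', if_true, if_false] at e1 e2 e3
      rcases mul_eq_zero.1 e2 with h | h
      · rw [h, zero_mul] at e1; exact zero_ne_one e1
      · rw [h, mul_zero] at e3; exact zero_ne_one e3
    have hP : charVec K (cl x) ∈ C ^ r := by
      obtain ⟨A, hA, hxA⟩ := hx
      have h1 : charVec K A ^ r = charVec K A := by
        funext j
        by_cases hj : j ∈ A
        · simp [charVec, hj]
        · have : r ≠ 0 := by omega
          simp [charVec, hj, this]
      have h2 := cl_mem x _ (Submodule.pow_mem_pow _ (hmemC A hA) r)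
      rw [h1] at h2
      convert h2 using 1
      funext j
      by_cases hj : j ∈ cl x
      · have := hsame A hA x (self_cl x) j hj hxA
        simp [charVec, hj, this]
      · simp [charVec, hj]
    have heq : cl x = clsF F x := by
      ext y
      constructor
      · intro hy
        rw [mem_clsF]
        intro A hA
        exact ⟨hsame A hA x (self_cl x) y hy, hsame A hA y hy x (self_cl x)⟩
      · intro hy
        have := hconst x y hy _ hP
        by_contra hno
        simp [charVec, self_cl x, hno] at this
    refine ⟨?_, heq ▸ hP⟩
    intro y hy hyB
    rw [← heq] at hy
    have := ((memB y).1 hyB).2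
    rw [cl_eq x y hy] at this
    omega

end BlockPart

section LiftPart

theorem charVec_prod {n k : ℕ} (A : Fin k → Finset (Fin n)) :
    ∏ i, charVec ℤ (A i) = charVec ℤ (Finset.univ.inf A) := by
  funext j
  rw [Finset.prod_apply]
  by_cases h : j ∈ Finset.univ.inf A
  · have h' := h
    rw [Finset.mem_inf] at h'
    simp only [charVec, h, if_true]
    exact Finset.prod_eq_one (fun i _ => by simp [h' i])
  · have h' := h
    rw [Finset.mem_inf] at h'
    push Not at h'
    obtain ⟨i, hi, hij⟩ := h'
    simp only [charVec, h, if_false]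
    exact Finset.prod_eq_zero hi (by simp [hij])

theorem sum_dvd {n k ℓ : ℕ} (F : Finset (Finset (Fin n))) (hdiv : kWiseDiv n k ℓ F)
    (t : ℕ) (ht : 1 ≤ t) (htk : t ≤ k) (v : Fin n → ℤ)
    (hv : v ∈ (span ℤ (charVec ℤ '' (F : Set (Finset (Fin n))))) ^ t) :
    (ℓ : ℤ) ∣ ∑ i, v i := by
  classical
  set M := span ℤ (charVec ℤ '' (F : Set (Finset (Fin n)))) with hM
  have hle : M ≤ M * M := by
    rw [hM, Submodule.span_le]
    rintro _ ⟨A, hA, rfl⟩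
    have hm : charVec ℤ A ∈ M := Submodule.subset_span ⟨A, hA, rfl⟩
    have := Submodule.mul_mem_mul hm hm
    have h2 : charVec ℤ A * charVec ℤ A = charVec ℤ A := by
      funext j
      simp [charVec]
    rw [h2] at this
    exact this
  have hmono : ∀ s, t ≤ s → M ^ t ≤ M ^ s := by
    intro s hs
    induction s, hs using Nat.le_induction with
    | base => exact le_rfl
    | succ s hs ih =>
      refine ih.trans ?_
      obtain ⟨u, rfl⟩ := Nat.exists_eq_add_of_le (ht.trans hs)
      rw [add_comm 1 u, pow_succ M (u + 1), pow_succ M u, mul_assoc]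
      exact mul_le_mul_right hle _
  have hk := hmono k htk hv
  clear hv
  rw [hM, Submodule.span_pow] at hk
  induction hk using Submodule.span_induction with
  | mem x hx =>
    rw [Set.mem_pow] at hx
    obtain ⟨f, rfl⟩ := hx
    have hf : ∀ i, ∃ A ∈ F, charVec ℤ A = (f i : Fin n → ℤ) := fun i => (f i).2
    choose A hA hAf using hf
    have h1 : (List.ofFn fun i => (f i : Fin n → ℤ)).prod = charVec ℤ (Finset.univ.inf A) := by
      rw [List.prod_ofFn, ← charVec_prod]
      exact Finset.prod_congr rfl (fun i _ => (hAf i).symm)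
    rw [h1]
    have := hdiv A hA
    have h2 : ∑ i, charVec ℤ (Finset.univ.inf A) i = ((Finset.univ.inf A).card : ℤ) := by
      simp [charVec]
    rw [h2]
    exact_mod_cast this
  | zero => simp
  | add x y _ _ hx hy =>
    simp only [Pi.add_apply, Finset.sum_add_distrib]
    exact dvd_add hx hy
  | smul c x _ hx =>
    simp only [Pi.smul_apply, smul_eq_mul, ← Finset.mul_sum]
    exact hx.mul_left c

theorem lift_mod {n p : ℕ} [Fact p.Prime] {K : Type*} [Field K]
    (F : Finset (Finset (Fin n))) (r : ℕ) (x : Fin n → K)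
    (hx : x ∈ (span K (charVec K '' (F : Set (Finset (Fin n))))) ^ r) :
    ∀ φ : K →+ ZMod p, ∃ v ∈ (span ℤ (charVec ℤ '' (F : Set (Finset (Fin n))))) ^ r,
      ∀ i, ((v i : ℤ) : ZMod p) = φ (x i) := by
  rw [Submodule.span_pow] at hx
  rw [Submodule.span_pow]
  induction hx using Submodule.span_induction with
  | mem x hx =>
    intro φ
    let g : (Fin n → ℤ) →+* (Fin n → K) := (Int.castRingHom K).compLeft (Fin n)
    have himg : charVec K '' (F : Set (Finset (Fin n))) =
        g '' (charVec ℤ '' (F : Set (Finset (Fin n)))) := by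
      rw [Set.image_image]
      apply Set.image_congr
      intro A _
      funext j
      by_cases hj : j ∈ A <;> simp [g, charVec, hj]
    rw [himg, ← Set.image_pow] at hx
    obtain ⟨w, hw, rfl⟩ := hx
    obtain ⟨z, hz⟩ := ZMod.intCast_surjective (φ 1)
    refine ⟨z • w, Submodule.smul_mem _ _ (Submodule.subset_span hw), ?_⟩
    intro i
    have h1 : g w i = w i • (1 : K) := by simp [g]
    rw [h1, map_zsmul, ← hz]
    simp [mul_comm]
  | zero => intro φ; exact ⟨0, Submodule.zero_mem _, by simp⟩
  | add x y _ _ hx hy =>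
    intro φ
    obtain ⟨v, hv, hv'⟩ := hx φ
    obtain ⟨w, hw, hw'⟩ := hy φ
    exact ⟨v + w, Submodule.add_mem _ hv hw, fun i => by simp [hv', hw']⟩
  | smul c x _ hx =>
    intro φ
    obtain ⟨v, hv, hv'⟩ := hx (φ.comp (AddMonoidHom.mulLeft c))
    exact ⟨v, hv, fun i => by simp [hv']⟩

theorem lift_dvd {n p k ℓ : ℕ} [Fact p.Prime]
    (F : Finset (Finset (Fin n))) (hdiv : kWiseDiv n k ℓ F) (r t : ℕ) (hr : 1 ≤ r)
    (P : Finset (Fin n))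
    (hP : charVec (AlgebraicClosure (ZMod p)) P ∈
      (span (AlgebraicClosure (ZMod p))
        (charVec (AlgebraicClosure (ZMod p)) '' (F : Set (Finset (Fin n))))) ^ r)
    (hk : r * p ^ t ≤ k) (hpl : p ^ (t + 1) ∣ ℓ) : p ^ (t + 1) ∣ P.card := by
  obtain ⟨φ, hφ⟩ := (Algebra.linearMap (ZMod p)
    (AlgebraicClosure (ZMod p))).exists_leftInverse_of_injective
      (LinearMap.ker_eq_bot.2 (FaithfulSMul.algebraMap_injective _ _))
  have hφ1 : φ 1 = 1 := by
    have := LinearMap.congr_fun hφ 1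
    simpa using this
  obtain ⟨v, hv, hv'⟩ := lift_mod (p := p) F r _ hP φ.toAddMonoidHom
  have h1 : ∀ i, (p : ℤ) ∣ v i - charVec ℤ P i := by
    intro i
    rw [← ZMod.intCast_zmod_eq_zero_iff_dvd]
    push_cast
    rw [hv' i]
    by_cases hi : i ∈ P <;> simp [charVec, hi, hφ1]
  have h2 : ∀ i, ((p : ℤ) ^ (t + 1)) ∣ v i ^ p ^ t - charVec ℤ P i := by
    intro i
    have := dvd_sub_pow_of_dvd_sub (h1 i) t
    have h3 : charVec ℤ P i ^ p ^ t = charVec ℤ P i := by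
      have : p ≠ 0 := (Fact.out : p.Prime).ne_zero
      by_cases hi : i ∈ P <;> simp [charVec, hi, this]
    rwa [h3] at this
  have h4 := sum_dvd F hdiv (r * p ^ t)
    (Nat.mul_pos hr (pow_pos (Fact.out : p.Prime).pos _)) hk (v ^ p ^ t) (by
      rw [pow_mul]; exact Submodule.pow_mem_pow _ hv _)
  have h5 : ((p : ℤ) ^ (t + 1)) ∣ ∑ i, (v ^ p ^ t) i :=
    dvd_trans (by exact_mod_cast hpl) h4
  have h6 : ((p : ℤ) ^ (t + 1)) ∣ ∑ i, ((v ^ p ^ t) i - charVec ℤ P i) :=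
    Finset.dvd_sum (fun i _ => h2 i)
  rw [Finset.sum_sub_distrib] at h6
  have h7 := (dvd_sub_right h5).1 h6
  have h8 : ∑ i, charVec ℤ P i = (P.card : ℤ) := by simp [charVec]
  rw [h8] at h7
  exact_mod_cast h7

theorem arith_prime {ℓ p : ℕ} (hℓ : 0 < ℓ) (hp : p ∈ ℓ.primeFactors) :
    2 * ℓ.primeFactors.card * p ^ (ℓ.factorization p - 1) ≤ ℓ := by
  have hpp := Nat.prime_of_mem_primeFactors hp
  set a := ℓ.factorization p with ha
  have ha1 : 1 ≤ a := hpp.factorization_pos_of_dvd hℓ.ne' (Nat.dvd_of_mem_primeFactors hp)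
  set m := ℓ / p ^ a with hm
  have hlm : p ^ a * m = ℓ := Nat.ordProj_mul_ordCompl_eq_self ℓ p
  have hm0 : 0 < m := Nat.pos_of_ne_zero (by rintro h; rw [h] at hlm; omega)
  have hpf : m.primeFactors = ℓ.primeFactors.erase p := by
    rw [← Nat.support_factorization, hm, Nat.factorization_ordCompl]
    simp
  have hcard : m.primeFactors.card + 1 = ℓ.primeFactors.card := by
    rw [hpf]; exact Finset.card_erase_add_one hp
  have h1 : 2 ^ m.primeFactors.card ≤ m := by
    refine le_trans ?_ (Nat.le_of_dvd hm0 m.prod_primeFactors_dvd)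
    exact Finset.pow_card_le_prod _ _ _ (fun q hq => (Nat.prime_of_mem_primeFactors hq).two_le)
  have h2 : m.primeFactors.card < 2 ^ m.primeFactors.card := Nat.lt_two_pow_self
  have h3 : p ^ a = p ^ (a - 1) * p := by rw [← pow_succ]; congr 1; omega
  calc 2 * ℓ.primeFactors.card * p ^ (a - 1) ≤ p * m * p ^ (a - 1) := by
        apply Nat.mul_le_mul_right
        exact Nat.mul_le_mul hpp.two_le (by omega)
    _ = p ^ a * m := by rw [h3]; ring
    _ = ℓ := hlm

end LiftPart


theorem clsF_eq {n : ℕ} {F : Finset (Finset (Fin n))} {x y : Fin n} (h : y ∈ clsF F x) :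
    clsF F y = clsF F x := by
  rw [mem_clsF] at h
  ext z
  rw [mem_clsF, mem_clsF]
  exact forall₂_congr (fun A hA => by rw [h A hA])

theorem self_clsF {n : ℕ} (F : Finset (Finset (Fin n))) (x : Fin n) : x ∈ clsF F x := by
  rw [mem_clsF]; intros; rfl

theorem traceCard_clsF {n : ℕ} (F : Finset (Finset (Fin n))) (x : Fin n) :
    traceCard F (clsF F x) ≤ 2 ^ 1 := by
  classical
  have hsub : F.image (fun A => A ∩ clsF F x) ⊆ {∅, clsF F x} := by
    intro X hX
    obtain ⟨A, hA, rfl⟩ := Finset.mem_image.1 hX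
    rw [Finset.mem_insert, Finset.mem_singleton]
    by_cases hx : x ∈ A
    · right
      rw [Finset.inter_eq_right]
      intro y hy
      exact (mem_clsF.1 hy A hA).1 hx
    · left
      rw [← Finset.disjoint_iff_inter_eq_empty, Finset.disjoint_left]
      intro y hyA hy
      exact hx ((mem_clsF.1 hy A hA).2 hyA)
  exact (Finset.card_le_card hsub).trans Finset.card_le_two

theorem prime_step {n ℓ : ℕ} (hℓ : 0 < ℓ) (F : Finset (Finset (Fin n)))
    (hdiv : kWiseDiv n (4 * ℓ ^ 2) ℓ F) (p : ℕ) (hp : p ∈ ℓ.primeFactors) :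
    ∃ (B : Finset (Fin n)) (D : ℕ), traceCard F B ≤ 2 ^ D ∧
      (8 * ℓ.primeFactors.card * ℓ) * D ≤ 2 * B.card ∧
      (B.Nonempty → 8 * ℓ.primeFactors.card * ℓ ≤ B.card) ∧
      ∀ x, x ∉ B → (∃ A ∈ F, x ∈ A) → (∀ y ∈ clsF F x, y ∉ B) ∧
        p ^ (ℓ.factorization p) ∣ (clsF F x).card := by
  have hpp := Nat.prime_of_mem_primeFactors hp
  have : Fact p.Prime := ⟨hpp⟩
  have hω : 0 < ℓ.primeFactors.card := Finset.card_pos.2 ⟨p, hp⟩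
  have hr : 1 ≤ 8 * ℓ.primeFactors.card * ℓ := by
    have : 0 < 8 * ℓ.primeFactors.card * ℓ := by positivity
    omega
  obtain ⟨B, D, h1, h2, h3, h4⟩ := dichotomy (AlgebraicClosure (ZMod p)) F
    (8 * ℓ.primeFactors.card * ℓ) hr
  refine ⟨B, D, h1, h2, h3, fun x hx hxs => ⟨(h4 x hx hxs).1, ?_⟩⟩
  have ha1 : 1 ≤ ℓ.factorization p :=
    hpp.factorization_pos_of_dvd hℓ.ne' (Nat.dvd_of_mem_primeFactors hp)
  obtain ⟨t, ht⟩ := Nat.exists_eq_add_of_le ha1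
  have hle := arith_prime hℓ hp
  have ht' : ℓ.factorization p - 1 = t := by omega
  rw [ht'] at hle
  have hpl : p ^ (t + 1) ∣ ℓ := by
    have := Nat.ordProj_dvd ℓ p
    rwa [ht, add_comm] at this
  rw [ht, add_comm]
  refine lift_dvd F hdiv _ t hr _ (h4 x hx hxs).2 ?_ hpl
  calc 8 * ℓ.primeFactors.card * ℓ * p ^ t
      = 4 * ℓ * (2 * ℓ.primeFactors.card * p ^ t) := by ring
    _ ≤ 4 * ℓ * ℓ := Nat.mul_le_mul_left _ hle
    _ = 4 * ℓ ^ 2 := by ring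

/-- large 4ℓ²-wise ℓ-divisible families are contained in an atomic
family with atoms of size ℓ. -/
theorem statement3 (n ℓ : ℕ) (hℓ : 0 < ℓ) (𝓕 : Finset (Finset (Fin n)))
    (hdiv : kWiseDiv n (4 * ℓ ^ 2) ℓ 𝓕)
    (hcard : (2 : ℝ) ^ (((n / ℓ : ℕ) : ℤ) - 1) < (𝓕.card : ℝ)) :
    ∃ 𝒜 : Finset (Finset (Fin n)),
      (∀ A ∈ 𝒜, A.card = ℓ) ∧
      (∀ A ∈ 𝒜, ∀ B ∈ 𝒜, A ≠ B → Disjoint A B) ∧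
      (∀ B ∈ 𝓕, ∃ 𝒮 ⊆ 𝒜, B = 𝒮.sup id) := by
  classical
  have hstep : ∀ p, ∃ (B : Finset (Fin n)) (D : ℕ), p ∈ ℓ.primeFactors →
      traceCard 𝓕 B ≤ 2 ^ D ∧
      (8 * ℓ.primeFactors.card * ℓ) * D ≤ 2 * B.card ∧
      (B.Nonempty → 8 * ℓ.primeFactors.card * ℓ ≤ B.card) ∧
      ∀ x, x ∉ B → (∃ A ∈ 𝓕, x ∈ A) → (∀ y ∈ clsF 𝓕 x, y ∉ B) ∧
        p ^ (ℓ.factorization p) ∣ (clsF 𝓕 x).card := by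
    intro p
    by_cases hp : p ∈ ℓ.primeFactors
    · obtain ⟨B, D, h⟩ := prime_step hℓ 𝓕 hdiv p hp
      exact ⟨B, D, fun _ => h⟩
    · exact ⟨∅, 0, fun h => absurd h hp⟩
  choose B D hBD using hstep
  set ω := ℓ.primeFactors.card with hω
  set BB := ℓ.primeFactors.biUnion B with hBB
  set DD := ∑ p ∈ ℓ.primeFactors, D p with hDD
  have hT : traceCard 𝓕 BB ≤ 2 ^ DD :=
    traceCard_biUnion 𝓕 _ B D (fun p hp => (hBD p hp).1)
  have hrD : 8 * ω * ℓ * DD ≤ 2 * ω * BB.card := by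
    calc 8 * ω * ℓ * DD = ∑ p ∈ ℓ.primeFactors, 8 * ω * ℓ * D p := by rw [hDD, Finset.mul_sum]
      _ ≤ ∑ p ∈ ℓ.primeFactors, 2 * BB.card := by
          apply Finset.sum_le_sum
          intro p hp
          refine (hBD p hp).2.1.trans (Nat.mul_le_mul_left _ (Finset.card_le_card ?_))
          exact Finset.subset_biUnion_of_mem B hp
      _ = 2 * ω * BB.card := by rw [Finset.sum_const, smul_eq_mul, ← hω]; ring
  let U : Finset (Fin n) := Finset.univ.filter (fun x => x ∉ BB ∧ ∃ A ∈ 𝓕, x ∈ A)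
  have memU : ∀ x, x ∈ U ↔ x ∉ BB ∧ ∃ A ∈ 𝓕, x ∈ A := fun x => by simp [U]
  have hnot : ∀ x, x ∉ BB → ∀ p ∈ ℓ.primeFactors, x ∉ B p := by
    intro x hx p hp hxp
    exact hx (Finset.mem_biUnion.2 ⟨p, hp, hxp⟩)
  have hclU : ∀ x ∈ U, clsF 𝓕 x ⊆ U := by
    intro x hx y hy
    rw [memU] at hx ⊢
    obtain ⟨hxB, A, hA, hxA⟩ := hx
    refine ⟨fun hyB => ?_, A, hA, (mem_clsF.1 hy A hA).1 hxA⟩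
    obtain ⟨p, hp, hyp⟩ := Finset.mem_biUnion.1 hyB
    exact ((hBD p hp).2.2.2 x (hnot x hxB p hp) ⟨A, hA, hxA⟩).1 y hy hyp
  have hdvd : ∀ x ∈ U, ℓ ∣ (clsF 𝓕 x).card := by
    intro x hx
    rw [memU] at hx
    rw [Nat.dvd_iff_prime_pow_dvd_dvd]
    intro p k hp hpk
    rcases Nat.eq_zero_or_pos k with rfl | hk
    · simp
    have hmem : p ∈ ℓ.primeFactors :=
      Nat.mem_primeFactors.2 ⟨hp, (dvd_pow_self p hk.ne').trans hpk, hℓ.ne'⟩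
    refine (pow_dvd_pow p ?_).trans
      ((hBD p hmem).2.2.2 x (hnot x hx.1 p hmem) hx.2).2
    exact (hp.pow_dvd_iff_le_factorization hℓ.ne').1 hpk
  set 𝒜 := U.image (clsF 𝓕) with h𝒜
  have hUU : U = 𝒜.biUnion id := by
    ext j
    simp only [h𝒜, Finset.mem_biUnion, Finset.mem_image, id]
    constructor
    · intro hj; exact ⟨clsF 𝓕 j, ⟨j, hj, rfl⟩, self_clsF 𝓕 j⟩
    · rintro ⟨_, ⟨i, hi, rfl⟩, hj⟩; exact hclU i hi hj
  have hdisj : ∀ A ∈ 𝒜, ∀ B ∈ 𝒜, A ≠ B → Disjoint A B := by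
    intro P hP Q hQ hPQ
    obtain ⟨i, hi, rfl⟩ := Finset.mem_image.1 hP
    obtain ⟨j, hj, rfl⟩ := Finset.mem_image.1 hQ
    rw [Finset.disjoint_left]
    intro k hk hk'
    exact hPQ (by rw [← clsF_eq hk, ← clsF_eq hk'])
  have hUcard : U.card = ∑ P ∈ 𝒜, P.card := by
    conv_lhs => rw [hUU]
    rw [Finset.card_biUnion]
    · rfl
    · intro P hP Q hQ hPQ
      exact hdisj P hP Q hQ hPQ
  have hge : ∀ P ∈ 𝒜, ℓ ∣ P.card ∧ ℓ ≤ P.card := by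
    intro P hP
    obtain ⟨i, hi, rfl⟩ := Finset.mem_image.1 hP
    exact ⟨hdvd i hi, Nat.le_of_dvd (Finset.card_pos.2 ⟨i, self_clsF 𝓕 i⟩) (hdvd i hi)⟩
  have hTU : traceCard 𝓕 U ≤ 2 ^ 𝒜.card := by
    have := traceCard_biUnion 𝓕 𝒜 id (fun _ => 1) (by
      intro P hP
      obtain ⟨i, hi, rfl⟩ := Finset.mem_image.1 hP
      exact traceCard_clsF 𝓕 i)
    rw [← hUU] at this
    simpa using this
  let Z : Finset (Fin n) := Finset.univ.filter (fun x => ¬ ∃ A ∈ 𝓕, x ∈ A)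
  have hTZ : traceCard 𝓕 Z ≤ 1 := by
    have hsub : 𝓕.image (fun A => A ∩ Z) ⊆ {∅} := by
      intro X hX
      obtain ⟨A, hA, rfl⟩ := Finset.mem_image.1 hX
      rw [Finset.mem_singleton, ← Finset.disjoint_iff_inter_eq_empty, Finset.disjoint_left]
      intro y hyA hy
      exact (Finset.mem_filter.1 hy).2 ⟨A, hA, hyA⟩
    exact Finset.card_le_card hsub
  have huniv : (Finset.univ : Finset (Fin n)) = (BB ∪ U) ∪ Z := by
    ext x
    simp only [Finset.mem_univ, Finset.mem_union, memU, Z, Finset.mem_filter, true_and, true_iff]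
    by_cases h1 : x ∈ BB <;> by_cases h2 : ∃ A ∈ 𝓕, x ∈ A <;> simp only [h1, h2, true_or, or_true, not_true, not_false_iff, and_self]
  have hF : 𝓕.card ≤ 2 ^ (DD + 𝒜.card) := by
    have h1 : 𝓕.card = traceCard 𝓕 Finset.univ := by simp [traceCard]
    rw [h1, huniv, pow_add]
    calc _ ≤ traceCard 𝓕 (BB ∪ U) * traceCard 𝓕 Z := traceCard_union _ _ _
      _ ≤ (traceCard 𝓕 BB * traceCard 𝓕 U) * 1 := Nat.mul_le_mul (traceCard_union _ _ _) hTZ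
      _ ≤ _ := by rw [mul_one]; exact Nat.mul_le_mul hT hTU
  have hn : n / ℓ ≤ DD + 𝒜.card := by
    have h1 : (2 : ℝ) ^ (((n / ℓ : ℕ) : ℤ) - 1) < (2 : ℝ) ^ (((DD + 𝒜.card : ℕ) : ℤ)) := by
      refine hcard.trans_le ?_
      rw [zpow_natCast]
      exact_mod_cast hF
    have h2 := (zpow_lt_zpow_iff_right₀ (by norm_num : (1 : ℝ) < 2)).1 h1
    omega
  have hn2 : n < ℓ * (DD + 𝒜.card + 1) := by
    have := Nat.lt_mul_div_succ n hℓ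
    refine this.trans_le (Nat.mul_le_mul_left _ (by omega))
  have hdisjBU : Disjoint BB U := by
    rw [Finset.disjoint_left]
    intro x hx hxU
    exact ((memU x).1 hxU).1 hx
  have hBUn : BB.card + U.card ≤ n := by
    rw [← Finset.card_union_of_disjoint hdisjBU]
    exact (Finset.card_le_univ _).trans (by simp)
  have hUge : ℓ * 𝒜.card ≤ U.card := by
    rw [hUcard, mul_comm, ← smul_eq_mul]
    exact Finset.card_nsmul_le_sum _ _ _ (fun P hP => (hge P hP).2)
  have hBempty : BB = ∅ := by
    by_contra hne
    obtain ⟨x, hx⟩ := Finset.nonempty_iff_ne_empty.2 hne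
    obtain ⟨p, hp, hxp⟩ := Finset.mem_biUnion.1 hx
    have hωpos : 0 < ω := Finset.card_pos.2 ⟨p, hp⟩
    have h1 := (hBD p hp).2.2.1 ⟨x, hxp⟩
    have h2 := Finset.card_le_card (Finset.subset_biUnion_of_mem B hp)
    have h3 : 8 * ℓ ≤ BB.card := by
      refine le_trans ?_ (h1.trans h2)
      nlinarith
    have h4 : 4 * (ℓ * DD) ≤ BB.card := by
      refine Nat.le_of_mul_le_mul_left (c := 2 * ω) ?_ (Nat.mul_pos (by norm_num) hωpos)
      calc 2 * ω * (4 * (ℓ * DD)) = 8 * ω * ℓ * DD := by ring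
        _ ≤ _ := hrD
    have h5 : ℓ * (DD + 𝒜.card + 1) = ℓ * DD + ℓ * 𝒜.card + ℓ := by ring
    omega
  have hDD0 : ℓ * DD = 0 := by
    have hz : DD = 0 := by
      apply Finset.sum_eq_zero
      intro p hp
      have hωpos : 0 < ω := Finset.card_pos.2 ⟨p, hp⟩
      have h1 := (hBD p hp).2.1
      have h2 := Finset.card_le_card (Finset.subset_biUnion_of_mem B hp)
      rw [← hBB, hBempty, Finset.card_empty] at h2
      have h3 : 8 * ω * ℓ * D p = 0 := by omega
      have h4 : 8 * ω * ℓ ≠ 0 :=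
        (Nat.mul_pos (Nat.mul_pos (by norm_num) hωpos) hℓ).ne'
      exact (Nat.mul_eq_zero.1 h3).resolve_left h4
    rw [hz, mul_zero]
  refine ⟨𝒜, ?_, hdisj, ?_⟩
  · intro P hP
    by_contra hne
    obtain ⟨⟨c, hc⟩, h2⟩ := hge P hP
    have h3 : 2 * ℓ ≤ P.card := by
      have : c ≠ 0 := by rintro rfl; omega
      have : c ≠ 1 := by rintro rfl; omega
      have : 2 ≤ c := by omega
      rw [hc, mul_comm]
      exact Nat.mul_le_mul_left _ this
    have h4 := Finset.add_sum_erase 𝒜 (fun P => P.card) hP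
    have h5 : (𝒜.erase P).card * ℓ ≤ ∑ Q ∈ 𝒜.erase P, Q.card := by
      rw [← smul_eq_mul]
      exact Finset.card_nsmul_le_sum _ _ _ (fun Q hQ => (hge Q (Finset.mem_of_mem_erase hQ)).2)
    have h6 := Finset.card_erase_add_one hP
    have h7 : ℓ * (DD + 𝒜.card + 1) = ℓ * DD + (𝒜.erase P).card * ℓ + 2 * ℓ := by
      rw [← h6]; ring
    omega
  · intro S hS
    refine ⟨𝒜.filter (· ⊆ S), Finset.filter_subset _ _, ?_⟩
    ext x
    rw [Finset.mem_sup]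
    constructor
    · intro hx
      have hxU : x ∈ U := (memU x).2 ⟨by rw [hBempty]; simp, S, hS, hx⟩
      refine ⟨clsF 𝓕 x, Finset.mem_filter.2 ⟨Finset.mem_image_of_mem _ hxU, ?_⟩, self_clsF 𝓕 x⟩
      intro y hy
      exact (mem_clsF.1 hy S hS).1 hx
    · rintro ⟨P, hP, hxP⟩
      exact (Finset.mem_filter.1 hP).2 hxP
end
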